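/- Let 1 < a < b with b > 4 and ab even. Then P(V_{a,b})/(SL₂(ℂ)×SL₂(ℂ)) is birational to ℂ^{a(b+1)−3} × (P(V_b)/SL₂(ℂ)); that is, the field of SL₂×SL₂-invariant rational functions on P(V_{a,b}) is a purely transcendental extension of transcendence degree a(b+1)−3 of the field of SL₂-invariant rational functions on P(V_b). -/

import Mathlib

set_option synthInstance.maxHeartbeats 1000000
set_option maxHeartbeats 1000000
noncomputable section
open MvPolynomial

/-- The field of invariant rational functions: the subfield of the fraction field of `R`
consisting of elements fixed by a family of `ℂ`-algebra endomorphisms of `R`. -/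
def invariantField (R : Type*) [CommRing R] [IsDomain R] [Algebra ℂ R]
    {ι : Type*} (φ : ι → (R →ₐ[ℂ] R)) : IntermediateField ℂ (FractionRing R) where
  carrier := {x | ∃ f g : R, g ≠ 0 ∧
      x = algebraMap R (FractionRing R) f / algebraMap R (FractionRing R) g ∧
      ∀ i, φ i f * g = φ i g * f}
  mul_mem' := by
    rintro x y ⟨f, g, hg, rfl, hf⟩ ⟨p, q, hq, rfl, hp⟩
    exact ⟨f * p, g * q, mul_ne_zero hg hq,
      by rw [map_mul, map_mul, div_mul_div_comm],
      fun i => by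
        simp only [map_mul]
        linear_combination (φ i p * q) * hf i + (φ i g * f) * hp i⟩
  one_mem' := ⟨1, 1, one_ne_zero, by simp, fun i => rfl⟩
  add_mem' := by
    rintro x y ⟨f, g, hg, rfl, hf⟩ ⟨p, q, hq, rfl, hp⟩
    have hg' : algebraMap R (FractionRing R) g ≠ 0 :=
      fun h => hg ((map_eq_zero_iff _ (IsFractionRing.injective R (FractionRing R))).mp h)
    have hq' : algebraMap R (FractionRing R) q ≠ 0 :=
      fun h => hq ((map_eq_zero_iff _ (IsFractionRing.injective R (FractionRing R))).mp h)
    refine ⟨f * q + g * p, g * q, mul_ne_zero hg hq, ?_, fun i => ?_⟩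
    · rw [map_add, map_mul, map_mul, map_mul, div_add_div _ _ hg' hq']
    · simp only [map_add, map_mul]
      linear_combination (φ i q * q) * hf i + (φ i g * g) * hp i
  zero_mem' := ⟨0, 1, one_ne_zero, by simp, fun i => by simp⟩
  algebraMap_mem' := fun c =>
    ⟨algebraMap ℂ R c, 1, one_ne_zero,
      by rw [map_one, div_one, ← IsScalarTower.algebraMap_apply],
      fun i => by simp [AlgHom.commutes]⟩
  inv_mem' := by
    rintro x ⟨f, g, hg, rfl, hf⟩
    by_cases hf0 : f = 0
    · exact ⟨0, 1, one_ne_zero, by simp [hf0], fun i => by simp⟩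
    · exact ⟨g, f, hf0, by rw [inv_div], fun i => (hf i).symm⟩

abbrev SL2 := Matrix.SpecialLinearGroup (Fin 2) ℂ

/-- The action of `SL₂(ℂ)` on binary forms by linear substitution of the variables. -/
def sub1 (g : SL2) : MvPolynomial (Fin 2) ℂ →ₐ[ℂ] MvPolynomial (Fin 2) ℂ :=
  aeval fun i => ∑ j, C (g.1 i j) * X j

/-- The matrix of the action of `g` on `V_d` in the basis of monomials `X^i Y^(d-i)`. -/
def repMat (d : ℕ) (g : SL2) (i j : Fin (d + 1)) : ℂ :=
  coeff (Finsupp.single 0 (i : ℕ) + Finsupp.single 1 (d - (i : ℕ)))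
    (sub1 g (X 0 ^ (j : ℕ) * X 1 ^ (d - (j : ℕ))))

/-- The endomorphism of the coordinate ring of `V_{a,b} = V_a ⊗ V_b` induced by
`(g, h) ∈ SL₂ × SL₂` together with the scaling by `t` (so that invariance under the
scalings expresses that a rational function descends to the projectivization). -/
def coordHomAB (a b : ℕ) (g h : SL2) (t : ℂˣ) :
    MvPolynomial (Fin (a + 1) × Fin (b + 1)) ℂ →ₐ[ℂ]
      MvPolynomial (Fin (a + 1) × Fin (b + 1)) ℂ :=
  aeval fun p => (t : ℂ) • ∑ q, C (repMat a g p.1 q.1 * repMat b h p.2 q.2) * X q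

/-- The field `ℂ(P(V_{a,b}))^{SL₂×SL₂}` of `SL₂(ℂ) × SL₂(ℂ)`-invariant rational functions on
the projective space of biforms of bidegree `(a,b)`, realized as the field of rational
functions in the coefficient coordinates (indexed by `Fin (a+1) × Fin (b+1)`) that are
invariant under the induced linear action and under scaling. -/
def invFieldAB (a b : ℕ) :
    IntermediateField ℂ (FractionRing (MvPolynomial (Fin (a + 1) × Fin (b + 1)) ℂ)) :=
  invariantField _ fun γ : SL2 × SL2 × ℂˣ => coordHomAB a b γ.1 γ.2.1 γ.2.2


/-- The endomorphism of the coordinate ring of `V_b` induced by `g ∈ SL₂` together with the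
scaling by `t`. -/
def coordHomB (b : ℕ) (g : SL2) (t : ℂˣ) :
    MvPolynomial (Fin (b + 1)) ℂ →ₐ[ℂ] MvPolynomial (Fin (b + 1)) ℂ :=
  aeval fun i => (t : ℂ) • ∑ j, C (repMat b g i j) * X j

/-- The field `ℂ(P(V_b))^{SL₂}` of invariant rational functions on the projective space of
binary forms of degree `b`. -/
def invFieldB (b : ℕ) :
    IntermediateField ℂ (FractionRing (MvPolynomial (Fin (b + 1)) ℂ)) :=
  invariantField _ fun γ : SL2 × ℂˣ => coordHomB b γ.1 γ.2

namespace QB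
open Matrix
local notation:max "FS" n:max => Fin (n + 1)
local notation:max "MM" n:max m:max R:max => Matrix (Fin (n + 1)) (Fin (m + 1)) R
local notation:max "M2" R:max => Matrix (Fin 2) (Fin 2) R
local notation:max "M3" R:max => Matrix (Fin 3) (Fin 3) R
local notation:max "AI" x:max => AlgebraicIndependent ℂ x
local notation:max "IF" K:max => IntermediateField ℂ K
local notation:max "AE" K:max => K →ₐ[ℂ] K
local notation:max "aM" K:max => algebraMap ℂ K

section rep
variable {R : Type*} [CommRing R] {S : Type*} [CommRing S]

/-- the vector of monomials -/
def mon (d : ℕ) (x y : R) : FS d → R := fun i => x ^ (i : ℕ) * y ^ (d - (i : ℕ))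

def cfp {d : ℕ} (v : FS d → R) : Polynomial R := ∑ i, Polynomial.C (v i) * Polynomial.X ^ (i : ℕ)

lemma cfp_coeff {d : ℕ} (v : FS d → R) (i : FS d) : (cfp v).coeff i = v i := by
  unfold cfp
  simp only [Polynomial.finsetSum_coeff, Polynomial.coeff_C_mul, Polynomial.coeff_X_pow]
  rw [Finset.sum_eq_single i]
  · simp
  · intro j _ hj
    rw [if_neg (fun h => hj (Fin.ext h.symm)), mul_zero]
  · simp

lemma cfp_natDegree {d : ℕ} (v : FS d → R) : (cfp v).natDegree ≤ d := by
  unfold cfp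
  refine Polynomial.natDegree_sum_le_of_forall_le _ _ fun i _ => ?_
  exact (Polynomial.natDegree_C_mul_X_pow_le _ _).trans (by omega)

/-- homogeneous evaluation -/
def hm (d : ℕ) (p : Polynomial R) (x y : R) : R := mon d x y ⬝ᵥ fun i => p.coeff i

lemma hm_eq (d : ℕ) (p : Polynomial R) (x y : R) :
    hm d p x y = MvPolynomial.aeval ![x, y] (p.homogenize d) := by
  unfold hm mon Polynomial.homogenize
  simp only [dotProduct, map_sum]
  rw [Finset.Nat.sum_antidiagonal_eq_sum_range_succ_mk, ← Fin.sum_univ_eq_sum_range (n := d+1)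
    (fun k => (aeval ![x, y]) (monomial (fun₀ | 0 => k | 1 => d - k) (p.coeff k)))]
  refine Finset.sum_congr rfl fun i _ => ?_
  rw [MvPolynomial.aeval_monomial, Finsupp.prod_fintype _ _ (by simp)]
  simp [Fin.prod_univ_two, Finsupp.update_apply]
  ring

lemma hm_mul {m n : ℕ} {p q : Polynomial R} (hp : p.natDegree ≤ m) (hq : q.natDegree ≤ n) (x y : R) :
    hm (m + n) (p * q) x y = hm m p x y * hm n q x y := by
  rw [hm_eq, hm_eq, hm_eq, Polynomial.homogenize_mul p q hp hq, map_mul]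

lemma hm_pow {m : ℕ} {p : Polynomial R} (hp : p.natDegree ≤ m) (k : ℕ) (x y : R) :
    hm (m * k) (p ^ k) x y = hm m p x y ^ k := by
  induction k with
  | zero => simp [hm, mon, dotProduct, Fin.sum_univ_succ]
  | succ k ih =>
    rw [pow_succ, pow_succ, Nat.mul_succ, hm_mul _ hp, ih]
    exact (Polynomial.natDegree_pow_le_of_le k hp).trans (by rw [mul_comm])

def lin (u v : R) : Polynomial R := Polynomial.C u * Polynomial.X + Polynomial.C v

lemma lin_deg (u v : R) : (lin u v).natDegree ≤1 := Polynomial.natDegree_linear_le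

lemma hm_lin (u v x y : R) : hm 1 (lin u v) x y = u * x + v * y := by
  simp [hm, mon, lin, dotProduct, Fin.sum_univ_two, Polynomial.coeff_X, Polynomial.coeff_C]
  ring

/-- the representation matrix of an arbitrary 2x2 matrix on `V_d` -/
def rep (d : ℕ) (g : M2 R) : MM d d R :=
  Matrix.of fun i j => (lin (g 0 0) (g 0 1) ^ (j : ℕ) * lin (g 1 0) (g 1 1) ^ (d - (j : ℕ))).coeff i

lemma monR (d : ℕ) (g : M2 R) (x y : R) :
    mon d x y ᵥ* rep d g = mon d (g 0 0 * x + g 0 1 * y) (g 1 0 * x + g 1 1 * y) := by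
  funext j
  have hj : (j : ℕ) + (d - j) = d := by omega
  have h := hm_mul (m :=1 * (j : ℕ)) (n :=1 * (d - (j : ℕ)))
    (p := lin (g 0 0) (g 0 1) ^ (j : ℕ)) (q := lin (g 1 0) (g 1 1) ^ (d - (j : ℕ)))
    ((Polynomial.natDegree_pow_le_of_le _ (lin_deg _ _)).trans (by omega))
    ((Polynomial.natDegree_pow_le_of_le _ (lin_deg _ _)).trans (by omega)) x y
  rw [hm_pow (lin_deg _ _), hm_pow (lin_deg _ _), hm_lin, hm_lin] at h
  rw [show 1 * (j : ℕ) +1 * (d - (j : ℕ)) = d by omega] at h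
  exact h

lemma repM (d : ℕ) (g : M2 R) (f : R →+* S) :
    rep d (g.map f) = (rep d g).map f := by
  ext i j
  simp only [rep, of_apply, map_apply]
  rw [← Polynomial.coeff_map]
  congr 1
  simp [lin, Polynomial.map_mul, Polynomial.map_pow]

lemma vec_ext {d : ℕ} {v w : FS d → R}
    (h : mon d (Polynomial.X : Polynomial R) 1 ⬝ᵥ (Polynomial.C ∘ v) = mon d Polynomial.X 1 ⬝ᵥ (Polynomial.C ∘ w)) :
    v = w := by
  have key : ∀ u : Fin (d+1) → R, mon d (Polynomial.X : Polynomial R) 1 ⬝ᵥ (Polynomial.C ∘ u) = cfp u := by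
    intro u
    simp only [mon, dotProduct, cfp, Function.comp, one_pow, mul_one]
    exact Finset.sum_congr rfl fun i _ => mul_comm _ _
  rw [key, key] at h
  funext i
  rw [← cfp_coeff v, ← cfp_coeff w, h]

lemma mat_ext {d n : ℕ} {A B : Matrix (FS d) (Fin n) R}
    (h : mon d (Polynomial.X : Polynomial R) 1 ᵥ* A.map Polynomial.C = mon d Polynomial.X 1 ᵥ* B.map Polynomial.C) :
    A = B := by
  ext i j
  have := vec_ext (v := fun i => A i j) (w := fun i => B i j) (congrFun h j)
  exact congrFun this i

lemma repP (d : ℕ) (g h : M2 R) : rep d g * rep d h = rep d (h * g) := by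
  apply mat_ext
  rw [Matrix.map_mul, ← vecMul_vecMul, ← repM, ← repM, ← repM, monR, monR, monR]
  simp only [map_apply, mul_apply, Fin.sum_univ_two, map_add, map_mul]
  congr 1 <;> ring

lemma repO (d : ℕ) : rep d (1 : M2 R) =1 := by
  apply mat_ext
  rw [← repM, monR]
  simp

lemma rep_smul (d : ℕ) (t : R) (g : M2 R) : rep d (t • g) = t ^ d • rep d g := by
  apply mat_ext
  rw [← repM, monR]
  rw [show (t ^ d • rep d g).map Polynomial.C = (Polynomial.C t) ^ d • (rep d g).map Polynomial.C by
    ext i j : 2; simp, vecMul_smul, ← repM, monR]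
  funext i
  have hi : (i : ℕ) + (d - i) = d := by omega
  simp only [mon, map_apply, Matrix.smul_apply, smul_eq_mul, Polynomial.C_mul, Pi.smul_apply]
  calc _ = (Polynomial.C t) ^ (i : ℕ) * (Polynomial.C t) ^ (d - (i : ℕ)) * _ := by
        rw [mul_assoc (Polynomial.C t), mul_assoc (Polynomial.C t), mul_assoc (Polynomial.C t), mul_assoc (Polynomial.C t), ← mul_add, ← mul_add, mul_pow, mul_pow]
        exact mul_mul_mul_comm _ _ _ _
    _ = _ := by rw [← pow_add, hi]

/-- frozen representation matrix -/
lemma repMat_eq (d : ℕ) (g : SL2) : Matrix.of (repMat d g) = rep d g.1 := by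
  have h := monR d (g.1.map (C : ℂ →+* MvPolynomial (Fin 2) ℂ)) (X 0) (X 1)
  ext i j
  have hj := congrFun h j
  rw [repM] at hj
  have h2 : sub1 g (X 0 ^ (j : ℕ) * X 1 ^ (d - (j : ℕ))) =
      mon d (C (g.1 0 0) * X 0 + C (g.1 0 1) * X 1) (C (g.1 1 0) * X 0 + C (g.1 1 1) * X 1) j := by
    simp [sub1, mon, Fin.sum_univ_two]
  simp only [of_apply, repMat, h2]
  simp only [map_apply] at hj
  rw [← hj]
  simp only [vecMul, dotProduct, mon, map_apply, coeff_sum]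
  rw [Finset.sum_eq_single i]
  · rw [mul_comm, coeff_C_mul]
    have : (X 0 ^ (i : ℕ) * X 1 ^ (d - (i : ℕ)) : MvPolynomial (Fin 2) ℂ) =
      monomial (Finsupp.single 0 (i : ℕ) + Finsupp.single 1 (d - (i : ℕ))) 1 := by
      rw [X_pow_eq_monomial, X_pow_eq_monomial, monomial_mul, mul_one]
    rw [this, coeff_monomial, if_pos rfl, mul_one]
  · intro k _ hk
    rw [mul_comm, coeff_C_mul]
    have : (X 0 ^ (k : ℕ) * X 1 ^ (d - (k : ℕ)) : MvPolynomial (Fin 2) ℂ) =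
      monomial (Finsupp.single 0 (k : ℕ) + Finsupp.single 1 (d - (k : ℕ))) 1 := by
      rw [X_pow_eq_monomial, X_pow_eq_monomial, monomial_mul, mul_one]
    rw [this, coeff_monomial, if_neg, mul_zero]
    intro h
    have := DFunLike.congr_fun h 0
    simp at this
    exact hk (Fin.ext this)
  · simp

/-- inverse-form matrix -/
def Om' (d : ℕ) : MM d d R :=
  Matrix.of fun i j => if (i : ℕ) + j = d then (-1) ^ (j : ℕ) * (d.choose i : R) else 0

lemma Om'_map (d : ℕ) (f : R →+* S) : (Om' d : Matrix _ _ R).map f = Om' d := by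
  ext i j; simp only [Om', map_apply, of_apply]; split_ifs <;> simp

lemma mon_Om' (d : ℕ) (x y s t : R) : (mon d x y ᵥ* Om' d) ⬝ᵥ mon d s t = (x * t - y * s) ^ d := by
  rw [sub_eq_add_neg, add_pow, ← Fin.sum_univ_eq_sum_range (n := d +1)
    (fun m => (x * t) ^ m * (-(y * s)) ^ (d - m) * (d.choose m : R)), ← dotProduct_mulVec]
  unfold dotProduct
  refine Finset.sum_congr rfl fun i _ => ?_
  simp only [mulVec, dotProduct, Om', of_apply]
  rw [Finset.sum_eq_single ⟨d - i, by omega⟩]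
  · rw [if_pos (by simp; omega)]
    have : d - (d - (i : ℕ)) = i := by omega
    simp only [mon, this]
    rw [neg_pow (y * s), mul_pow, mul_pow]; ring
  · intro j _ hj
    rw [if_neg, zero_mul]
    intro h; apply hj; ext; simp; omega
  · simp

lemma mat_ext2.{u} {R : Type u} [CommRing R] {d n : ℕ} {A B : MM d n R}
    (h : ∀ (S : Type u) [CommRing S] (f : R →+* S) (x y s t : S),
      (mon d x y ᵥ* A.map f) ⬝ᵥ mon n s t = (mon d x y ᵥ* B.map f) ⬝ᵥ mon n s t) : A = B := by
  have h1 := h (Polynomial (Polynomial R)) (Polynomial.C.comp Polynomial.C) (Polynomial.C Polynomial.X) 1 Polynomial.X 1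
  have key : ∀ A : MM d n R,
     (mon d (Polynomial.C (Polynomial.X : Polynomial R)) 1 ᵥ* A.map (Polynomial.C.comp Polynomial.C)) ⬝ᵥ mon n Polynomial.X 1
     = mon n (Polynomial.X : Polynomial (Polynomial R)) 1 ⬝ᵥ (Polynomial.C ∘ (mon d Polynomial.X 1 ᵥ* A.map Polynomial.C)) := by
    intro A
    rw [dotProduct_comm]
    congr 1
    funext j
    simp only [vecMul, dotProduct, mon, Function.comp, map_sum, map_mul, map_pow, one_pow, map_one, map_apply, RingHom.comp_apply]
  rw [key, key] at h1
  exact mat_ext (vec_ext h1)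

lemma rep_Om' (d : ℕ) (g : M2 R) :
    rep d g * Om' d * (rep d g)ᵀ = g.det ^ d • Om' d := by
  apply mat_ext2
  intro S _ f x y s t
  rw [Matrix.map_mul, Matrix.map_mul, transpose_map, ← repM, Om'_map,
    show (g.det ^ d • (Om' d : Matrix (Fin (d+1)) (Fin (d+1)) R)).map f = f (g.det) ^ d • Om' d by
      rw [← Om'_map d f]; ext i j; simp, ← vecMul_vecMul, ← vecMul_vecMul, ← dotProduct_mulVec, mulVec_transpose,
      monR, monR, mon_Om', vecMul_smul, smul_dotProduct, mon_Om', smul_eq_mul, ← mul_pow]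
  congr 1
  simp only [map_apply, det_fin_two, map_sub, map_mul]
  ring

end rep

section Om
variable {R : Type*} [CommRing R] [Algebra ℂ R] {S : Type*} [CommRing S] [Algebra ℂ S]

def wv (d i : ℕ) : ℂ := (-1) ^ i / (d.choose i : ℂ)

def Om (d : ℕ) : MM d d R :=
  Matrix.of fun i j => if (i : ℕ) + j = d then aM R (wv d i) else 0

lemma Om_map (d : ℕ) (f : R →ₐ[ℂ] S) : (Om d : Matrix _ _ R).map f = Om d := by
  ext i j; simp only [Om, map_apply, of_apply]; split_ifs <;> simp

lemma Om'_Om (d : ℕ) : (Om' d : Matrix (Fin (d+1)) (Fin (d+1)) R) * Om d =1 := by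
  ext i j
  rw [mul_apply, Finset.sum_eq_single ⟨d - i, by omega⟩]
  · have hi : (i : ℕ) ≤ d := by omega
    simp only [Om', Om, of_apply]
    rw [if_pos (by omega), Matrix.one_apply]
    by_cases hij : i = j
    · subst hij
      rw [if_pos (by omega), if_pos rfl, wv, Nat.choose_symm hi]
      have : (-1 : R) ^ (d - (i:ℕ)) * (d.choose i : R) = aM R ((-1) ^ (d - (i : ℕ)) * (d.choose i : ℂ)) := by simp
      rw [this, ← map_mul, ← map_one (aM R)]
      congr 1
      have h0 : (d.choose i : ℂ) ≠0 := by exact_mod_cast (Nat.choose_pos hi).ne'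
      field_simp
      rw [← pow_mul, mul_comm, pow_mul]; simp
    · rw [if_neg, if_neg hij, mul_zero]
      intro h; apply hij; ext; omega
  · intro k _ hk
    simp only [Om', of_apply]
    rw [if_neg, zero_mul]
    intro h; apply hk; ext; simp; omega
  · simp

lemma Om_Om' (d : ℕ) : (Om d : Matrix (Fin (d+1)) (Fin (d+1)) R) * Om' d =1 :=
  mul_eq_one_comm.mp (Om'_Om d)

lemma rep_Om (d : ℕ) {g : M2 R} (hg : g.det =1) :
    (rep d g)ᵀ * Om d * rep d g = Om d := by
  have h := rep_Om' d g
  rw [hg, one_pow, one_smul] at h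
  have h1 : rep d g * (Om' d * (rep d g)ᵀ * Om d) =1 := by
    rw [← mul_assoc, ← mul_assoc, h, Om'_Om]
  have h2 := mul_eq_one_comm.mp h1
  have h3 : Om d * (Om' d * (rep d g)ᵀ * Om d * rep d g) = Om d := by rw [h2, mul_one]
  rw [← mul_assoc, ← mul_assoc, ← mul_assoc, Om_Om', one_mul] at h3
  exact h3

end Om

section X
variable {R : Type*} [CommRing R] {S : Type*} [CommRing S]

lemma rdU (d : ℕ) {g : M2 R} (hg : g.det =1) : IsUnit (rep d g).det := by
  have h : g.adjugate * g =1 := by rw [adjugate_mul, hg, one_smul]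
  have := repP d g g.adjugate
  rw [h, repO] at this
  exact (Matrix.isUnit_iff_isUnit_det _).mp (IsUnit.of_mul_eq_one _ this)

def Xop (d : ℕ) (N : M2 R) : MM d d R :=
  Matrix.of fun i j => (if (i : ℕ) = j then ((j : ℕ) : R) * N 0 0 + ((d - (j : ℕ) : ℕ) : R) * N 1 1 else 0)
    + (if (i : ℕ) +1 = j then ((j : ℕ) : R) * N 0 1 else 0)
    + (if (i : ℕ) = j +1 then ((d - (j : ℕ) : ℕ) : R) * N 1 0 else 0)

lemma Xop_map (d : ℕ) (N : M2 R) (f : R →+* S) :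
    (Xop d N).map f = Xop d (N.map f) := by
  ext i j
  simp only [Xop, map_apply, of_apply, map_add, apply_ite f, map_mul, map_natCast, map_zero]

lemma eps_pow {ε : R} (h : ε * ε =0) (x a : R) (j : ℕ) :
    (x + ε * a) ^ j = x ^ j + ε * (j * x ^ (j -1) * a) := by
  induction j with
  | zero => simp
  | succ j ih =>
    rw [pow_succ, ih]
    cases j with
    | zero => simp
    | succ j => 
      simp only [Nat.add_sub_cancel]
      push_cast
      linear_combination (((j:R) +1) * x ^ j * a * a) * h

lemma sum_fin_ite {d : ℕ} (F : ℕ → R) (k : ℕ) :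
    ∑ i : FS d, (if (i : ℕ) = k then F i else 0) = if k ≤ d then F k else 0 := by
  rw [Fin.sum_univ_eq_sum_range (fun i => if i = k then F i else 0), Finset.sum_ite_eq']
  simp

lemma mon_Xop (d : ℕ) (N : M2 R) (x y : R) (j : FS d) :
    (mon d x y ᵥ* Xop d N) j = (j : ℕ) * x ^ ((j : ℕ) -1) * (N 0 0 * x + N 0 1 * y) * y ^ (d - (j : ℕ))
      + x ^ (j : ℕ) * (((d - (j : ℕ) : ℕ) : R) * y ^ (d - (j : ℕ) -1) * (N 1 0 * x + N 1 1 * y)) := by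
  simp only [vecMul, dotProduct, Xop, of_apply, mul_add, Finset.sum_add_distrib, mul_ite, mul_zero, mon]
  rw [sum_fin_ite (fun i => x ^ i * y ^ (d - i) * (((j : ℕ) : R) * N 0 0) + x ^ i * y ^ (d - i) * (((d - (j : ℕ) : ℕ) : R) * N 1 1)),
    sum_fin_ite (fun i => x ^ i * y ^ (d - i) * (((d - (j : ℕ) : ℕ) : R) * N 1 0)), if_pos (by omega)]
  obtain ⟨j, hj⟩ := j
  simp only
  have e2 : (∑ i : Fin (d+1), if (i : ℕ) +1 = j then x ^ (i : ℕ) * y ^ (d - (i : ℕ)) * ((j : R) * N 0 1) else 0)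
      = (j : R) * x ^ (j -1) * N 0 1 * y * y ^ (d - j) := by
    cases j with
    | zero => simp
    | succ j =>
      simp only [Nat.add_right_cancel_iff]
      rw [sum_fin_ite (fun i => x ^ i * y ^ (d - i) * ((j +1 : ℕ) * N 0 1)), if_pos (by omega)]
      rw [show d - j = d - (j +1) +1 by omega, pow_succ]; simp only [Nat.add_sub_cancel]; ring
  rw [e2]
  have e3 : (if j +1 ≤ d then x ^ (j +1) * y ^ (d - (j +1)) * (((d - j : ℕ) : R) * N 1 0) else 0)
      = x ^ j * x * (((d - j : ℕ) : R) * y ^ (d - j -1) * N 1 0) := by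
    split_ifs with h
    · rw [Nat.sub_sub]; ring
    · rw [show d - j =0 by omega]; simp
  rw [e3]
  have e4 : ((d - j : ℕ) : R) * y ^ (d - j) = ((d - j : ℕ) : R) * y ^ (d - j -1) * y := by
    rcases Nat.eq_zero_or_pos (d - j) with h | h
    · rw [h]; simp
    · obtain ⟨k, hk⟩ := Nat.exists_eq_succ_of_ne_zero h.ne'
      rw [hk]; simp [pow_succ]; ring
  have e5 : (j : R) * x ^ j = (j : R) * x ^ (j -1) * x := by
    cases j with
    | zero => simp
    | succ j => simp [pow_succ]; ring
  linear_combination (x ^ j * N 1 1) * e4 + (y ^ (d - j) * N 0 0) * e5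

lemma rep_eps (d : ℕ) {ε : R} (h : ε * ε =0) (N : M2 R) :
    rep d (1 + ε • N) =1 + ε • Xop d N := by
  apply mat_ext
  funext j
  rw [← repM, monR]
  have e1 : (1 + ε • Xop d N).map Polynomial.C =1 + Polynomial.C ε • Xop d (N.map Polynomial.C) := by
    rw [← Xop_map]
    ext a b : 2
    simp only [map_apply, Matrix.add_apply, Matrix.smul_apply, smul_eq_mul, Matrix.one_apply, map_add, map_mul]
    split_ifs <;> simp
  rw [e1, vecMul_add, vecMul_one, vecMul_smul, Pi.add_apply, Pi.smul_apply, smul_eq_mul, mon_Xop]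
  have h' : Polynomial.C ε * Polynomial.C ε =0 := by rw [← Polynomial.C_mul, h, Polynomial.C_0]
  set E := Polynomial.C ε with hE
  have a1 : ((1 + ε • N).map Polynomial.C 0 0 * Polynomial.X + (1 + ε • N).map Polynomial.C 0 1 *1)
    = Polynomial.X + E * (N.map Polynomial.C 0 0 * Polynomial.X + N.map Polynomial.C 0 1 *1) := by
    simp [hE]; ring
  have a2 : ((1 + ε • N).map Polynomial.C 1 0 * Polynomial.X + (1 + ε • N).map Polynomial.C 1 1 *1)
    =1 + E * (N.map Polynomial.C 1 0 * Polynomial.X + N.map Polynomial.C 1 1 *1) := by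
    simp [hE]; ring
  rw [a1, a2]
  simp only [mon]
  rw [eps_pow h', eps_pow h']
  set U := (N.map Polynomial.C 0 0 * Polynomial.X + N.map Polynomial.C 0 1 *1)
  set V := (N.map Polynomial.C 1 0 * Polynomial.X + N.map Polynomial.C 1 1 *1)
  simp only [one_pow, mul_one]
  linear_combination (((j : ℕ) : Polynomial R) * Polynomial.X ^ ((j : ℕ) -1) * U * (((d - (j:ℕ) : ℕ) : Polynomial R) * V)) * h'

lemma rep_Xop (d : ℕ) {g N N' : M2 R} (h : N * g = g * N') :
    rep d g * Xop d N = Xop d N' * rep d g := by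
  let f : R →+* DualNumber R := algebraMap R (DualNumber R)
  let ε : DualNumber R := DualNumber.eps
  have hε : ε * ε =0 := DualNumber.eps_mul_eps
  have h1 : rep d (g.map f) * rep d (1 + ε • N.map f) = rep d (1 + ε • N'.map f) * rep d (g.map f) := by
    rw [repP, repP]
    congr 1
    rw [add_mul, mul_add, one_mul, mul_one, smul_mul_assoc, mul_smul_comm, ← Matrix.map_mul, ← Matrix.map_mul, h]
  rw [rep_eps d hε, rep_eps d hε, mul_add, add_mul, mul_one, one_mul, mul_smul_comm, smul_mul_assoc] at h1
  have h2 := add_left_cancel h1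
  rw [← Xop_map, ← Xop_map, repM, ← Matrix.map_mul, ← Matrix.map_mul] at h2
  ext i j
  have h3 := congrArg TrivSqZeroExt.snd (congrFun (congrFun h2 i) j)
  simp only [Matrix.smul_apply, map_apply, smul_eq_mul, ε, f, DualNumber.eps, TrivSqZeroExt.algebraMap_eq_inl, TrivSqZeroExt.snd_mul, TrivSqZeroExt.fst_inr, TrivSqZeroExt.snd_inr, TrivSqZeroExt.fst_inl, TrivSqZeroExt.snd_inl] at h3
  simpa using h3

def Nq (q : Fin 3 → R) : M2 R := !![-q 1, -2 * q 0; 2 * q 2, q 1]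

/-- action of a quadratic form by Poisson bracket -/
def mq (d : ℕ) (q : Fin 3 → R) : MM d d R := Xop d (Nq q)

lemma rep_two (g : M2 R) : rep 2 g =
    !![g 1 1 ^2, g 0 1 * g 1 1, g 0 1 ^2; 2 * g 1 0 * g 1 1, g 0 0 * g 1 1 + g 0 1 * g 1 0,2 * g 0 0 * g 0 1;
      g 1 0 ^2, g 0 0 * g 1 0, g 0 0 ^2] := by
  apply mat_ext
  rw [← repM, monR]
  funext j
  have h2 : (Polynomial.C 2 : Polynomial R) =2 := rfl
  fin_cases j <;> simp [mon, vecMul, dotProduct, Fin.sum_univ_three, h2] <;> ring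

lemma rep_oneD (g : M2 R) : rep 1 g = !![g 1 1, g 0 1; g 1 0, g 0 0] := by
  apply mat_ext
  rw [← repM, monR]
  funext j
  fin_cases j <;> simp [mon, vecMul, dotProduct, Fin.sum_univ_two] <;> ring

lemma rep_mq (d : ℕ) {g : M2 R} (hg : g.det =1) (q : Fin 3 → R) :
    rep d g * mq d q = mq d (rep 2 g *ᵥ q) * rep d g := by
  apply rep_Xop
  rw [rep_two]
  rw [det_fin_two] at hg
  ext i j
  fin_cases i <;> fin_cases j <;> simp [Nq, mul_apply, Fin.sum_univ_two, mulVec, dotProduct, Fin.sum_univ_three]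
  · linear_combination (q 1 * g 0 0 +2 * q 0 * g 1 0) * hg
  · linear_combination (q 1 * g 0 1 +2 * q 0 * g 1 1) * hg
  · linear_combination (-q 1 * g 1 0 -2 * q 2 * g 0 0) * hg
  · linear_combination (-q 1 * g 1 1 -2 * q 2 * g 0 1) * hg

lemma mq_map (d : ℕ) (q : Fin 3 → R) (f : R →+* S) : (mq d q).map f = mq d (f ∘ q) := by
  unfold mq
  rw [Xop_map]
  congr 1
  ext i j
  have h2 : f 2 =2 := map_ofNat f 2
  fin_cases i <;> fin_cases j <;> simp [Nq, h2]

lemma mq_apply (d : ℕ) (q : Fin 3 → R) (i j : FS d) : mq d q i j =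
   (if (i : ℕ) = j then ((j : ℕ) : R) * -q 1 + ((d - (j : ℕ) : ℕ) : R) * q 1 else 0)
    + (if (i : ℕ) +1 = j then ((j : ℕ) : R) * (-2 * q 0) else 0)
    + (if (i : ℕ) = j +1 then ((d - (j : ℕ) : ℕ) : R) * (2 * q 2) else 0) := by
  simp [mq, Xop, Nq]

lemma mq_add (d : ℕ) (p q : Fin 3 → R) : mq d (p + q) = mq d p + mq d q := by
  ext i j
  simp only [mq_apply, Matrix.add_apply, Pi.add_apply]
  split_ifs <;> ring

lemma mq_smul (d : ℕ) (c : R) (q : Fin 3 → R) : mq d (c • q) = c • mq d q := by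
  ext i j
  simp only [mq_apply, Matrix.smul_apply, Pi.smul_apply, smul_eq_mul]
  split_ifs <;> ring

/-- powers of forms -/
def pw {r : ℕ} (d k : ℕ) (e : FS r → R) : FS d → R := fun i => ((cfp e) ^ k).coeff i

lemma mon_cfp {r : ℕ} (e : FS r → R) (x y : R) : hm r (cfp e) x y = mon r x y ⬝ᵥ e := by
  unfold hm; simp only [cfp_coeff]

lemma mon_pw {r d k : ℕ} (h : d = r * k) (e : FS r → R) (x y : R) :
    mon d x y ⬝ᵥ pw d k e = (mon r x y ⬝ᵥ e) ^ k := by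
  subst h
  rw [← mon_cfp e, ← hm_pow (cfp_natDegree e)]
  rfl

lemma pw_map {r : ℕ} (d k : ℕ) (e : FS r → R) (f : R →+* S) : f ∘ pw d k e = pw d k (f ∘ e) := by
  funext i
  simp only [pw, Function.comp]
  rw [← Polynomial.coeff_map]
  congr 1
  simp [cfp, Polynomial.map_sum]

lemma map_mulVec' {m n : Type*} [Fintype n] (f : R →+* S) (A : Matrix m n R) (v : n → R) :
    f ∘ (A *ᵥ v) = A.map f *ᵥ (f ∘ v) := by
  funext i
  simp [mulVec, dotProduct]

lemma rep_pw {r d k : ℕ} (h : d = r * k) (g : M2 R) (e : FS r → R) :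
    rep d g *ᵥ pw d k e = pw d k (rep r g *ᵥ e) := by
  apply vec_ext
  rw [map_mulVec', pw_map, pw_map, map_mulVec', ← repM, ← repM, dotProduct_mulVec, monR, mon_pw h, mon_pw h,
    dotProduct_mulVec, monR]

lemma pw_ne_zero [IsDomain R] {r d k : ℕ} (h : d = r * k) {e : FS r → R} (he : e ≠0) : pw d k e ≠0 := by
  intro h0
  have hc : cfp e ≠0 := by
    intro h1; apply he; funext i; rw [← cfp_coeff e, h1]; simp
  apply pow_ne_zero k hc
  ext i
  by_cases hi : i ≤ d
  · exact congrFun h0 ⟨i, by omega⟩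
  · rw [Polynomial.coeff_eq_zero_of_natDegree_lt]; · simp
    refine lt_of_le_of_lt (Polynomial.natDegree_pow_le_of_le k (cfp_natDegree e)) ?_
    rw [mul_comm, ← h]; omega

def MX (d : ℕ) : Matrix (Fin (d +2)) (FS d) R := Matrix.of fun i j => if (i : ℕ) = j +1 then 1 else 0
def MY (d : ℕ) : Matrix (Fin (d +2)) (FS d) R := Matrix.of fun i j => if (i : ℕ) = j then 1 else 0

lemma MX_map (d : ℕ) (f : R →+* S) : (MX d : Matrix _ _ R).map f = MX d := by
  ext i j; simp [MX, apply_ite f]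
lemma MY_map (d : ℕ) (f : R →+* S) : (MY d : Matrix _ _ R).map f = MY d := by
  ext i j; simp [MY, apply_ite f]

lemma mon_MX (d : ℕ) (x y : R) : mon (d +1) x y ᵥ* MX d = x • mon d x y := by
  funext j
  simp only [vecMul, dotProduct, mon, MX, of_apply, mul_ite, mul_one, mul_zero, Pi.smul_apply, smul_eq_mul]
  rw [sum_fin_ite (fun i => x ^ i * y ^ (d +1 - i)), if_pos (by omega), Nat.add_sub_add_right, pow_succ]; ring

lemma mon_MY (d : ℕ) (x y : R) : mon (d +1) x y ᵥ* MY d = y • mon d x y := by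
  funext j
  simp only [vecMul, dotProduct, mon, MY, of_apply, mul_ite, mul_one, mul_zero, Pi.smul_apply, smul_eq_mul]
  rw [sum_fin_ite (fun i => x ^ i * y ^ (d +1 - i)), if_pos (by omega), Nat.succ_sub (by omega), pow_succ]; ring

lemma rep_MX (d : ℕ) (g : M2 R) :
    rep (d +1) g * (MX d : Matrix (Fin (d+2)) (Fin (d+1)) R) = (g 0 0 • (MX d : Matrix (Fin (d+2)) (Fin (d+1)) R) + g 0 1 • (MY d : Matrix (Fin (d+2)) (Fin (d+1)) R)) * rep d g := by
  apply mat_ext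
  have e : ∀ u v : R, (u • MX d + v • MY d : Matrix (Fin (d+2)) (Fin (d+1)) R).map Polynomial.C
      = Polynomial.C u • (MX d : Matrix (Fin (d+2)) (Fin (d+1)) (Polynomial R)) + Polynomial.C v • (MY d : Matrix (Fin (d+2)) (Fin (d+1)) (Polynomial R)) := by
    intro u v; rw [← MX_map d (Polynomial.C : R →+* _), ← MY_map d (Polynomial.C : R →+* _)]; ext; simp
  rw [Matrix.map_mul, Matrix.map_mul, e, ← vecMul_vecMul, ← vecMul_vecMul, ← repM, ← repM, monR, MX_map, mon_MX,
    vecMul_add, vecMul_smul, vecMul_smul, mon_MX, mon_MY, smul_smul, smul_smul, ← add_smul, smul_vecMul, monR]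
  simp

lemma rep_MY (d : ℕ) (g : M2 R) :
    rep (d +1) g * (MY d : Matrix (Fin (d+2)) (Fin (d+1)) R) = (g 1 0 • (MX d : Matrix (Fin (d+2)) (Fin (d+1)) R) + g 1 1 • (MY d : Matrix (Fin (d+2)) (Fin (d+1)) R)) * rep d g := by
  apply mat_ext
  have e : ∀ u v : R, (u • MX d + v • MY d : Matrix (Fin (d+2)) (Fin (d+1)) R).map Polynomial.C
      = Polynomial.C u • (MX d : Matrix (Fin (d+2)) (Fin (d+1)) (Polynomial R)) + Polynomial.C v • (MY d : Matrix (Fin (d+2)) (Fin (d+1)) (Polynomial R)) := by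
    intro u v; rw [← MX_map d (Polynomial.C : R →+* _), ← MY_map d (Polynomial.C : R →+* _)]; ext; simp
  rw [Matrix.map_mul, Matrix.map_mul, e, ← vecMul_vecMul, ← vecMul_vecMul, ← repM, ← repM, monR, MY_map, mon_MY,
    vecMul_add, vecMul_smul, vecMul_smul, mon_MX, mon_MY, smul_smul, smul_smul, ← add_smul, smul_vecMul, monR]
  simp

end X

section irr
variable {K : Type*} [Field K] [CharZero K]

lemma single_mem_of_diag {n : ℕ} (A : Subalgebra K (Matrix (Fin n) (Fin n) K)) (w : Fin n → K)
    (hw : Function.Injective w) (h : diagonal w ∈ A) (i : Fin n) : Matrix.single i i (1 : K) ∈ A := by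
  have h1 : Polynomial.aeval (diagonal w) (Lagrange.basis Finset.univ w i) ∈ A :=
    (Algebra.adjoin_le (Set.singleton_subset_iff.mpr h)) (Polynomial.aeval_mem_adjoin_singleton K _)
  have h2 : Polynomial.aeval (diagonal w) (Lagrange.basis Finset.univ w i) = Matrix.single i i (1 : K) := by
    have := Polynomial.aeval_algHom_apply (Matrix.diagonalAlgHom (n := Fin n) (α := K) K) w (Lagrange.basis Finset.univ w i)
    simp only [Matrix.diagonalAlgHom_apply] at this
    rw [this]
    ext a b
    rw [Matrix.diagonal_apply, Polynomial.aeval_pi_apply₂, Matrix.single_apply]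
    by_cases hab : a = b
    · subst hab
      by_cases hai : a = i
      · subst hai
        simp [Lagrange.eval_basis_self (hw.injOn) (Finset.mem_univ a)]
      · have := Lagrange.eval_basis_of_ne (s := Finset.univ) (v := w) (i := i) (j := a) (Ne.symm hai) (Finset.mem_univ a)
        simp [this, Ne.symm hai]
    · rw [if_neg hab, if_neg]; rintro ⟨rfl, rfl⟩; exact hab rfl
  rwa [h2] at h1

lemma irr_top {d : ℕ} (A : Subalgebra K (MM d d K))
    (h : ∀ q, mq d q ∈ A) : A = ⊤ := by
  have hd : ∀ i, Matrix.single i i (1 : K) ∈ A := by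
    apply single_mem_of_diag A (fun j => (d : K) -2 * (j : ℕ))
    · intro i j hij
      have : ((i : ℕ) : K) = (j : ℕ) := by
        have h2 : (2 : K) ≠0 := two_ne_zero
        apply mul_left_cancel₀ h2
        simpa using hij
      exact Fin.ext (Nat.cast_injective this)
    · convert h ![0,1,0] using 1
      ext i j
      rw [mq_apply, diagonal_apply]
      have hj : (j : ℕ) ≤ d := by omega
      by_cases hij : i = j
      · subst hij; simp [Nat.cast_sub hj]; ring
      · have : (i : ℕ) ≠ j := fun h => hij (Fin.ext h)
        simp [hij, this]
  have key : ∀ (q : Fin 3 → K) (i j : FS d), mq d q i j ≠0 → Matrix.single i j (1 : K) ∈ A := by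
    intro q i j hne
    have h1 := A.smul_mem (A.mul_mem (A.mul_mem (hd i) (h q)) (hd j)) (mq d q i j)⁻¹
    have : Matrix.single i i (1:K) * mq d q * Matrix.single j j 1 = mq d q i j • Matrix.single i j 1 := by
      ext a b
      simp [Matrix.mul_apply, Matrix.single_apply, ite_and]
      split_ifs <;> simp
    rwa [this, smul_smul, inv_mul_cancel₀ hne, one_smul] at h1
  have tr : ∀ i j k : Fin (d+1), Matrix.single i j (1 : K) ∈ A → Matrix.single j k (1 : K) ∈ A → Matrix.single i k (1 : K) ∈ A := by
    intro i j k h1 h2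
    have := A.mul_mem h1 h2
    simpa using this
  have up : ∀ (i : ℕ) (hi : i < d +1), Matrix.single (0 : FS d) ⟨i, hi⟩ (1 : K) ∈ A ∧ Matrix.single ⟨i, hi⟩ (0 : Fin (d+1)) (1 : K) ∈ A := by
    intro i
    induction i with
    | zero => intro hi; exact ⟨hd 0, hd 0⟩
    | succ i ih =>
      intro hi
      obtain ⟨h1, h2⟩ := ih (by omega)
      constructor
      · refine tr _ _ _ h1 (key ![1,0,0] _ _ ?_)
        rw [mq_apply]
        rw [if_neg (by simp), if_pos rfl, if_neg (by simp; omega)]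
        simp; exact_mod_cast Nat.succ_ne_zero i
      · refine tr _ _ _ (key ![0,0,1] _ _ ?_) h2
        rw [mq_apply]
        rw [if_neg (by simp), if_neg (by simp; omega), if_pos rfl]
        simp; omega
  rw [eq_top_iff]
  intro M _
  rw [Matrix.matrix_eq_sum_single M]
  refine A.sum_mem fun i _ => A.sum_mem fun j _ => ?_
  have := A.smul_mem (tr i 0 j (up i i.2).2 (up j j.2).1) (M i j)
  simpa using this

end irr

section FL
variable {K : Type*} [Field K] [Algebra ℂ K] {Γ : Type*}

lemma V2FL (σ : Γ → K →+* K) (g : Γ → M2 K) (hg : ∀ γ, (g γ).det =1)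
    (L : IF K) (E : M3 K) (hE : E.det ≠0)
    (hEL : ∀ i j, E i j ∈ L) (hσE : ∀ γ, E.map (σ γ) = rep 2 (g γ) * E)
    {d : ℕ} (v : FS d → K) (hv : v ≠0) (hvL : ∀ i, v i ∈ L) (χ : Γ → K)
    (hσv : ∀ γ, σ γ ∘ v = χ γ • (rep d (g γ) *ᵥ v)) :
    ∃ Q : MM d d K, Q.det ≠0 ∧ (∀ i j, Q i j ∈ L) ∧
      (∀ γ, Q.map (σ γ) = χ γ • (rep d (g γ) * Q)) ∧ ∀ i, Q i 0 = v i := by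
  have : CharZero K := charZero_of_injective_algebraMap (aM K).injective
  let 𝒮 : Submonoid (MM d d K) :=
    { carrier := {Z | (∀ i j, Z i j ∈ L) ∧ ∀ γ, Z.map (σ γ) * rep d (g γ) = rep d (g γ) * Z}
      one_mem' := ⟨fun i j => by
          rw [Matrix.one_apply]; split_ifs; exacts [L.one_mem, L.zero_mem], fun γ => by simp⟩
      mul_mem' := by
        rintro Y Z ⟨h1, h2⟩ ⟨h3, h4⟩
        refine ⟨fun i j => ?_, fun γ => ?_⟩
        · rw [mul_apply]; exact L.sum_mem fun k _ => L.mul_mem (h1 _ _) (h3 _ _)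
        · rw [Matrix.map_mul, mul_assoc, h4, ← mul_assoc, h2, mul_assoc] }
  have hspan : Submodule.span K (𝒮 : Set (MM d d K)) = ⊤ := by
    have h1 : Algebra.adjoin K (𝒮 : Set (MM d d K)) = ⊤ := by
      apply irr_top
      have hcol : ∀ j, mq d (fun i => E i j) ∈ Algebra.adjoin K (𝒮 : Set (MM d d K)) := by
        intro j
        apply Algebra.subset_adjoin
        refine ⟨fun a b => ?_, fun γ => ?_⟩
        · rw [mq_apply]
          have n2 : (2 : K) ∈ L := ofNat_mem L 2
          refine L.add_mem (L.add_mem ?_ ?_) ?_ <;> split_ifs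
          · exact L.add_mem (L.mul_mem (natCast_mem L _) (L.neg_mem (hEL _ _))) (L.mul_mem (natCast_mem L _) (hEL _ _))
          · exact L.zero_mem
          · exact L.mul_mem (natCast_mem L _) (L.mul_mem (L.neg_mem n2) (hEL _ _))
          · exact L.zero_mem
          · exact L.mul_mem (natCast_mem L _) (L.mul_mem n2 (hEL _ _))
          · exact L.zero_mem
        · rw [mq_map, rep_mq d (hg γ)]
          congr 2
          funext i
          exact congrFun (congrFun (hσE γ) i) j
      intro q
      have : q = ∑ j, (E⁻¹ *ᵥ q) j • fun i => E i j := by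
        have h2 : E *ᵥ (E⁻¹ *ᵥ q) = q := by
          rw [mulVec_mulVec, mul_nonsing_inv _ (isUnit_iff_ne_zero.mpr hE), one_mulVec]
        conv_lhs => rw [← h2]
        funext i
        simp [mulVec, dotProduct, mul_comm]
      rw [this, Fin.sum_univ_three, mq_add, mq_add, mq_smul, mq_smul, mq_smul]
      exact Subalgebra.add_mem _ (Subalgebra.add_mem _ (Subalgebra.smul_mem _ (hcol _) _) (Subalgebra.smul_mem _ (hcol _) _)) (Subalgebra.smul_mem _ (hcol _) _)
    have h2 := Algebra.adjoin_eq_span K (𝒮 : Set (MM d d K))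
    rw [h1, Submonoid.closure_eq] at h2
    rw [← h2]; rfl
  let φ : MM d d K →ₗ[K] (FS d → K) :=
    { toFun := fun Z => Z *ᵥ v, map_add' := fun Y Z => add_mulVec _ _ _, map_smul' := fun c Z => smul_mulVec _ _ _ }
  have hφ : Submodule.span K (φ '' (𝒮 : Set _)) = ⊤ := by
    rw [Submodule.span_image, hspan, Submodule.map_top, LinearMap.range_eq_top]
    intro w
    obtain ⟨k, hk⟩ := Function.ne_iff.mp hv
    refine ⟨Matrix.of fun i j => if j = k then w i * (v k)⁻¹ else 0, ?_⟩
    funext i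
    change (Matrix.of fun i j => if j = k then w i * (v k)⁻¹ else 0) i ⬝ᵥ v = w i
    simp only [of_apply, dotProduct, ite_mul, zero_mul]
    rw [Finset.sum_ite_eq']
    simp
    rw [mul_assoc, inv_mul_cancel₀ hk, mul_one]
  have hvT : ({v} : Set (FS d → K)) ⊆ φ '' (𝒮 : Set _) := by
    rw [Set.singleton_subset_iff]
    exact ⟨1, 𝒮.one_mem, one_mulVec v⟩
  obtain ⟨b, hbT, hvb, hTb, hbi⟩ := exists_linearIndepOn_id_extension (K := K) (LinearIndepOn.singleton (v := id) hv) hvT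
  replace hbi : LinearIndependent K ((↑) : b → (FS d → K)) := hbi
  have hb : Submodule.span K b = ⊤ := by
    rw [eq_top_iff, ← hφ]; exact Submodule.span_le.mpr hTb
  let bas : Module.Basis b K (FS d → K) := Module.Basis.mk (v := ((↑) : b → _)) hbi (by rw [Subtype.range_coe, hb])
  have : Fintype b := FiniteDimensional.fintypeBasisIndex bas
  have hcard : Fintype.card (FS d) = Fintype.card b := by
    rw [← Module.finrank_eq_card_basis bas]; simp
  let e0 : FS d ≃ b := Fintype.equivOfCardEq hcard
  let v' : b := ⟨v, hvb rfl⟩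
  let e : FS d ≃ b := (Equiv.swap 0 (e0.symm v')).trans e0
  have he0 : e 0 = v' := by simp [e]
  choose Z hZ1 hZ2 using fun j => hbT (e j).2
  refine ⟨Matrix.of fun i j => (e j).1 i, ?_, ?_, ?_, ?_⟩
  · have h1 : LinearIndependent K (fun j => ((e j).1 : Fin (d+1) → K)) := hbi.comp e e.injective
    have h2 := (Matrix.linearIndependent_cols_iff_isUnit (A := Matrix.of fun i j => (e j).1 i)).mp h1
    exact ((Matrix.isUnit_iff_isUnit_det _).mp h2).ne_zero
  · intro i j
    rw [of_apply, ← hZ2]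
    change ∑ k, Z j i k * v k ∈ L
    exact L.sum_mem fun k _ => L.mul_mem ((hZ1 j).1 _ _) (hvL k)
  · intro γ
    ext i j
    have h1 : σ γ ∘ (e j).1 = χ γ • (rep d (g γ) *ᵥ (e j).1) := by
      rw [← hZ2]
      change σ γ ∘ (Z j *ᵥ v) = χ γ • (rep d (g γ) *ᵥ (Z j *ᵥ v))
      rw [map_mulVec', hσv, mulVec_smul, mulVec_mulVec, (hZ1 j).2, mulVec_mulVec]
    exact congrFun h1 i
  · intro i; rw [of_apply, he0]

end FL

section fld
variable {K : Type} [Field K] [Algebra ℂ K]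

abbrev adj (S : Set K) : IF K := IntermediateField.adjoin ℂ S

notation:max "AR" v:max => adj (Set.range v)

lemma count {ι κ : Type} [Fintype ι] [Fintype κ] (v : ι → K) (w : κ → K)
    (hw : AI w) (hwt : AR w = ⊤) (hv : AR v = ⊤)
    (hc : Fintype.card ι = Fintype.card κ) : AI v := by
  have alg : ∀ {ι : Type} (v : ι → K), AR v = ⊤ →
      Algebra.IsAlgebraic (Algebra.adjoin ℂ (Set.range v)) K := by
    intro ι v hv
    rw [← IntermediateField.isAlgebraic_adjoin_iff_top]
    refine ⟨fun x => ?_⟩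
    have : x ∈ IntermediateField.adjoin ℂ (Set.range v) := by
      change x ∈ AR v; rw [hv]; trivial
    exact isAlgebraic_algebraMap (⟨x, this⟩ : IntermediateField.adjoin ℂ (Set.range v))
  have h1 := alg v hv
  have h2 := alg w hwt
  have hwb : IsTranscendenceBasis ℂ w := hw.isTranscendenceBasis_iff_isAlgebraic.mpr h2
  refine (Algebra.IsAlgebraic.isTranscendenceBasis_of_le_trdeg_of_finite ℂ v ?_).1
  have := hwb.cardinalMk_eq_trdeg
  rw [← this, Cardinal.mk_fintype, Cardinal.mk_fintype, hc]

lemma indep_over {ι κ : Type*} {x : ι → K} {y : κ → K} (h : AI (Sum.elim x y)) :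
    AlgebraicIndependent (AR x) y := by
  have h' : AI (Sum.elim y x) := by
    have := (algebraicIndependent_equiv (Equiv.sumComm κ ι)).mpr h
    convert this using 1
    ext (_ | _) <;> rfl
  exact IntermediateField.algebraicIndependent_adjoin_iff.mpr
    (AlgebraicIndependent.sumElim_iff.mp h').2

lemma maO {S : Set K} {x : K} (h : x ∈ S) : x ∈ adj S := IntermediateField.subset_adjoin ℂ S h

lemma frac_form {ι : Type*} (F : IF K) (x : ι → K) {k : K}
    (hk : k ∈ F ⊔ AR x) :
    ∃ p q : MvPolynomial ι F, aeval x q ≠0 ∧ k * aeval x q = aeval x p := by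
  have h1 : F ⊔ AR x ≤ (IntermediateField.adjoin F (Set.range x)).restrictScalars ℂ := by
    refine sup_le ?_ ?_
    · intro y hy
      exact (IntermediateField.adjoin F (Set.range x)).algebraMap_mem ⟨y, hy⟩
    · rw [IntermediateField.adjoin_le_iff]
      exact IntermediateField.subset_adjoin F _
  have h2 : k ∈ IntermediateField.adjoin F (Set.range x) := h1 hk
  rw [IntermediateField.mem_adjoin_range_iff] at h2
  obtain ⟨r, s, hrs⟩ := h2
  by_cases hs : aeval x s =0
  · refine ⟨0,1, by simp, ?_⟩
    rw [hrs, hs]; simp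
  · exact ⟨r, s, hs, by rw [hrs, div_mul_cancel₀ _ hs]⟩

lemma aeval_mem_sup {ι : Type*} (F : IF K) (x : ι → K) (p : MvPolynomial ι F) :
    aeval x p ∈ F ⊔ AR x := by
  rw [aeval_def, eval₂_eq]
  refine IntermediateField.sum_mem _ fun d _ => IntermediateField.mul_mem _ ?_ ?_
  · exact (le_sup_left : F ≤ _) (SetLike.coe_mem (coeff d p))
  · exact prod_mem fun i _ => pow_mem ((le_sup_right : _ ≤ F ⊔ AR x) (maO ⟨i, rfl⟩)) _

variable {Γ : Type*} (σ : Γ → AE K)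

def Fx : IF K where
  carrier := {k | ∀ γ, σ γ k = k}
  mul_mem' := fun h1 h2 γ => by rw [map_mul, h1 γ, h2 γ]
  add_mem' := fun h1 h2 γ => by rw [map_add, h1 γ, h2 γ]
  algebraMap_mem' := fun r γ => AlgHom.commutes _ r
  inv_mem' := fun x h γ => by rw [map_inv₀, h γ]

lemma mFx {k : K} : k ∈ Fx σ ↔ ∀ γ, σ γ k = k := Iff.rfl

/-- relations among fixed elements descend -/
lemma descend {ι : Type*} (F : IF K) (hF : ∀ γ, ∀ k ∈ F, σ γ k ∈ F)
    (v : ι → K) (hv : ∀ i, v i ∈ Fx σ) (s : Finset ι) : ∀ (c : ι → K), (∀ i, c i ∈ F) →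
    (∃ i ∈ s, c i ≠0) → ∑ i ∈ s, c i * v i =0 →
    ∃ c' : ι → K, (∀ i, c' i ∈ F ⊓ Fx σ) ∧ (∃ i ∈ s, c' i ≠0) ∧ ∑ i ∈ s, c' i * v i =0 := by
  classical
  induction s using Finset.strongInduction with
  | _ s ih =>
    rintro c hc ⟨i0, hi0, hne⟩ hsum
    let d : ι → K := fun i => (c i0)⁻¹ * c i
    have hd : ∀ i, d i ∈ F := fun i => F.mul_mem (F.inv_mem (hc _)) (hc _)
    have hd0 : d i0 =1 := inv_mul_cancel₀ hne
    have hdsum : ∑ i ∈ s, d i * v i =0 := by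
      have : ∑ i ∈ s, d i * v i = (c i0)⁻¹ * ∑ i ∈ s, c i * v i := by
        rw [Finset.mul_sum]; exact Finset.sum_congr rfl fun i _ => by simp only [d]; ring
      rw [this, hsum, mul_zero]
    by_cases hfix : ∀ γ, ∀ i ∈ s, σ γ (d i) = d i
    · refine ⟨fun i => if i ∈ s then d i else 0, fun i => ?_, ⟨i0, hi0, by simp [hi0, hd0]⟩, ?_⟩
      · dsimp only
        split_ifs with h
        · exact ⟨hd i, fun γ => hfix γ i h⟩
        · exact IntermediateField.zero_mem _
      · exact (Finset.sum_congr rfl fun i hi => by simp only [if_pos hi]).trans hdsum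
    · push Not at hfix
      obtain ⟨γ, i1, hi1, hne1⟩ := hfix
      have hi01 : i1 ≠ i0 := by
        rintro rfl; rw [hd0, map_one] at hne1; exact hne1 rfl
      have hsum2 : ∑ i ∈ s.erase i0, (σ γ (d i) - d i) * v i =0 := by
        have h1 : ∑ i ∈ s, (σ γ (d i) - d i) * v i =0 := by
          have h2 : ∑ i ∈ s, σ γ (d i) * v i =0 := by
            have := congrArg (σ γ) hdsum
            rw [map_sum, map_zero] at this
            rw [← this]; exact Finset.sum_congr rfl fun i _ => by rw [map_mul (σ γ) (d i) (v i), hv i γ]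
          simp only [sub_mul, Finset.sum_sub_distrib, h2, hdsum, sub_zero]
        rw [← Finset.add_sum_erase s _ hi0, hd0, map_one, sub_self, zero_mul, zero_add] at h1
        exact h1
      obtain ⟨c', h1, ⟨i2, hi2, hne2⟩, h3⟩ := ih (s.erase i0) (Finset.erase_ssubset hi0)
        (fun i => σ γ (d i) - d i) (fun i => F.sub_mem (hF γ _ (hd i)) (hd i))
        ⟨i1, Finset.mem_erase.mpr ⟨hi01, hi1⟩, sub_ne_zero.mpr hne1⟩ hsum2
      refine ⟨fun i => if i = i0 then 0 else c' i, fun i => ?_, ⟨i2, (Finset.mem_erase.mp hi2).2, ?_⟩, ?_⟩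
      · dsimp only; split_ifs
        · exact IntermediateField.zero_mem _
        · exact h1 i
      · simp only [if_neg (Finset.mem_erase.mp hi2).1]; exact hne2
      · rw [← Finset.add_sum_erase s _ hi0]
        simp only [if_true, zero_mul, zero_add]
        exact (Finset.sum_congr rfl fun i hi => by simp only [if_neg (Finset.mem_erase.mp hi).1]).trans h3

lemma lemA {ι : Type*} (F : IF K) (hF : ∀ γ, ∀ k ∈ F, σ γ k ∈ F)
    (x : ι → K) (hx : ∀ i, x i ∈ Fx σ) (hind : AlgebraicIndependent F x) {k : K} (hk : k ∈ Fx σ)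
    (hkF : k ∈ F ⊔ AR x) : k ∈ (F ⊓ Fx σ) ⊔ AR x := by
  classical
  obtain ⟨p, q, hq, hpq⟩ := frac_form F x hkF
  have hq0 : q ≠0 := by rintro rfl; simp at hq
  let mo : (ι →₀ ℕ) → K := fun m => ∏ i ∈ m.support, x i ^ m i
  have hmo : ∀ m, mo m ∈ Fx σ := fun m => prod_mem fun i _ => pow_mem (hx i) _
  have hmo2 : ∀ m, mo m ∈ AR x := fun m => prod_mem fun i _ => pow_mem (maO (Set.mem_range_self i)) _
  have hev : ∀ r : MvPolynomial ι F, ∀ S : Finset (ι →₀ ℕ), r.support ⊆ S → aeval x r = ∑ m ∈ S, ((coeff m r : F) : K) * mo m := by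
    intro r S hS
    rw [aeval_def, eval₂_eq]
    rw [Finset.sum_subset hS]
    · rfl
    · intro m _ hm
      rw [notMem_support_iff.mp hm]; simp
  let S := p.support ∪ q.support
  let v : (ι →₀ ℕ) ⊕ (ι →₀ ℕ) → K := Sum.elim (fun m => k * mo m) mo
  obtain ⟨c', h1, ⟨i, hi, hine⟩, h3⟩ := descend σ F hF v
    (by rintro (m | m); exacts [(Fx σ).mul_mem hk (hmo m), hmo m]) (S.disjSum S)
    (Sum.elim (fun m => ((coeff m q : F) : K)) (fun m => -((coeff m p : F) : K)))
    (by rintro (m | m); exacts [SetLike.coe_mem _, F.neg_mem (SetLike.coe_mem _)])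
    (by
      obtain ⟨m, hm⟩ := ne_zero_iff.mp hq0
      refine ⟨Sum.inl m, ?_, by simpa using hm⟩
      rw [Finset.inl_mem_disjSum]
      exact Finset.mem_union_right _ (mem_support_iff.mpr hm))
    (by
      rw [Finset.sum_disjSum]
      have e1 := hev q S Finset.subset_union_right
      have e2 := hev p S Finset.subset_union_left
      rw [e1, e2, Finset.mul_sum] at hpq
      simp only [Sum.elim_inl, Sum.elim_inr, v, neg_mul, Finset.sum_neg_distrib]
      rw [← hpq, ← sub_eq_add_neg, sub_eq_zero]
      exact Finset.sum_congr rfl fun m _ => by ring)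
  rw [Finset.sum_disjSum] at h3
  simp only [Sum.elim_inl, Sum.elim_inr, v] at h3
  have h4 : k * ∑ m ∈ S, c' (Sum.inl m) * mo m = - ∑ m ∈ S, c' (Sum.inr m) * mo m := by
    rw [eq_neg_iff_add_eq_zero, ← h3, Finset.mul_sum]
    congr 1
    exact Finset.sum_congr rfl fun m _ => by ring
  have mem : ∀ f : (ι →₀ ℕ) → (ι →₀ ℕ) ⊕ (ι →₀ ℕ), ∑ m ∈ S, c' (f m) * mo m ∈ (F ⊓ Fx σ) ⊔ AR x :=
    fun f => IntermediateField.sum_mem _ fun m _ => IntermediateField.mul_mem _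
      ((le_sup_left : F ⊓ Fx σ ≤ _) (h1 _)) ((le_sup_right : _ ≤ (F ⊓ Fx σ) ⊔ AR x) (hmo2 m))
  have lin : ∀ f : (ι →₀ ℕ) → (ι →₀ ℕ) ⊕ (ι →₀ ℕ), ∑ m ∈ S, c' (f m) * mo m =0 → ∀ m ∈ S, c' (f m) =0 := by
    intro f h0 m hm
    let r : MvPolynomial ι F := ∑ m ∈ S, monomial m (⟨c' (f m), (h1 (f m)).1⟩ : F)
    have hr : aeval x r =0 := by
      rw [← h0]
      simp only [r, map_sum, aeval_monomial]
      rfl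
    have hr0 : r =0 := (algebraicIndependent_iff.mp hind) r hr
    have := congrArg (coeff m) hr0
    simp only [r, coeff_sum, coeff_monomial, coeff_zero] at this
    rw [Finset.sum_ite_eq', if_pos hm] at this
    exact congrArg Subtype.val this
  have hD : ∑ m ∈ S, c' (Sum.inl m) * mo m ≠0 := by
    intro h0
    rw [h0, mul_zero, eq_comm, neg_eq_zero] at h4
    have a1 := lin Sum.inl h0
    have a2 := lin Sum.inr h4
    rcases i with m | m
    · exact hine (a1 m (Finset.inl_mem_disjSum.mp hi))
    · exact hine (a2 m (Finset.inr_mem_disjSum.mp hi))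
  rw [← eq_div_iff hD] at h4
  rw [h4]
  exact IntermediateField.div_mem _ (IntermediateField.neg_mem _ (mem _)) (mem _)

end fld

section dens
variable {K : Type} [Field K] [Algebra ℂ K]

lemma dens {ι : Type*} (p : MvPolynomial ι K) (s : MvPolynomial ι ℂ) (hs : s ≠0)
    (h : ∀ c : ι → ℂ, eval c s ≠0 → eval (fun i => aM K (c i)) p =0) : p =0 := by
  have h1 : p * map (aM K) s =0 := by
    apply funext_set (fun _ => Set.range (aM K))
    · intro i; exact Set.infinite_range_of_injective (aM K).injective
    · intro x hx
      choose c hc using fun i => hx i trivial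
      have : x = fun i => aM K (c i) := funext fun i => (hc i).symm
      rw [this, map_mul, map_zero]
      by_cases h0 : eval c s =0
      · have : eval (fun i => aM K (c i)) (map (aM K) s) =0 := by
          rw [eval_map]
          have := eval₂_comp_left (aM K) (RingHom.id ℂ) c s
          rw [RingHom.comp_id] at this
          change aM K (eval c s) = _ at this
          rw [h0, map_zero] at this
          exact this.symm
        rw [this, mul_zero]
      · rw [h c h0, zero_mul]
  rcases mul_eq_zero.mp h1 with h | h
  · exact h
  · exact absurd ((map_eq_zero_iff _ (map_injective _ (aM K).injective)).mp h) hs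

/-- orbit lemma -/
lemma orbit {ι κ : Type*} {K' : Type*} [Field K'] [Algebra K K'] (U : IF K)
    (x : K) (y : κ → K) (f h : MvPolynomial κ U)
    (hx : x * aeval y h = aeval y f) (s : MvPolynomial ι ℂ) (hs : s ≠0)
    (Y : κ → MvPolynomial ι K)
    (τ : ∀ c : ι → ℂ, eval c s ≠0 → ∃ τ : AE K, τ x = x ∧ (∀ u ∈ U, τ u = u) ∧
      ∀ j, τ (y j) = eval (fun i => aM K (c i)) (Y j)) (c : ι → K') :
    algebraMap K K' x * aeval (fun j => aeval c (Y j)) h = aeval (fun j => aeval c (Y j)) f := by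
  have key : C x * aeval Y h - aeval Y f =0 := by
    apply dens _ s hs
    intro c hc
    obtain ⟨τ, h1, h2, h3⟩ := τ c hc
    have hcomp : ∀ r : MvPolynomial κ U, eval (fun i => aM K (c i)) (aeval Y r) = τ (aeval y r) := by
      intro r
      induction r using MvPolynomial.induction_on with
      | C u =>
        rw [aeval_C, aeval_C]
        change eval _ (C (u : K)) = τ u
        rw [eval_C, h2 _ u.2]
      | add p q hp hq => rw [map_add, map_add, map_add, map_add, hp, hq]
      | mul_X p j hp => rw [map_mul, map_mul, map_mul, map_mul, hp, aeval_X, aeval_X, h3]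
    rw [map_sub, map_mul, eval_C, hcomp, hcomp, ← hx, map_mul, h1, sub_self]
  have := congrArg (aeval c) key
  rw [map_sub, map_mul, map_zero, sub_eq_zero] at this
  have hcomp : ∀ r : MvPolynomial κ U, aeval c (aeval Y r) = aeval (fun j => aeval c (Y j)) r := by
    intro r
    induction r using MvPolynomial.induction_on with
    | C u =>
      rw [aeval_C, aeval_C]
      change aeval c (C (u : K)) = _
      rw [aeval_C]; rfl
    | add p q hp hq => rw [map_add, map_add, map_add, hp, hq]
    | mul_X p j hp => rw [map_mul, map_mul, map_mul, hp, aeval_X, aeval_X]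
  rwa [hcomp, hcomp, aeval_C] at this

end dens

section
variable {K : Type} [Field K] [Algebra ℂ K]

lemma dens' {ι : Type*} (p : MvPolynomial ι K) (hp : p ≠0) :
    ∃ c : ι → ℂ, eval (fun i => aM K (c i)) p ≠0 := by
  by_contra! h
  exact hp (dens p 1 one_ne_zero fun c _ => h c)

lemma mem_of_point {κ : Type*} (U : IF K) (x : K) (f h : MvPolynomial κ U) (hh : h ≠0)
    (H : ∀ c : κ → ℂ, x * aeval (fun i => aM K (c i)) h = aeval (fun i => aM K (c i)) f) :
    x ∈ U := by
  obtain ⟨c, hc⟩ := dens' h hh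
  have e : ∀ r : MvPolynomial κ U, aeval (fun i => aM K (c i)) r =
      ((eval (fun i => aM U (c i)) r : U) : K) := by
    intro r
    induction r using MvPolynomial.induction_on with
    | C u => rw [aeval_C, eval_C]; rfl
    | add p q hp hq => rw [map_add, map_add, hp, hq]; rfl
    | mul_X p j hp => rw [map_mul, map_mul, hp, aeval_X, eval_X]; rfl
  have := H c
  rw [e, e, ← eq_div_iff (by simpa using hc)] at this
  rw [this]
  exact U.div_mem (SetLike.coe_mem _) (SetLike.coe_mem _)

lemma tlem (U : IF K) (ξ : K) (hξ : ξ ≠0) {x : K} (hx : x ∈ U ⊔ adj {ξ})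
    (hτ : ∀ t : ℂ, t ≠0 → ∃ τ : AE K, τ x = x ∧ (∀ u ∈ U, τ u = u) ∧ τ ξ = aM K t * ξ) :
    x ∈ U := by
  have e : ({ξ} : Set K) = Set.range (fun _ : Unit => ξ) := by simp
  rw [e] at hx
  obtain ⟨f, h, hh, hfh⟩ := frac_form U _ hx
  refine mem_of_point U x f h (by rintro rfl; simp at hh) fun c => ?_
  have := orbit (K' := K) U x (fun _ : Unit => ξ) f h hfh (X () : MvPolynomial Unit ℂ) (X_ne_zero _)
    (fun _ => X () * C ξ) (fun c hc => by
      obtain ⟨τ, h1, h2, h3⟩ := hτ (c ()) (by simpa using hc)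
      exact ⟨τ, h1, h2, fun _ => by simp [h3]⟩) (fun _ => aM K (c ()) / ξ)
  simpa [hξ] using this

lemma base_odd (U : IF K) (P : M2 K) (hP : P.det ≠0) {x : K}
    (hx : x ∈ U ⊔ adj (Set.range fun p : Fin 2 × Fin 2 => P p.1 p.2))
    (hτ : ∀ G : M2 ℂ, G.det ≠0 → ∃ τ : AE K, τ x = x ∧ (∀ u ∈ U, τ u = u) ∧
      P.map τ = G.map (aM K) * P) : x ∈ U := by
  obtain ⟨f, h, hh, hfh⟩ := frac_form U _ hx
  refine mem_of_point U x f h (by rintro rfl; simp at hh) fun c => ?_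
  let G : M2 K := Matrix.of (fun i j => aM K (c (i, j))) * P⁻¹
  have hG : ∀ p : Fin 2 × Fin 2, ∑ k, G p.1 k * P k p.2 = aM K (c p) := by
    intro p
    rw [← Matrix.mul_apply, Matrix.mul_assoc, Matrix.nonsing_inv_mul _ (isUnit_iff_ne_zero.mpr hP), Matrix.mul_one]
    rfl
  have := orbit (K' := K) U x _ f h hfh
    (X (0,0) * X (1,1) - X (0,1) * X (1,0) : MvPolynomial (Fin 2 × Fin 2) ℂ)
    (by
      intro h0
      have := congrArg (eval (fun p => if p.1 = p.2 then (1 : ℂ) else 0)) h0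
      simp at this)
    (fun p => ∑ k, X (p.1, k) * C (P k p.2)) (fun c hc => by
      obtain ⟨τ, h1, h2, h3⟩ := hτ (Matrix.of fun i j => c (i, j)) (by
        rw [Matrix.det_fin_two]; simpa using hc)
      refine ⟨τ, h1, h2, fun p => ?_⟩
      have := congrFun (congrFun h3 p.1) p.2
      rw [Matrix.map_apply] at this
      rw [this]
      simp [Matrix.mul_apply]) (fun p => G p.1 p.2)
  have e : (fun p : Fin 2 × Fin 2 => aeval (fun p => G p.1 p.2) (∑ k, X (p.1, k) * C (P k p.2) : MvPolynomial (Fin 2 × Fin 2) K)) = fun p => aM K (c p) := by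
    funext p; rw [← hG p]; simp
  rw [e] at this
  exact this

end

section ul
variable {R S : Type*} [CommRing R] [CommRing S]
def ulul (c : Fin 4 → R) : M2 R :=
  !![1, c 0; 0,1] * !![1,0; c 1,1] * !![1, c 2; 0,1] * !![1,0; c 3,1]

lemma ulul_map (f : R →+* S) (c : Fin 4 → R) : (ulul c).map f = ulul (f ∘ c) := by
  ext i j; fin_cases i <;> fin_cases j <;> simp [ulul]

lemma ulul_det (c : Fin 4 → R) : (ulul c).det =1 := by
  simp only [ulul, Matrix.det_mul, Matrix.det_fin_two_of]; ring

lemma ulul_surj {F : Type*} [Field F] (G : M2 F) (hG : G.det =1) : ∃ c, ulul c = G := by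
  rw [Matrix.det_fin_two] at hG
  by_cases h : G 1 0 =0
  · have h1 : G 1 1 ≠0 := by intro h1; rw [h, h1] at hG; simp at hG
    have h0 : G 0 0 =1 / G 1 1 := by rw [eq_div_iff h1, ← hG, h]; ring
    refine ⟨![(G 0 0 + G 0 1 -1) / G 1 1, G 1 1, (G 1 1 -1) / G 1 1, -1], ?_⟩
    ext i j; fin_cases i <;> fin_cases j <;> simp [ulul, h, h0] <;> field_simp <;> ring
  · have h0 : G 0 1 = (G 0 0 * G 1 1 -1) / G 1 0 := by rw [eq_div_iff h, ← hG]; ring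
    refine ⟨![(G 0 0 -1) / G 1 0, G 1 0, (G 1 1 -1) / G 1 0,0], ?_⟩
    ext i j; fin_cases i <;> fin_cases j <;> simp [ulul, h0] <;> field_simp <;> ring

def qf (e e' : Fin 3 → R) : R := e 1 * e' 1 -2 * (e 0 * e' 2 + e 2 * e' 0)

lemma qf_rep (G : M2 R) (hG : G.det =1) (e e' : Fin 3 → R) :
    qf (rep 2 G *ᵥ e) (rep 2 G *ᵥ e') = qf e e' := by
  have : qf (rep 2 G *ᵥ e) (rep 2 G *ᵥ e') = G.det ^2 * qf e e' := by
    rw [rep_two, Matrix.det_fin_two]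
    simp [qf, Matrix.mulVec, dotProduct, Fin.sum_univ_three]
    ring
  rw [this, hG]; ring

lemma slice {F : Type*} [Field F] [CharZero F] [IsAlgClosed F] (e e' : Fin 3 → F) (s : F) (hs : s ^2 = qf e e)
    (h1 : qf e e ≠0) (he : e 2 ≠0) (h2 : qf e e' ^2 ≠ qf e e * qf e' e') :
    ∃ G : M2 F, G.det =1 ∧ rep 2 G *ᵥ e = ![0, s,0] ∧
      rep 2 G *ᵥ e' = ![(qf e e' ^2 / qf e e - qf e' e') /4, qf e e' / qf e e * s,1] := by
  have hs0 : s ≠0 := by rintro rfl; rw [← hs] at h1; simp at h1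
  let κ : F := -1 / (4 * e 2 * s)
  let G : M2 F := !![-e 1 - s, κ * (-e 1 + s); 2 * e 2, κ * (2 * e 2)]
  have hG : G.det =1 := by
    rw [Matrix.det_fin_two]; simp [G, κ]; field_simp; ring
  have hq : s ^2 = e 1 * e 1 -4 * (e 0 * e 2) := by rw [hs, qf]; ring
  have hGe : rep 2 G *ᵥ e = ![0, s,0] := by
    rw [rep_two]
    ext i
    fin_cases i <;> simp [Matrix.mulVec, dotProduct, Fin.sum_univ_three, G, κ]
    · field_simp; linear_combination  hq
    · field_simp; linear_combination  (-2) * hq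
    · linear_combination  e 2 * hq
  obtain ⟨w, hw⟩ : ∃ w, rep 2 G *ᵥ e' = w := ⟨_, rfl⟩
  have q12 := qf_rep G hG e e'
  have q22 := qf_rep G hG e' e'
  rw [hw] at q22
  rw [hGe, hw] at q12
  simp only [qf] at q12 q22
  simp at q12
  change _ = qf e e' at q12
  change _ = qf e' e' at q22
  have hz : w 2 ≠0 := by
    intro hz
    apply h2
    rw [← q12, ← q22, ← hs, hz]; ring
  obtain ⟨c, hc⟩ := IsAlgClosed.exists_pow_nat_eq (1 / w 2) (n :=2) (by norm_num)
  have hc0 : c ≠0 := by rintro rfl; simp at hc; exact hz hc.symm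
  have hwc : w 2 =1 / c ^2 := by rw [hc]; field_simp
  let D : M2 F := !![c,0; 0, c⁻¹]
  have hD : D.det =1 := by rw [Matrix.det_fin_two]; simp [D, hc0]
  refine ⟨G * D, by rw [Matrix.det_mul, hG, hD, one_mul], ?_, ?_⟩
  · rw [← repP, ← Matrix.mulVec_mulVec, hGe, rep_two]
    ext i; fin_cases i <;> simp [Matrix.mulVec, dotProduct, Fin.sum_univ_three, D, hc0]
  · rw [← repP, ← Matrix.mulVec_mulVec, hw, rep_two, ← q12, ← q22, ← hs]
    ext i; fin_cases i <;> simp [Matrix.mulVec, dotProduct, Fin.sum_univ_three, D, hc0]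
    · have hwc' : c ^2 * w 2 =1 := by rw [hc]; field_simp
      field_simp; ring_nf; linear_combination (-4 * w 0) * hwc'
    · field_simp
    · rw [hc]; field_simp
end ul

lemma aeval_hom {U A B κ : Type*} [CommRing U] [CommRing A] [CommRing B] [Algebra U A] [Algebra U B] (φ : A →+* B)
    (hφ : ∀ u, φ (algebraMap U A u) = algebraMap U B u) (Z : κ → A) (p : MvPolynomial κ U) :
    φ (aeval Z p) = aeval (φ ∘ Z) p := by
  induction p using MvPolynomial.induction_on with
  | C u => rw [aeval_C, aeval_C, hφ]
  | add p q hp hq => rw [map_add, map_add, map_add, hp, hq]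
  | mul_X p j hp => rw [map_mul, map_mul, map_mul, hp, aeval_X, aeval_X]; rfl

lemma ulul_ev {K F : Type*} [CommRing K] [CommRing F] (φ : MvPolynomial (Fin 4) K →+* F) (w : Fin 3 → K)
    (c : Fin 4 → F) (hc : ∀ i, φ (X i) = c i) (w' : Fin 3 → F) (hw : ∀ i, φ (C (w i)) = w' i) (i) :
    φ ((rep 2 (ulul X) *ᵥ (C ∘ w)) i) = (rep 2 (ulul c) *ᵥ w') i := by
  have := congrFun (map_mulVec' φ (rep 2 (ulul X)) (C ∘ w)) i
  rw [← repM, ulul_map] at this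
  have e1 : φ ∘ (X : Fin 4 → MvPolynomial (Fin 4) K) = c := funext hc
  have e2 : φ ∘ (C ∘ w) = w' := funext hw
  rw [e1, e2] at this
  exact this

section even
variable {K : Type} [Field K] [Algebra ℂ K]

lemma AB_form {K' : Type} [Field K'] [Algebra K K'] {κ : Type} (U L : IF K) (hUL : U ≤ L) (q : K) (hq : q ∈ L)
    (u v : κ → K) (hu : ∀ i, u i ∈ L) (hv : ∀ i, v i ∈ L) (p : MvPolynomial κ U) :
    ∃ A ∈ L, ∃ B ∈ L, ∀ s : K', s ^2 = algebraMap K K' q →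
      aeval (fun i => algebraMap K K' (u i) + algebraMap K K' (v i) * s) p = algebraMap K K' A + algebraMap K K' B * s := by
  induction p using MvPolynomial.induction_on with
  | C c => exact ⟨c, hUL c.2,0, L.zero_mem, fun s _ => by rw [aeval_C]; simp; rfl⟩
  | add p p' h h' =>
    obtain ⟨A, hA, B, hB, e⟩ := h
    obtain ⟨A', hA', B', hB', e'⟩ := h'
    exact ⟨A + A', L.add_mem hA hA', B + B', L.add_mem hB hB', fun s hs => by
      rw [map_add, e s hs, e' s hs, map_add, map_add]; ring⟩
  | mul_X p j h =>
    obtain ⟨A, hA, B, hB, e⟩ := h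
    exact ⟨A * u j + B * v j * q, L.add_mem (L.mul_mem hA (hu j)) (L.mul_mem (L.mul_mem hB (hv j)) hq),
      A * v j + B * u j, L.add_mem (L.mul_mem hA (hv j)) (L.mul_mem hB (hu j)), fun s hs => by
      rw [map_mul, e s hs, aeval_X]; simp only [map_add, map_mul, ← hs]; ring⟩

lemma base_even (U : IF K) (e e' : Fin 3 → K) {x : K}
    (hx : x ∈ U ⊔ adj (Set.range (Sum.elim e e')))
    (h1 : qf e e ≠0) (he : e 2 ≠0) (h2 : qf e e' ^2 ≠ qf e e * qf e' e')
    (hτ : ∀ G : M2 ℂ, G.det =1 → ∃ τ : AE K, τ x = x ∧ (∀ u ∈ U, τ u = u) ∧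
      τ ∘ e = rep 2 (G.map (aM K)) *ᵥ e ∧ τ ∘ e' = rep 2 (G.map (aM K)) *ᵥ e') :
    x ∈ U ⊔ adj (Set.range ![qf e e, qf e e', qf e' e']) := by
  obtain ⟨f, h, hh, hfh⟩ := frac_form U _ hx
  let K' := AlgebraicClosure K
  have : CharZero K := charZero_of_injective_algebraMap (aM K).injective
  have : CharZero K' := charZero_of_injective_algebraMap (algebraMap K K').injective
  let L := U ⊔ adj (Set.range ![qf e e, qf e e', qf e' e'])
  let ι := algebraMap K K'
  have hq : ∀ i, ![qf e e, qf e e', qf e' e'] i ∈ L := fun i =>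
    (le_sup_right : _ ≤ L) (maO (Set.mem_range_self i))
  let Y : Fin 3 ⊕ Fin 3 → MvPolynomial (Fin 4) K :=
    Sum.elim (rep 2 (ulul X) *ᵥ (C ∘ e)) (rep 2 (ulul X) *ᵥ (C ∘ e'))
  have hY : ∀ {F : Type} [Field F] [Algebra K F] (c : Fin 4 → F) (w : Fin 3 → K) i,
      aeval c ((rep 2 (ulul X) *ᵥ (C ∘ w)) i : MvPolynomial (Fin 4) K) = (rep 2 (ulul c) *ᵥ (algebraMap K F ∘ w)) i := by
    intro F _ _ c w i
    exact ulul_ev ((aeval c : MvPolynomial (Fin 4) K →ₐ[K] F) : MvPolynomial (Fin 4) K →+* F) w c (by simp) _ (by simp) i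
  have orb : ∀ G : M2 K', G.det =1 →
      ι x * aeval (Sum.elim (rep 2 G *ᵥ (ι ∘ e)) (rep 2 G *ᵥ (ι ∘ e'))) h
       = aeval (Sum.elim (rep 2 G *ᵥ (ι ∘ e)) (rep 2 G *ᵥ (ι ∘ e'))) f := by
    intro G hG
    obtain ⟨c, rfl⟩ := ulul_surj G hG
    have := orbit (K' := K') U x _ f h hfh (1 : MvPolynomial (Fin 4) ℂ) one_ne_zero Y (fun c _ => by
      obtain ⟨τ, t1, t2, t3, t4⟩ := hτ (ulul c) (ulul_det c)
      refine ⟨τ, t1, t2, ?_⟩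
      rw [ulul_map] at t3 t4
      rintro (i | i)
      · refine (congrFun t3 i).trans ?_
        have := hY (F := K) (fun i => aM K (c i)) e i
        exact this.symm
      · refine (congrFun t4 i).trans ?_
        have := hY (F := K) (fun i => aM K (c i)) e' i
        exact this.symm) c
    have hYc : (fun j => aeval c (Y j)) = Sum.elim (rep 2 (ulul c) *ᵥ (ι ∘ e)) (rep 2 (ulul c) *ᵥ (ι ∘ e')) := by
      funext j
      rcases j with i | i
      · exact hY c e i
      · exact hY c e' i
    rwa [hYc] at this
  have hι : Function.Injective ι := (algebraMap K K').injective
  have hqι : ∀ w w' : Fin 3 → K, qf (ι ∘ w) (ι ∘ w') = ι (qf w w') := by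
    intro w w'; simp only [qf, Function.comp, map_sub, map_mul, map_add, map_ofNat]
  obtain ⟨s, hs⟩ := IsAlgClosed.exists_pow_nat_eq (ι (qf e e)) (n :=2) (by norm_num)
  let S : K' → (Fin 3 → K') := fun s => ![0, s,0]
  let S' : K' → (Fin 3 → K') := fun s => ![ι ((qf e e' ^2 / qf e e - qf e' e') /4), ι (qf e e' / qf e e) * s,1]
  have sl : ∀ s, s ^2 = ι (qf e e) → ∃ G : M2 K', G.det =1 ∧ rep 2 G *ᵥ (ι ∘ e) = S s ∧
      rep 2 G *ᵥ (ι ∘ e') = S' s := by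
    intro s hs
    have := slice (ι ∘ e) (ι ∘ e') s (by rw [hs, hqι]) (by rw [hqι]; simpa using h1)
      (by simpa using he) (by rw [hqι, hqι, hqι, ← map_pow, ← map_mul]; exact fun h => h2 (hι h))
    simpa only [hqι, ← map_pow, ← map_div₀, ← map_sub, ← map_ofNat ι 4] using this
  obtain ⟨G0, hG0, hG1, hG2⟩ := sl s hs
  let Z : Fin 3 ⊕ Fin 3 → MvPolynomial (Fin 4) K' :=
    Sum.elim (rep 2 (ulul X) *ᵥ (C ∘ S s)) (rep 2 (ulul X) *ᵥ (C ∘ S' s))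
  have hZ : ∀ c : Fin 4 → K', (fun j => eval c (Z j)) = Sum.elim (rep 2 (ulul c) *ᵥ S s) (rep 2 (ulul c) *ᵥ S' s) := by
    intro c
    have : ∀ w : Fin 3 → K', ∀ i, eval c ((rep 2 (ulul X) *ᵥ (C ∘ w)) i) = (rep 2 (ulul c) *ᵥ w) i := by
      intro w i
      exact ulul_ev (eval c) w c (by simp) _ (by simp) i
    funext j
    rcases j with i | i
    · exact this _ i
    · exact this _ i
  have hev : ∀ c : Fin 4 → K', eval c (aeval Z h) = aeval (fun j => eval c (Z j)) h := by
    intro c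
    exact aeval_hom (U := U) (eval c) (fun u => eval_C _) Z h
  obtain ⟨c, hc⟩ := dens' (aeval Z h) (by
    intro h0
    obtain ⟨c, hc⟩ := ulul_surj G0⁻¹ (by rw [Matrix.det_nonsing_inv, hG0]; simp)
    have := hev c
    rw [h0, map_zero, hZ, hc, ← hG1, ← hG2, Matrix.mulVec_mulVec, Matrix.mulVec_mulVec, repP,
      Matrix.mul_nonsing_inv _ (by rw [hG0]; exact isUnit_one), repO, Matrix.one_mulVec, Matrix.one_mulVec] at this
    apply hh
    apply hι
    rw [map_zero, this, aeval_hom (U := U) (A := K) (B := K') ι (fun u => rfl)]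
    congr 2
    funext j; rcases j with i | i <;> rfl)
  rw [hev, hZ] at hc
  obtain ⟨N, hN⟩ : ∃ N : M2 ℂ, N = ulul c := ⟨_, rfl⟩
  have hN2 : ulul (fun i => aM K' (c i)) = N.map (aM K') := by rw [hN, ulul_map]; rfl
  have hNdet : N.det =1 := by rw [hN]; exact ulul_det c
  rw [hN2] at hc
  let NK : M3 K := rep 2 (N.map (aM K))
  have hNK : rep 2 (N.map (aM K')) = NK.map ι := by
    rw [← repM, Matrix.map_map]; congr 1
  have hNKL : ∀ w : Fin 3 → K, (∀ i, w i ∈ L) → ∀ i, (NK *ᵥ w) i ∈ L := by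
    intro w hw i
    have : NK = (rep 2 N).map (aM K) := repM _ _ _
    rw [this]
    change ∑ j, aM K (rep 2 N i j) * w j ∈ L
    exact sum_mem fun j _ => L.mul_mem (L.algebraMap_mem _) (hw j)
  let y := (qf e e' ^2 / qf e e - qf e' e') /4
  let z := qf e e' / qf e e
  have hz : z ∈ L := L.div_mem (hq 1) (hq 0)
  have hy : y ∈ L := L.div_mem (L.sub_mem (L.div_mem (pow_mem (hq 1) 2) (hq 0)) (hq 2)) (ofNat_mem L 4)
  let u : Fin 3 ⊕ Fin 3 → K := Sum.elim (NK *ᵥ ![0,0,0]) (NK *ᵥ ![y,0,1])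
  let v : Fin 3 ⊕ Fin 3 → K := Sum.elim (NK *ᵥ ![0,1,0]) (NK *ᵥ ![0, z,0])
  have hu : ∀ j, u j ∈ L := by
    rintro (j | j)
    · exact hNKL _ (by intro i; fin_cases i <;> exact L.zero_mem) j
    · exact hNKL _ (by intro i; fin_cases i; exacts [hy, L.zero_mem, L.one_mem]) j
  have hv : ∀ j, v j ∈ L := by
    rintro (j | j)
    · exact hNKL _ (by intro i; fin_cases i; exacts [L.zero_mem, L.one_mem, L.zero_mem]) j
    · exact hNKL _ (by intro i; fin_cases i; exacts [L.zero_mem, hz, L.zero_mem]) j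
  have huv : ∀ s, Sum.elim (NK.map ι *ᵥ S s) (NK.map ι *ᵥ S' s) = fun j => ι (u j) + ι (v j) * s := by
    intro s
    funext j
    rcases j with j | j <;> simp [S, S', u, v, Matrix.mulVec, dotProduct, Fin.sum_univ_three, y, z] <;> ring
  have orb2 : ∀ s, s ^2 = ι (qf e e) → ι x * aeval (fun j => ι (u j) + ι (v j) * s) h = aeval (fun j => ι (u j) + ι (v j) * s) f := by
    intro s hs
    obtain ⟨G, g0, g1, g2⟩ := sl s hs
    have := orb (G * N.map (aM K')) (by
      rw [Matrix.det_mul, g0, one_mul]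
      have := congrArg (aM K') hNdet
      rw [map_one, RingHom.map_det] at this
      exact this)
    rw [← repP, ← Matrix.mulVec_mulVec, ← Matrix.mulVec_mulVec, g1, g2, hNK, huv] at this
    exact this
  obtain ⟨A, hA, B, hB, hAB⟩ := AB_form (K' := K') U L le_sup_left (qf e e) (hq 0) u v hu hv f
  obtain ⟨A', hA', B', hB', hAB'⟩ := AB_form (K' := K') U L le_sup_left (qf e e) (hq 0) u v hu hv h
  have hs' : (-s) ^2 = ι (qf e e) := by rw [neg_sq, hs]
  have r1 := orb2 s hs
  have r2 := orb2 (-s) hs'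
  rw [hNK, huv, hAB' s hs] at hc
  rw [hAB s hs, hAB' s hs] at r1
  rw [hAB (-s) hs', hAB' (-s) hs'] at r2
  change ι x * (ι A' + ι B' * s) = ι A + ι B * s at r1
  change ι x * (ι A' + ι B' * -s) = ι A + ι B * -s at r2
  have hs0 : s ≠0 := by rintro rfl; apply h1; apply hι; rw [← hs]; simp
  have a1 : x * A' = A := by
    apply hι; rw [map_mul]
    linear_combination (r1 + r2) /2
  have a2 : x * B' = B := by
    apply hι; rw [map_mul]
    have : (ι x * ι B' - ι B) * s =0 := by linear_combination (r1 - r2) /2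
    exact sub_eq_zero.mp ((mul_eq_zero.mp this).resolve_right hs0)
  by_cases hA0 : A' =0
  · have hB0 : B' ≠0 := by rintro rfl; rw [hA0] at hc; simp at hc
    rw [← eq_div_iff hB0] at a2
    rw [a2]; exact L.div_mem hB hB'
  · rw [← eq_div_iff hA0] at a1
    rw [a1]; exact L.div_mem hA hA'
end even

section
variable {K : Type} [Field K] [Algebra ℂ K]

lemma indep_mono {A B ι : Type*} [CommRing A] [CommRing B] [Algebra A K] [Algebra B K] (f : A →+* B)
    (hf : Function.Injective f) (hc : ∀ x, algebraMap B K (f x) = algebraMap A K x) {y : ι → K}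
    (h : AlgebraicIndependent B y) : AlgebraicIndependent A y := by
  rw [algebraicIndependent_iff] at h ⊢
  intro p hp
  have := h (map f p) (by
    rw [← hp, aeval_def, aeval_def, eval₂_map]
    congr 1
    exact RingHom.ext hc)
  exact (map_eq_zero_iff _ (map_injective _ hf)).mp this

lemma indep_sub {ι : Type*} {A B : IF K} (hAB : A ≤ B) {y : ι → K}
    (h : AlgebraicIndependent B y) : AlgebraicIndependent A y :=
  indep_mono (IntermediateField.inclusion hAB).toRingHom (IntermediateField.inclusion_injective hAB) (fun _ => rfl) h

lemma mem_adjoin_sup {U : IF K} {S : Set K} {z : K} :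
    z ∈ IntermediateField.adjoin U S ↔ z ∈ U ⊔ adj S := by
  have h : (IntermediateField.adjoin U S).restrictScalars ℂ = U ⊔ adj S := by
    apply le_antisymm
    · let T : IntermediateField U K := IntermediateField.extendScalars (le_sup_left : U ≤ U ⊔ adj S)
      have : IntermediateField.adjoin U S ≤ T := by
        rw [IntermediateField.adjoin_le_iff]
        intro s hs
        exact (le_sup_right : _ ≤ U ⊔ adj S) (maO hs)
      exact fun x hx => this hx
    · refine sup_le ?_ ?_
      · intro y hy
        exact (IntermediateField.adjoin U S).algebraMap_mem ⟨y, hy⟩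
      · rw [IntermediateField.adjoin_le_iff]
        exact IntermediateField.subset_adjoin U _
  rw [← h]; rfl

lemma indep_sum_iff {ι κ : Type*} (U : IF K) {x : ι → K} {y : κ → K} :
    AlgebraicIndependent U (Sum.elim x y) ↔
      AlgebraicIndependent U x ∧ AlgebraicIndependent ↥(U ⊔ AR x) y := by
  have h1 : AlgebraicIndependent U (Sum.elim x y) ↔ AlgebraicIndependent U (Sum.elim y x) := by
    rw [← algebraicIndependent_equiv (Equiv.sumComm κ ι)]
    have : (Sum.elim x y ∘ (Equiv.sumComm κ ι)) = Sum.elim y x := by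
      ext (_ | _) <;> rfl
    rw [this]
  rw [h1, AlgebraicIndependent.sumElim_iff, ← IntermediateField.algebraicIndependent_adjoin_iff]
  refine and_congr_right fun _ => ⟨fun h => ?_, fun h => ?_⟩
  · refine indep_mono (B := IntermediateField.adjoin U (Set.range x))
      ⟨⟨⟨fun z => ⟨z.1, mem_adjoin_sup.mpr z.2⟩, rfl⟩, fun _ _ => rfl⟩, rfl, fun _ _ => rfl⟩ ?_ (fun _ => rfl) h
    intro a b hab
    exact Subtype.ext (congrArg (fun z => z.1) hab)
  · refine indep_mono (B := ↥(U ⊔ AR x))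
      ⟨⟨⟨fun z => ⟨z.1, mem_adjoin_sup.mp z.2⟩, rfl⟩, fun _ _ => rfl⟩, rfl, fun _ _ => rfl⟩ ?_ (fun _ => rfl) h
    intro a b hab
    exact Subtype.ext (congrArg (fun z => z.1) hab)

lemma q_indep' (U : Type) [Field U] [Algebra ℂ U] [Algebra U K] (e e' : Fin 3 → K) (h : AlgebraicIndependent U (Sum.elim e e')) :
    AlgebraicIndependent U ![qf e e, qf e e', qf e' e'] := by
  rw [algebraicIndependent_iff] at h ⊢
  intro p hp
  let E : Fin 3 → MvPolynomial (Fin 3 ⊕ Fin 3) U := fun i => X (Sum.inl i)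
  let E' : Fin 3 → MvPolynomial (Fin 3 ⊕ Fin 3) U := fun i => X (Sum.inr i)
  have h1 : aeval ![qf E E, qf E E', qf E' E'] p =0 := by
    apply h
    have := aeval_hom (U := U) ((aeval (Sum.elim e e') : MvPolynomial (Fin 3 ⊕ Fin 3) U →ₐ[U] K) : _ →+* K)
      (fun u => by simp) ![qf E E, qf E E', qf E' E'] p
    refine this.trans (Eq.trans ?_ hp)
    congr 2
    funext i
    fin_cases i <;> simp [qf, E, E']
  by_contra hne
  obtain ⟨c, hc⟩ := dens' p hne
  obtain ⟨r, hr⟩ := IsAlgClosed.exists_pow_nat_eq (c 2) (n :=2) (by norm_num)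
  apply hc
  let i := aM U
  have := aeval_hom (U := U) (eval (Sum.elim ![i (- c 0 /4),0,1] ![i (-c 1 /2), i r,0])
    : MvPolynomial (Fin 3 ⊕ Fin 3) U →+* U) (fun u => by exact eval_C _) ![qf E E, qf E E', qf E' E'] p
  rw [h1, map_zero] at this
  rw [this]
  change aeval (fun i => aM U (c i)) p = _
  congr 2
  have : CharZero U := charZero_of_injective_algebraMap (aM U).injective
  funext k
  fin_cases k
  · simp [qf, E, i]; rw [show aM U 4 =4 from map_ofNat _ 4]; field_simp; ring
  · simp [qf, E, E', i]; rw [show aM U 2 =2 from map_ofNat _ 2]; field_simp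
  · simp [qf, E', i]; rw [← hr, map_pow, sq]

lemma q_indep (U : IF K) (e e' : Fin 3 → K) (h : AlgebraicIndependent U (Sum.elim e e')) :
    AlgebraicIndependent U ![qf e e, qf e e', qf e' e'] := q_indep' U e e' h

lemma q_ne {U : IF K} {e e' : Fin 3 → K} (h : AlgebraicIndependent U (Sum.elim e e')) :
    qf e e ≠0 ∧ e 2 ≠0 ∧ qf e e' ^2 ≠ qf e e * qf e' e' := by
  have hq := q_indep U e e' h
  refine ⟨hq.ne_zero 0, h.ne_zero (Sum.inl 2), ?_⟩
  intro h0
  rw [algebraicIndependent_iff] at hq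
  have := hq (X 1 ^2 - X 0 * X 2) (by simp [h0])
  have := congrArg (eval ![(0 : U),1,0]) this
  simp at this
end

section fin
variable {K : Type} [Field K] [Algebra ℂ K]

abbrev GG := SL2 × SL2 × ℂˣ
abbrev ic (K : Type) [Field K] [Algebra ℂ K] (g : SL2) : M2 K := g.1.map (aM K)

lemma icD (g : SL2) : (ic K g).det =1 := by
  have := congrArg (aM K) g.2
  rw [map_one, RingHom.map_det] at this
  exact this

lemma saL {U L : IF K} {ι : Type*} {x : ι → K} (h1 : U ≤ L) (h2 : ∀ i, x i ∈ L) :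
    U ⊔ AR x ≤ L := by
  refine sup_le h1 ?_
  rw [IntermediateField.adjoin_le_iff]
  rintro _ ⟨i, rfl⟩; exact h2 i

lemma adL {L : IF K} {ι : Type*} {x : ι → K} (h2 : ∀ i, x i ∈ L) :
    AR x ≤ L := by
  rw [IntermediateField.adjoin_le_iff]
  rintro _ ⟨i, rfl⟩; exact h2 i

lemma msr {U : IF K} {ι : Type*} (x : ι → K) (i : ι) : x i ∈ U ⊔ AR x :=
  (le_sup_right : _ ≤ U ⊔ AR x) (maO (Set.mem_range_self i))

lemma pres {U L : IF K} {ι : Type*} {x : ι → K} (τ : AE K) (h1 : ∀ u ∈ U, τ u ∈ L) (h2 : ∀ i, τ (x i) ∈ L) :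
    ∀ u ∈ U ⊔ AR x, τ u ∈ L := by
  have : U ⊔ AR x ≤ L.comap τ := saL h1 h2
  exact this

lemma rep2_mem {n : ℕ} (L : IF K) (g : SL2) {w : Fin (n+1) → K} (hw : ∀ i, w i ∈ L) (i) :
    (rep n (ic K g) *ᵥ w) i ∈ L := by
  rw [show rep n (ic K g) = (rep n g.1).map (aM K) from repM _ _ _]
  change ∑ j, aM K (rep n g.1 i j) * w j ∈ L
  exact sum_mem fun j _ => L.mul_mem (L.algebraMap_mem _) (hw j)

/-- conclusion -/
def Concl (σ : GG → AE K) (U : IF K) (N : ℕ) : Prop :=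
  ∃ (τ : Type) (_ : Fintype τ) (T : τ → K), Fintype.card τ = N ∧ AlgebraicIndependent ↥(U ⊓ Fx σ) T ∧
    Fx σ = (U ⊓ Fx σ) ⊔ AR T

lemma even_finish (σ : GG → AE K) (U : IF K) (hU : ∀ γ, ∀ u ∈ U, σ γ u ∈ U)
    (hU1 : ∀ γ : GG, γ.2.1 =1 → ∀ u ∈ U, σ γ u = u) {τ : Type} [Fintype τ] (e e' : Fin 3 → K) (ξ : K) (T : τ → K)
    (hind : AlgebraicIndependent U (Sum.elim (Sum.elim (Sum.elim e e') (fun _ : Unit => ξ)) T))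
    (htop : U ⊔ adj (Set.range (Sum.elim (Sum.elim (Sum.elim e e') (fun _ : Unit => ξ)) T)) = ⊤)
    (he : ∀ γ, σ γ ∘ e = rep 2 (ic K γ.1) *ᵥ e) (he' : ∀ γ, σ γ ∘ e' = rep 2 (ic K γ.1) *ᵥ e')
    (l : GG → K) (hl : ∀ γ, l γ ∈ U) (hl1 : ∀ γ : GG, γ.2.1 =1 → l γ = aM K (γ.2.2 : ℂ)) (hξ : ∀ γ, σ γ ξ = l γ * ξ)
    (hT : ∀ i, T i ∈ Fx σ) : Concl σ U (3 + Fintype.card τ) := by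
  let x1 := Sum.elim e e'
  let x2 := Sum.elim x1 (fun _ : Unit => ξ)
  let F0 := U ⊔ AR x1
  let F1 := U ⊔ AR x2
  let q := ![qf e e, qf e e', qf e' e']
  obtain ⟨i2, iT⟩ := (indep_sum_iff U).mp hind
  obtain ⟨i1, iξ⟩ := (indep_sum_iff U).mp i2
  have iq := q_indep U e e' i1
  obtain ⟨n1, n2, n3⟩ := q_ne i1
  have cf : ∀ γ (w w' : Fin 3 → K), σ γ ∘ w = rep 2 (ic K γ.1) *ᵥ w → σ γ ∘ w' = rep 2 (ic K γ.1) *ᵥ w' →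
      σ γ (qf w w') = qf w w' := by
    intro γ w w' h h'
    refine Eq.trans ?_ (qf_rep (ic K γ.1) (icD γ.1) w w')
    rw [← h, ← h']
    simp only [qf, Function.comp, map_sub, map_mul, map_add, map_ofNat]
  have hqF : ∀ i, q i ∈ Fx σ := by
    intro i γ
    fin_cases i
    exacts [cf γ _ _ (he γ) (he γ), cf γ _ _ (he γ) (he' γ), cf γ _ _ (he' γ) (he' γ)]
  have F01 : F0 ≤ F1 := saL le_sup_left (fun i => msr x2 (Sum.inl i))
  have hx1 : ∀ γ i, σ γ (x1 i) ∈ F0 := by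
    rintro γ (i | i)
    · have := congrFun (he γ) i
      change σ γ (e i) ∈ F0
      change σ γ (e i) = _ at this
      rw [this]
      exact rep2_mem F0 γ.1 (fun i => msr x1 (Sum.inl i)) i
    · have := congrFun (he' γ) i
      change σ γ (e' i) ∈ F0
      change σ γ (e' i) = _ at this
      rw [this]
      exact rep2_mem F0 γ.1 (fun i => msr x1 (Sum.inr i)) i
  have hF1 : ∀ γ, ∀ k ∈ F1, σ γ k ∈ F1 := by
    intro γ
    apply pres
    · exact fun u hu => (le_sup_left : U ≤ F1) (hU γ u hu)
    · rintro (i | i)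
      · exact F01 (hx1 γ i)
      · change σ γ ξ ∈ F1
        rw [hξ]
        exact F1.mul_mem ((le_sup_left : U ≤ F1) (hl γ)) (msr x2 (Sum.inr ()))
  have iT' : AlgebraicIndependent F1 T := iT
  have step : ∀ y ∈ F1, y ∈ Fx σ → y ∈ (U ⊓ Fx σ) ⊔ AR q := by
    intro y hy hyσ
    have y1 : y ∈ F0 := by
      apply tlem F0 ξ (iξ.ne_zero ())
      · refine saL (le_sup_of_le_left le_sup_left) ?_ hy
        rintro (i | i)
        · exact (le_sup_left : F0 ≤ _) (msr x1 i)
        · exact (le_sup_right : _ ≤ F0 ⊔ adj {ξ}) (maO rfl)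
      · intro t ht
        refine ⟨σ (1,1, Units.mk0 t ht), hyσ _, ?_, ?_⟩
        · let γ : GG := (1,1, Units.mk0 t ht)
          have : F0 ≤ Fx (fun _ : Unit => σ γ) := by
            refine saL (fun u hu _ => hU1 γ rfl u hu) ?_
            have h1 : ic K γ.1 =1 := by
              change (1 : M2 ℂ).map _ =1
              simp
            rintro (i | i) _
            · have := congrFun (he γ) i
              rw [h1, repO, Matrix.one_mulVec] at this
              exact this
            · have := congrFun (he' γ) i
              rw [h1, repO, Matrix.one_mulVec] at this
              exact this
          exact fun u hu => this hu ()
        · rw [hξ, hl1 _ rfl]; rfl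
    have y2 : y ∈ U ⊔ AR q := by
      apply base_even U e e' y1 n1 n2 n3
      intro G hG
      let γ : GG := (⟨G, hG⟩,1,1)
      exact ⟨σ γ, hyσ _, hU1 γ rfl, he γ, he' γ⟩
    exact lemA σ U hU q hqF iq hyσ y2
  refine ⟨Fin 3 ⊕ τ, inferInstance, Sum.elim q T, by simp, ?_, ?_⟩
  · apply indep_sub (inf_le_left : U ⊓ Fx σ ≤ U)
    rw [indep_sum_iff]
    refine ⟨iq, indep_sub ?_ iT'⟩
    refine saL le_sup_left ?_
    have hx : ∀ i, x1 i ∈ F1 := fun i => msr x2 (Sum.inl i)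
    have h3 : ∀ w w' : Fin 3 → K, (∀ i, w i ∈ F1) → (∀ i, w' i ∈ F1) → qf w w' ∈ F1 := by
      intro w w' h h'
      exact F1.sub_mem (F1.mul_mem (h 1) (h' 1)) (F1.mul_mem (ofNat_mem F1 2)
        (F1.add_mem (F1.mul_mem (h 0) (h' 2)) (F1.mul_mem (h 2) (h' 0))))
    have a1 : ∀ i, e i ∈ F1 := fun i => hx (Sum.inl i)
    have a2 : ∀ i, e' i ∈ F1 := fun i => hx (Sum.inr i)
    intro i; fin_cases i
    exacts [h3 _ _ a1 a1, h3 _ _ a1 a2, h3 _ _ a2 a2]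
  · apply le_antisymm
    · intro k hk
      have hkF : k ∈ F1 ⊔ AR T := by
        have : k ∈ (⊤ : IF K) := trivial
        rw [← htop] at this
        refine saL (le_sup_of_le_left le_sup_left) ?_ this
        rintro (i | i)
        · exact (le_sup_left : F1 ≤ _) (msr x2 i)
        · exact msr T i
      have := lemA σ F1 hF1 T hT iT' hk hkF
      refine saL ?_ ?_ this
      · intro y hy
        refine saL le_sup_left ?_ (step y hy.1 hy.2)
        exact fun i => msr (Sum.elim q T) (Sum.inl i)
      · exact fun i => msr (Sum.elim q T) (Sum.inr i)
    · refine saL inf_le_right ?_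
      rintro (i | i)
      exacts [hqF i, hT i]

lemma odd_finish (σ : GG → AE K) (U : IF K) (hU : ∀ γ, ∀ u ∈ U, σ γ u ∈ U)
    (hU1 : ∀ γ : GG, γ.2.1 =1 → ∀ u ∈ U, σ γ u = u) {τ : Type} [Fintype τ] (P : M2 K) (T : τ → K)
    (hP : P.det ≠0)
    (hind : AlgebraicIndependent U (Sum.elim (fun p : Fin 2 × Fin 2 => P p.1 p.2) T))
    (htop : U ⊔ adj (Set.range (Sum.elim (fun p : Fin 2 × Fin 2 => P p.1 p.2) T)) = ⊤)
    (he : ∀ γ, P.map (σ γ) = aM K (γ.2.2 : ℂ) • (rep 1 (ic K γ.1) * P))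
    (hT : ∀ i, T i ∈ Fx σ) : Concl σ U (Fintype.card τ) := by
  let x1 := fun p : Fin 2 × Fin 2 => P p.1 p.2
  let F1 := U ⊔ AR x1
  obtain ⟨i1, iT⟩ := (indep_sum_iff U).mp hind
  have iT' : AlgebraicIndependent F1 T := iT
  have hF1 : ∀ γ, ∀ k ∈ F1, σ γ k ∈ F1 := by
    intro γ
    apply pres
    · exact fun u hu => (le_sup_left : U ≤ F1) (hU γ u hu)
    · intro p
      have := congrFun (congrFun (he γ) p.1) p.2
      change σ γ (P p.1 p.2) = aM K (γ.2.2 : ℂ) * ((rep 1 (ic K γ.1)) *ᵥ (fun i => P i p.2)) p.1 at this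
      change σ γ (P p.1 p.2) ∈ F1
      rw [this]
      exact F1.mul_mem (F1.algebraMap_mem _) (rep2_mem F1 _ (fun i => msr x1 (i, p.2)) _)
  have step : ∀ y ∈ F1, y ∈ Fx σ → y ∈ U := by
    intro y hy hyσ
    apply base_odd U P hP hy
    intro G hG
    obtain ⟨t, ht⟩ := IsAlgClosed.exists_pow_nat_eq G.det (n :=2) (by norm_num)
    have ht0 : t ≠0 := by rintro rfl; rw [← ht] at hG; simp at hG
    let g : SL2 := ⟨!![G 1 1 / t, G 0 1 / t; G 1 0 / t, G 0 0 / t], by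
      rw [Matrix.det_fin_two_of]
      rw [Matrix.det_fin_two] at ht
      field_simp
      linear_combination -ht⟩
    let γ : GG := (g,1, Units.mk0 t ht0)
    refine ⟨σ γ, hyσ _, hU1 γ rfl, ?_⟩
    rw [he γ, ← Matrix.smul_mul]
    congr 1
    have ht' : aM K t ≠0 := by simpa using ht0
    rw [rep_oneD]
    ext i j
    fin_cases i <;> fin_cases j <;> simp [γ, g] <;> field_simp
  refine ⟨τ, inferInstance, T, rfl, ?_, ?_⟩
  · apply indep_sub (inf_le_left : U ⊓ Fx σ ≤ U)
    exact indep_sub le_sup_left iT'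
  · apply le_antisymm
    · intro k hk
      have hkF : k ∈ F1 ⊔ AR T := by
        have : k ∈ (⊤ : IF K) := trivial
        rw [← htop] at this
        refine saL (le_sup_of_le_left le_sup_left) ?_ this
        rintro (i | i)
        · exact (le_sup_left : F1 ≤ _) (msr x1 i)
        · exact msr T i
      have := lemA σ F1 hF1 T hT iT' hk hkF
      refine saL ?_ ?_ this
      · intro y hy
        exact (le_sup_left : U ⊓ Fx σ ≤ _) ⟨step y hy.1 hy.2, hy.2⟩
      · exact fun i => msr T i
    · exact saL inf_le_right hT
end fin

section cov
variable {R : Type*} [CommRing R] {S : Type*} [CommRing S]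

def Xk (d : ℕ) (k : Fin 3) : MM d d R := mq d (Pi.single k 1)

lemma Xk_map (d : ℕ) (k : Fin 3) (f : R →+* S) : (Xk d k : Matrix _ _ R).map f = Xk d k := by
  unfold Xk
  rw [mq_map]; congr 1
  ext j; simp only [Function.comp, Pi.single_apply]; split_ifs <;> simp

lemma mq_eq (d : ℕ) (q : Fin 3 → R) : mq d q = ∑ k, q k • Xk d k := by
  ext i j
  simp only [Fin.sum_univ_three, Xk, Matrix.add_apply, Matrix.smul_apply, mq_apply, smul_eq_mul]
  simp [Pi.single_apply]
  split_ifs <;> ring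

def pi2 (d : ℕ) (Z : MM d d R) : Fin 3 → R :=
  ![trace (Xk d 2 * Z), -2 * trace (Xk d 1 * Z), trace (Xk d 0 * Z)]

lemma trace_map' {n : Type*} [Fintype n] (f : R →+* S) (Z : Matrix n n R) :
    f (trace Z) = trace (Z.map f) := by simp [trace, map_sum]

lemma pi2_map (d : ℕ) (Z : MM d d R) (f : R →+* S) :
    f ∘ pi2 d Z = pi2 d (Z.map f) := by
  funext k
  have h (k) : f (trace (Xk d k * Z)) = trace (Xk d k * Z.map f) := by
    rw [trace_map', Matrix.map_mul, Xk_map]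
  have h2 : f 2 =2 := map_ofNat f 2
  fin_cases k <;> simp [pi2, h, h2]

lemma pi2_smul (d : ℕ) (c : R) (Z : MM d d R) :
    pi2 d (c • Z) = c • pi2 d Z := by
  funext k
  fin_cases k <;> simp [pi2] <;> ring

lemma rep_adj (d : ℕ) {g : M2 R} (hg : g.det =1) :
    rep d g * rep d g.adjugate =1 := by
  rw [repP, adjugate_mul, hg, one_smul, repO]

lemma trace_conj (d : ℕ) {g : M2 R} (hg : g.det =1)
    {Z Z' : MM d d R} (h : rep d g * Z = Z' * rep d g) :
    trace Z' = trace Z := by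
  have h1 : Z' = rep d g * Z * rep d g.adjugate := by
    rw [h, Matrix.mul_assoc, rep_adj d hg, Matrix.mul_one]
  have h2 : rep d g.adjugate * rep d g =1 := by
    rw [repP, mul_adjugate, hg, one_smul, repO]
  rw [h1, trace_mul_comm, ← Matrix.mul_assoc, h2, Matrix.one_mul]

def Ga : M3 R := !![0,0,1; 0, -2,0; 1,0,0]
def Gb : M3 R := !![0,0,2; 0, -1,0; 2,0,0]

lemma rep_Ga {g : M2 R} (hg : g.det =1) :
    rep 2 g * Ga * (rep 2 g)ᵀ = Ga := by
  have : rep 2 g * Ga * (rep 2 g)ᵀ = g.det ^2 • Ga := by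
    rw [rep_two, det_fin_two]
    ext i j
    fin_cases i <;> fin_cases j <;> simp [Ga, mul_apply, Fin.sum_univ_three] <;> ring
  rw [this, hg]; simp

lemma rep_Gb {g : M2 R} (hg : g.det =1) :
    (rep 2 g)ᵀ * Gb * rep 2 g = Gb := by
  have : (rep 2 g)ᵀ * Gb * rep 2 g = g.det ^2 • Gb := by
    rw [rep_two, det_fin_two]
    ext i j
    fin_cases i <;> fin_cases j <;> simp [Gb, mul_apply, Fin.sum_univ_three] <;> ring
  rw [this, hg]; simp

lemma rep2_det {g : M2 R} (hg : g.det =1) : (rep 2 g).det =1 := by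
  have : (rep 2 g).det = g.det ^3 := by
    rw [rep_two, det_fin_two, det_fin_three]; simp; ring
  rw [this, hg, one_pow]

lemma trace_mq_conj (d : ℕ) {g : M2 R} (hg : g.det =1)
    {Z Z' : MM d d R} (h : rep d g * Z = Z' * rep d g) (q : Fin 3 → R) :
    trace (mq d (rep 2 g *ᵥ q) * Z') = trace (mq d q * Z) := by
  apply trace_conj d hg
  rw [← Matrix.mul_assoc, rep_mq d hg, Matrix.mul_assoc, h, Matrix.mul_assoc]

lemma pi2_conj (d : ℕ) {g : M2 R} (hg : g.det =1)
    {Z Z' : MM d d R} (h : rep d g * Z = Z' * rep d g) :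
    pi2 d Z' = rep 2 g *ᵥ pi2 d Z := by
  have hT : (fun k => trace (Xk d k * Z)) = (rep 2 g)ᵀ *ᵥ (fun k => trace (Xk d k * Z')) := by
    funext k
    have := trace_mq_conj d hg h (Pi.single k 1)
    rw [mq_eq d (rep 2 g *ᵥ _), Finset.sum_mul, trace_sum] at this
    simp only [mulVec_single_one, Matrix.smul_mul, trace_smul, col_apply, smul_eq_mul] at this
    exact this.symm
  have hp (Z : MM d d R) :
      pi2 d Z = Ga *ᵥ (fun k => trace (Xk d k * Z)) := by
    funext k
    fin_cases k <;> simp [pi2, Ga, mulVec, dotProduct, Fin.sum_univ_three]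
  rw [hp, hp, hT, mulVec_mulVec, mulVec_mulVec, rep_Ga hg]

def br (e e' : Fin 3 → R) : Fin 3 → R :=
  ![e 1 * e' 0 - e 0 * e' 1,2 * (e 2 * e' 0 - e 0 * e' 2), e 2 * e' 1 - e 1 * e' 2]

lemma br_rep {g : M2 R} (hg : g.det =1) (e e' : Fin 3 → R) :
    br (rep 2 g *ᵥ e) (rep 2 g *ᵥ e') = rep 2 g *ᵥ br e e' := by
  have : br (rep 2 g *ᵥ e) (rep 2 g *ᵥ e') = g.det • (rep 2 g *ᵥ br e e') := by
    rw [rep_two, det_fin_two]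
    funext i
    fin_cases i <;> simp [br, mulVec, dotProduct, Fin.sum_univ_three] <;> ring
  rw [this, hg, one_smul]

lemma br_smul (c c' : R) (e e' : Fin 3 → R) : br (c • e) (c' • e') = (c * c') • br e e' := by
  funext i
  fin_cases i <;> simp [br] <;> ring

lemma br_map (f : R →+* S) (e e' : Fin 3 → R) : f ∘ br e e' = br (f ∘ e) (f ∘ e') := by
  funext i
  have h2 : f 2 =2 := map_ofNat f 2
  fin_cases i <;> simp [br, h2]

lemma qf_map (f : R →+* S) (e e' : Fin 3 → R) : f (qf e e') = qf (f ∘ e) (f ∘ e') := by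
  have h2 : f 2 =2 := map_ofNat f 2
  simp [qf, h2]

lemma qf_smul (c c' : R) (e e' : Fin 3 → R) : qf (c • e) (c' • e') = c * c' * qf e e' := by
  simp [qf]; ring

/-- covariance predicates -/
def CovM (σ : R →+* R) (g : M2 R) (d : ℕ) (l : R)
    (Z : MM d d R) : Prop := Z.map σ * rep d g = l • (rep d g * Z)
def CovV (σ : R →+* R) (g : M2 R) (l : R) (e : Fin 3 → R) : Prop :=
  σ ∘ e = l • (rep 2 g *ᵥ e)
def CovS (σ : R →+* R) (g : M2 R) (l : R)
    (T : M3 R) : Prop := T.map σ = l • (rep 2 g * T * (rep 2 g)ᵀ)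

variable {σ : R →+* R} {g : M2 R} {d : ℕ} {l l' : R}

lemma CovM.mul {Z Z'} (h : CovM σ g d l Z) (h' : CovM σ g d l' Z') : CovM σ g d (l * l') (Z * Z') := by
  unfold CovM at *
  rw [Matrix.map_mul, Matrix.mul_assoc, h', Matrix.mul_smul, ← Matrix.mul_assoc, h, Matrix.smul_mul,
    smul_smul, Matrix.mul_assoc, mul_comm l]

lemma CovM.pi2 (hg : g.det =1) {Z} (h : CovM σ g d l Z) : CovV σ g l (pi2 d Z) := by
  unfold CovV
  rw [pi2_map, pi2_conj d hg (Z := l • Z) (by rw [Matrix.mul_smul, ← h]), pi2_smul, mulVec_smul]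

lemma CovV.mq (hg : g.det =1) {e} (h : CovV σ g l e) : CovM σ g d l (mq d e) := by
  unfold CovM
  rw [mq_map, h, mq_smul, Matrix.smul_mul, rep_mq d hg]

lemma CovV.br (hg : g.det =1) {e e'} (h : CovV σ g l e) (h' : CovV σ g l' e') :
    CovV σ g (l * l') (br e e') := by
  unfold CovV at *
  rw [br_map, h, h', br_smul, br_rep hg]

lemma CovV.qf (hg : g.det =1) {e e'} (h : CovV σ g l e) (h' : CovV σ g l' e') :
    σ (qf e e') = l * l' * qf e e' := by
  unfold CovV at *
  rw [qf_map, h, h', qf_smul, qf_rep g hg]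

lemma CovS.smul {T} (h : CovS σ g l T) {c} (hc : σ c = l' * c) : CovS σ g (l' * l) (c • T) := by
  unfold CovS at *
  have : (c • T).map σ = σ c • (T.map σ) := by ext i j; simp
  rw [this, h, hc, Matrix.mul_smul, Matrix.smul_mul, smul_smul, smul_smul]; congr 1; ring

lemma CovS.add {T T'} (h : CovS σ g l T) (h' : CovS σ g l T') : CovS σ g l (T + T') := by
  unfold CovS at *
  rw [Matrix.map_add _ (map_add σ), h, h', Matrix.mul_add, Matrix.add_mul, smul_add]

lemma Gb_map (f : R →+* S) : (Gb : Matrix _ _ R).map f = Gb := by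
  have h2 : f 2 =2 := map_ofNat f 2
  ext i j; fin_cases i <;> fin_cases j <;> simp [Gb, h2]
lemma Ga_map (f : R →+* S) : (Ga : Matrix _ _ R).map f = Ga := by
  have h2 : f 2 =2 := map_ofNat f 2
  ext i j; fin_cases i <;> fin_cases j <;> simp [Ga, h2]

lemma CovS.Ga (hg : g.det =1) : CovS σ g 1 Ga := by
  unfold CovS
  rw [rep_Ga hg, Ga_map, one_smul]

lemma CovS.mul (hg : g.det =1) {T T'} (h : CovS σ g l T) (h' : CovS σ g l' T') :
    CovS σ g (l * l') (T * Gb * T') := by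
  unfold CovS at *
  rw [Matrix.map_mul, Matrix.map_mul, Gb_map, h, h']
  simp only [Matrix.smul_mul, Matrix.mul_smul, smul_smul, mul_comm l']
  congr 1
  conv_rhs => rw [← rep_Gb hg]
  simp only [Matrix.mul_assoc]

lemma CovS.tr (hg : g.det =1) {T} (h : CovS σ g l T) : σ (trace (T * Gb)) = l * trace (T * Gb) := by
  unfold CovS at *
  rw [trace_map', Matrix.map_mul, Gb_map, h, Matrix.smul_mul, trace_smul, smul_eq_mul]
  congr 1
  rw [Matrix.mul_assoc, Matrix.mul_assoc, trace_mul_comm, Matrix.mul_assoc, Matrix.mul_assoc, ← Matrix.mul_assoc _ Gb, rep_Gb hg]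

lemma CovS.det (hg : g.det =1) {T} (h : CovS σ g l T) : σ (Matrix.det T) = l ^3 * Matrix.det T := by
  unfold CovS at *
  have : σ (Matrix.det T) = Matrix.det (T.map σ) := by rw [RingHom.map_det]; rfl
  rw [this, h, det_smul, det_mul, det_mul, det_transpose, rep2_det hg]; simp

def qOp (d : ℕ) (T : M3 R) : MM d d R :=
  T 0 0 • (Xk d 0 * Xk d 0) + T 0 1 • (Xk d 0 * Xk d 1) + T 0 2 • (Xk d 0 * Xk d 2) +
  (T 1 0 • (Xk d 1 * Xk d 0) + T 1 1 • (Xk d 1 * Xk d 1) + T 1 2 • (Xk d 1 * Xk d 2)) +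
  (T 2 0 • (Xk d 2 * Xk d 0) + T 2 1 • (Xk d 2 * Xk d 1) + T 2 2 • (Xk d 2 * Xk d 2))

lemma qOp_map (f : R →+* S) (T : M3 R) :
    (qOp d T).map f = qOp d (T.map f) := by
  have : ∀ A B : Matrix (Fin (d+1)) (Fin (d+1)) R, ∀ c : R, (c • (A * B)).map f = f c • (A.map f * B.map f) := by
    intro A B c
    rw [← Matrix.map_mul]; ext i j; simp [-Matrix.map_mul]
  simp only [qOp, Fin.sum_univ_three, Matrix.map_add _ (map_add f), this, Xk_map, map_apply]

lemma mq_single_sum (d : ℕ) (M : M3 R) (k : Fin 3) :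
    mq d (M *ᵥ Pi.single k 1) = M 0 k • Xk d 0 + M 1 k • Xk d 1 + M 2 k • Xk d 2 := by
  rw [mq_eq, Fin.sum_univ_three]; simp

lemma rep_qOp (hg : g.det =1) (T : M3 R) :
    rep d g * qOp d T = qOp d (rep 2 g * T * (rep 2 g)ᵀ) * rep d g := by
  have h1 : ∀ k, rep d g * Xk d k = (rep 2 g 0 k • Xk d 0 + rep 2 g 1 k • Xk d 1 + rep 2 g 2 k • Xk d 2) * rep d g := by
    intro k
    rw [← mq_single_sum, ← rep_mq d hg]; rfl
  have h2 : ∀ k l, rep d g * (Xk d k * Xk d l) =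
      ((rep 2 g 0 k • Xk d 0 + rep 2 g 1 k • Xk d 1 + rep 2 g 2 k • Xk d 2) * (rep 2 g 0 l • Xk d 0 + rep 2 g 1 l • Xk d 1 + rep 2 g 2 l • Xk d 2)) * rep d g := by
    intro k l
    rw [← Matrix.mul_assoc, h1, Matrix.mul_assoc, h1, Matrix.mul_assoc]
  unfold qOp
  simp only [Matrix.mul_add, Matrix.mul_smul, h2]
  simp only [← Matrix.smul_mul, ← Matrix.add_mul]
  congr 1
  have h3 : ∀ i j, (rep 2 g * T * (rep 2 g)ᵀ) i j = ∑ l : Fin 3, (∑ k : Fin 3, rep 2 g i k * T k l) * rep 2 g j l := by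
    intro i j; simp only [mul_apply, transpose_apply]
  simp only [h3, Fin.sum_univ_three, Matrix.mul_add, Matrix.add_mul, Matrix.smul_mul, Matrix.mul_smul]
  module

lemma CovS.qOp (hg : g.det =1) {T} (h : CovS σ g l T) : CovM σ g d l (qOp d T) := by
  unfold CovM
  have hs : ∀ (c : R) (T : M3 R), QB.qOp d (c • T) = c • QB.qOp d T := by
    intro c T; simp [QB.qOp, smul_smul]
  rw [qOp_map, h, hs, Matrix.smul_mul, rep_qOp hg]

def S1 (d : ℕ) (P : MM d d R) : M3 R :=
  Ga * (Matrix.of fun k l => trace (Xk d k * Xk d l * P)) * Ga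

lemma S1_map (f : R →+* S) (P : MM d d R) :
    (S1 d P).map f = S1 d (P.map f) := by
  unfold S1
  rw [Matrix.map_mul, Matrix.map_mul, Ga_map]
  congr 2
  ext k l
  simp only [map_apply, of_apply]
  rw [trace_map', Matrix.map_mul, Matrix.map_mul, Xk_map, Xk_map]

lemma S1_conj (hg : g.det =1)
    {Z Z' : MM d d R} (h : rep d g * Z = Z' * rep d g) :
    S1 d Z' = rep 2 g * S1 d Z * (rep 2 g)ᵀ := by
  have h1 : ∀ k, rep d g * Xk d k = (rep 2 g 0 k • Xk d 0 + rep 2 g 1 k • Xk d 1 + rep 2 g 2 k • Xk d 2) * rep d g := by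
    intro k
    rw [← mq_single_sum, ← rep_mq d hg]; rfl
  have hT : (Matrix.of fun k l => trace (Xk d k * Xk d l * Z)) =
      (rep 2 g)ᵀ * (Matrix.of fun k l => trace (Xk d k * Xk d l * Z')) * rep 2 g := by
    ext k l
    have := trace_conj d hg (Z := Xk d k * Xk d l * Z)
      (Z' := (rep 2 g 0 k • Xk d 0 + rep 2 g 1 k • Xk d 1 + rep 2 g 2 k • Xk d 2) * (rep 2 g 0 l • Xk d 0 + rep 2 g 1 l • Xk d 1 + rep 2 g 2 l • Xk d 2) * Z') (by
        rw [← Matrix.mul_assoc, ← Matrix.mul_assoc, h1, Matrix.mul_assoc _ (rep d g), h1, Matrix.mul_assoc, Matrix.mul_assoc, h]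
        simp only [Matrix.mul_assoc])
    rw [of_apply, ← this]
    have h3 : ∀ N : M3 R, ((rep 2 g)ᵀ * N * rep 2 g) k l = ∑ j : Fin 3, (∑ i : Fin 3, rep 2 g i k * N i j) * rep 2 g j l := by
      intro N; simp only [mul_apply, transpose_apply]
    simp only [h3, Fin.sum_univ_three, transpose_apply, of_apply, Matrix.add_mul, Matrix.mul_add,
      Matrix.smul_mul, Matrix.mul_smul, trace_add, trace_smul, smul_eq_mul]
    ring
  unfold S1
  rw [hT]
  conv_lhs => rw [← rep_Ga hg]
  have e2 : rep 2 g * Ga * (rep 2 g)ᵀ = rep 2 g * (Ga * (rep 2 g)ᵀ) := Matrix.mul_assoc _ _ _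
  simp only [Matrix.mul_assoc]

lemma S1_smul (c : R) (P : MM d d R) : S1 d (c • P) = c • S1 d P := by
  unfold S1
  rw [← Matrix.smul_mul, ← Matrix.mul_smul]
  congr 2
  ext k l; simp

lemma CovM.S1 (hg : g.det =1) {Z} (h : CovM σ g d l Z) : CovS σ g l (S1 d Z) := by
  unfold CovS
  rw [S1_map, S1_conj hg (Z := l • Z) (by rw [Matrix.mul_smul, ← h]), S1_smul, Matrix.mul_smul, Matrix.smul_mul]

end cov

lemma Om_tr (d : ℕ) {R : Type*} [CommRing R] [Algebra ℂ R] : (Om d : Matrix _ _ R)ᵀ = ((-1) ^ d : R) • Om d := by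
  ext i j
  simp only [transpose_apply, Om, of_apply, Matrix.smul_apply, smul_eq_mul, mul_ite, mul_zero, add_comm (j : ℕ)]
  split_ifs with h
  · have e : wv d j = (-1) ^ d * wv d i := by
      unfold wv
      have hc := Nat.choose_symm_of_eq_add h.symm
      have : ((-1 : ℂ)) ^ d * (-1) ^ (i : ℕ) = (-1) ^ (j : ℕ) := by
        conv_lhs => arg 1; rw [← h]
        rw [pow_add, mul_right_comm, ← mul_pow]; simp
      rw [hc, ← mul_div_assoc, this]
    rw [e]; simp
  · rfl

lemma Om_skew {d : ℕ} (hd : Odd d) (f : FS d → ℂ) : f ⬝ᵥ (Om d *ᵥ f) =0 := by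
  have h : f ⬝ᵥ (Om d *ᵥ f) = f ⬝ᵥ ((Om d)ᵀ *ᵥ f) := by
    rw [dotProduct_mulVec, ← mulVec_transpose, dotProduct_comm]
  rw [Om_tr, hd.neg_one_pow, smul_mulVec, dotProduct_smul] at h
  simp only [smul_eq_mul] at h
  have := mul_eq_zero.1 (show (2 : ℂ) * (f ⬝ᵥ (Om d *ᵥ f)) =0 by linear_combination h)
  simpa using this

def FrameThm (b : ℕ) : Prop :=
  ∃ (Θ : ∀ (R : Type) [CommRing R] [Algebra ℂ R], MM b b R → R) (n : ℕ),
  (∀ (R : Type) [CommRing R] [Algebra ℂ R] (S : Type) [CommRing S] [Algebra ℂ S] (f : R →ₐ[ℂ] S) P,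
    f (Θ R P) = Θ S (P.map f)) ∧
  (∀ (R : Type) [CommRing R] [Algebra ℂ R] (c : R) P, Θ R (c • P) = c ^ n * Θ R P) ∧
  (∃ f0 : FS b → ℂ, (f0 ⟨b - (b -1) /2, by omega⟩ ≠0 ∧ f0 ⬝ᵥ (Om b *ᵥ f0) =0) ∧ Θ ℂ (vecMulVec f0 f0 * Om b) ≠0) ∧
  (∀ (K : Type) [Field K] [Algebra ℂ K] (Γ : Type) (σ : Γ → AE K) (g : Γ → M2 K)
    (_ : ∀ γ, (g γ).det =1) (L : IF K) (P : MM b b K)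
    (_ : ∀ i j, P i j ∈ L) (l : Γ → K), (∀ γ, CovM (σ γ : K →+* K) (g γ) b (l γ) P) → Θ K P ≠0 →
    ∃ E : M3 K, E.det ≠0 ∧ (∀ i j, E i j ∈ L) ∧ ∀ γ, E.map (σ γ) = rep 2 (g γ) * E)

section
variable {K : Type*} [Field K] [Algebra ℂ K] {Γ : Type*}

lemma CovV.norm {σ : K →+* K} {g : M2 K} {l c : K} {e : Fin 3 → K}
    (h : CovV σ g l e) (hc : σ c = l * c) (hc0 : c ≠0) : σ ∘ (c⁻¹ • e) = rep 2 g *ᵥ (c⁻¹ • e) := by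
  have hl : l ≠0 := by
    rintro rfl
    rw [zero_mul] at hc
    exact hc0 (by simpa using hc)
  have : σ ∘ (c⁻¹ • e) = (σ c)⁻¹ • (σ ∘ e) := by funext i; simp
  unfold CovV at h
  rw [this, h, hc, mulVec_smul, smul_smul]; congr 1; field_simp

lemma frame_of (σ : Γ → K →+* K) (g : Γ → M2 K) (L : IF K)
    (v : Fin 3 → Fin 3 → K) (c : Fin 3 → K) (l : Γ → Fin 3 → K) (hc : ∀ j, c j ≠0)
    (hcL : ∀ j, c j ∈ L) (hvL : ∀ j i, v j i ∈ L) (hdet : (Matrix.of v).det ≠0)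
    (hv : ∀ γ j, CovV (σ γ) (g γ) (l γ j) (v j)) (hσc : ∀ γ j, σ γ (c j) = l γ j * c j) :
    ∃ E : M3 K, E.det ≠0 ∧ (∀ i j, E i j ∈ L) ∧
      ∀ γ, E.map (σ γ) = rep 2 (g γ) * E := by
  refine ⟨Matrix.of fun i j => ((c j)⁻¹ • v j) i, ?_, ?_, ?_⟩
  · have : (Matrix.of fun i j => ((c j)⁻¹ • v j) i) = (diagonal (fun j => (c j)⁻¹) * Matrix.of v)ᵀ := by
      ext i j; simp
    rw [this, det_transpose, det_mul, det_diagonal]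
    exact mul_ne_zero (Finset.prod_ne_zero_iff.2 fun j _ => inv_ne_zero (hc j)) hdet
  · intro i j
    exact L.mul_mem (L.inv_mem (hcL j)) (hvL j i)
  · intro γ
    ext i j
    have := congrFun (CovV.norm (hv γ j) (hσc γ j) (hc j)) i
    simpa [mul_apply, mulVec, dotProduct] using this

lemma lift_mat {n m : Type*} (L : IF K) (P : Matrix n m K) (h : ∀ i j, P i j ∈ L) :
    ∃ P0 : Matrix n m L, P = P0.map (algebraMap L K) :=
  ⟨Matrix.of fun i j => ⟨P i j, h i j⟩, by ext i j; rfl⟩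
end

/-! test vectors -/
section test
variable (d : ℕ)

def om (v w : FS d → ℂ) : ℂ := v ⬝ᵥ (Om d *ᵥ w)

variable {d}
lemma trace_om (A : MM d d ℂ) (f : FS d → ℂ) :
    trace (A * (vecMulVec f f * Om d)) = om d f (A *ᵥ f) := by
  rw [← Matrix.mul_assoc, mul_vecMulVec, vecMulVec_mul, trace_vecMulVec, om, dotProduct_comm, ← dotProduct_mulVec]

lemma omA (u v w) : om d (u + v) w = om d u w + om d v w := by simp [om, add_dotProduct]
lemma omB (u v w) : om d w (u + v) = om d w u + om d w v := by simp [om, mulVec_add]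
lemma omL (c : ℂ) (v w) : om d (c • v) w = c * om d v w := by simp [om]
lemma omR (c : ℂ) (v w) : om d v (c • w) = c * om d v w := by simp [om, mulVec_smul]

variable (d) in
def ub (j : ℕ) : FS d → ℂ := fun i => if (i : ℕ) = j then 1 else 0

lemma ub_eq (j : FS d) : ub d j = Pi.single j 1 := by
  funext i; simp [ub, Pi.single_apply, Fin.ext_iff]

lemma om_u {i j : ℕ} (hi : i ≤ d) (hj : j ≤ d) :
    om d (ub d i) (ub d j) = if i + j = d then wv d i else 0 := by
  obtain ⟨i, rfl⟩ : ∃ i' : FS d, (i' : ℕ) = i := ⟨⟨i, by omega⟩, rfl⟩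
  obtain ⟨j, rfl⟩ : ∃ i' : FS d, (i' : ℕ) = j := ⟨⟨j, by omega⟩, rfl⟩
  rw [ub_eq, ub_eq, om]
  simp [Om]

lemma omE {i j : ℕ} (h : i + j = d) : om d (ub d i) (ub d j) = wv d i := by
  rw [om_u (by omega) (by omega), if_pos h]

lemma omN {i j : ℕ} (h : i + j ≠ d) : om d (ub d i) (ub d j) =0 := by
  by_cases hi : i ≤ d
  · by_cases hj : j ≤ d
    · rw [om_u hi hj, if_neg h]
    · have : ub d j =0 := by funext k; simp [ub]; omega
      simp [this, om]
  · have : ub d i =0 := by funext k; simp [ub]; omega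
    simp [this, om]

lemma Xk_u (k : Fin 3) (j : FS d) : Xk d k *ᵥ ub d j = fun i => mq d (Pi.single k 1) i j := by
  rw [ub_eq]; simp [Xk]; rfl

lemma Xou {j : ℕ} (hj : j ≤ d) : Xk d 0 *ᵥ ub d j = (-2 * (j : ℂ)) • ub d (j -1) := by
  obtain ⟨j, rfl⟩ : ∃ i' : FS d, (i' : ℕ) = j := ⟨⟨j, by omega⟩, rfl⟩
  rw [Xk_u]
  funext i
  simp only [mq_apply, ub, Pi.smul_apply, smul_eq_mul]
  rcases Nat.eq_zero_or_pos (j : ℕ) with h | h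
  · simp [h]
  · simp; by_cases hh : (i : ℕ) +1 = j
    · rw [if_pos hh, if_pos (by omega)]; ring
    · rw [if_neg hh, if_neg (by omega)]

lemma X1_u' {j : ℕ} (hj : j ≤ d) : Xk d 1 *ᵥ ub d j = ((d : ℂ) -2 * j) • ub d j := by
  obtain ⟨j, rfl⟩ : ∃ i' : FS d, (i' : ℕ) = j := ⟨⟨j, by omega⟩, rfl⟩
  rw [Xk_u]
  funext i
  simp only [mq_apply, ub, Pi.smul_apply, smul_eq_mul]
  simp [Nat.cast_sub hj]
  split_ifs <;> ring

lemma X2_u' {j : ℕ} (hj : j ≤ d) : Xk d 2 *ᵥ ub d j = (2 * ((d : ℂ) - j)) • ub d (j +1) := by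
  obtain ⟨j, rfl⟩ : ∃ i' : FS d, (i' : ℕ) = j := ⟨⟨j, by omega⟩, rfl⟩
  rw [Xk_u]
  funext i
  simp only [mq_apply, ub, Pi.smul_apply, smul_eq_mul]
  simp [Nat.cast_sub hj]
  split_ifs <;> ring

lemma ub_big {j : ℕ} (hj : d < j) : ub d j =0 := by funext k; simp [ub]; omega

lemma Xau {j : ℕ} : Xk d 1 *ᵥ ub d j = ((d : ℂ) -2 * j) • ub d j := by
  by_cases hj : j ≤ d
  · exact X1_u' hj
  · rw [ub_big (by omega)]; simp

lemma Xbu {j : ℕ} : Xk d 2 *ᵥ ub d j = (2 * ((d : ℂ) - j)) • ub d (j +1) := by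
  by_cases hj : j ≤ d
  · exact X2_u' hj
  · rw [ub_big (by omega), ub_big (j := j +1) (by omega)]; simp

lemma wv_succ {j : ℕ} (hj : j < d) : ((d : ℂ) - j) * wv d (j +1) = -((j : ℂ) +1) * wv d j := by
  have h := Nat.choose_succ_right_eq d j
  have h1 : (d.choose j : ℂ) ≠0 := by exact_mod_cast (Nat.choose_pos hj.le).ne'
  have h2 : (d.choose (j+1) : ℂ) ≠0 := by exact_mod_cast (Nat.choose_pos hj).ne'
  have h3 : (d.choose (j+1) : ℂ) * (j +1) = d.choose j * ((d : ℂ) - j) := by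
    rw [← Nat.cast_sub hj.le]; exact_mod_cast h
  unfold wv
  field_simp
  rw [pow_succ]
  linear_combination ((-1)^j) * h3

lemma wv_ne {j : ℕ} (hj : j ≤ d) : wv d j ≠0 := by
  have h1 : (d.choose j : ℂ) ≠0 := by exact_mod_cast (Nat.choose_pos hj).ne'
  unfold wv
  exact div_ne_zero (pow_ne_zero _ (by norm_num)) h1
end test

/-! odd case -/
section odd
variable {R : Type*} [CommRing R] {S : Type*} [CommRing S] (d : ℕ)

def eO (k : ℕ) (P : MM d d R) : Fin 3 → R := pi2 d (mq d (pi2 d P) ^ k * P)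

lemma eO_map (k : ℕ) (P : MM d d R) (f : R →+* S) :
    f ∘ eO d k P = eO d k (P.map f) := by
  unfold eO
  have : (mq d (pi2 d P) ^ k).map f = (mq d (pi2 d (P.map f))) ^ k := by
    rw [← pi2_map, ← mq_map]
    exact map_pow (RingHom.mapMatrix f) _ _
  rw [pi2_map, Matrix.map_mul, this]

lemma eO_smul (k : ℕ) (c : R) (P : MM d d R) :
    eO d k (c • P) = c ^ (k +1) • eO d k P := by
  unfold eO
  rw [pi2_smul, mq_smul, smul_pow, Matrix.smul_mul, Matrix.mul_smul, pi2_smul, pi2_smul, smul_smul, pow_succ]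

def thO (P : MM d d R) : R :=
  qf (eO d 0 P) (eO d 0 P) * (Matrix.of ![eO d 0 P, eO d 2 P, eO d 4 P]).det

variable {d}
lemma CovM.pow {σ : R →+* R} {g : M2 R} {l : R} {Z} (h : CovM σ g d l Z) (k : ℕ) :
    CovM σ g d (l ^ k) (Z ^ k) := by
  induction k with
  | zero => simp [CovM]
  | succ k ih => rw [pow_succ, pow_succ]; exact ih.mul h

lemma CovM.eO {σ : R →+* R} {g : M2 R} (hg : g.det =1) {l : R} {Z}
    (h : CovM σ g d l Z) (k : ℕ) : CovV σ g (l ^ (k +1)) (eO d k Z) := by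
  rw [pow_succ]
  exact (((h.pi2 hg).mq hg).pow k |>.mul h).pi2 hg

lemma eO_test (f : FS d → ℂ) (T : ℂ) (h0 : om d f (Xk d 0 *ᵥ f) =0) (h2 : om d f (Xk d 2 *ᵥ f) =0)
    (h1 : om d f (Xk d 1 *ᵥ f) = T) (k : ℕ) :
    eO d k (vecMulVec f f * Om d) = (-2 * T) ^ k •
      ![om d f (Xk d 2 *ᵥ (Xk d 1 ^ k *ᵥ f)), -2 * om d f (Xk d 1 *ᵥ (Xk d 1 ^ k *ᵥ f)),
        om d f (Xk d 0 *ᵥ (Xk d 1 ^ k *ᵥ f))] := by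
  have e1 : pi2 d (vecMulVec f f * Om d) = (-2 * T) • Pi.single 1 1 := by
    funext i
    fin_cases i <;> simp [pi2, trace_om, h0, h1, h2]
  unfold eO
  rw [e1, mq_smul]
  change pi2 d (((-2 * T) • Xk d 1) ^ k * _) = _
  rw [smul_pow, Matrix.smul_mul, pi2_smul]
  congr 1
  simp only [pi2, ← Matrix.mul_assoc (Xk d _) (Xk d 1 ^ k), trace_om, mulVec_mulVec]
end odd

lemma thO_frame {d : ℕ} {K : Type*} [Field K] [Algebra ℂ K] {Γ : Type*} (σ : Γ → AE K) (g : Γ → M2 K)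
    (hg : ∀ γ, (g γ).det =1) (L : IF K) (P : MM d d K)
    (hP : ∀ i j, P i j ∈ L) (l : Γ → K) (hl : ∀ γ, CovM (σ γ : K →+* K) (g γ) d (l γ) P) (hΘ : thO d P ≠0) :
    ∃ E : M3 K, E.det ≠0 ∧ (∀ i j, E i j ∈ L) ∧ ∀ γ, E.map (σ γ) = rep 2 (g γ) * E := by
  unfold thO at hΘ
  have hk : qf (eO d 0 P) (eO d 0 P) ≠0 := left_ne_zero_of_mul hΘ
  have hd := right_ne_zero_of_mul hΘ
  have hm : ∀ k i, eO d k P i ∈ L := by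
    obtain ⟨P0, rfl⟩ := lift_mat L P hP
    intro k i
    rw [← eO_map]
    exact (eO d k P0 i).2
  have hbr : ∀ e e' : Fin 3 → K, (∀ i, e i ∈ L) → (∀ i, e' i ∈ L) → ∀ i, br e e' i ∈ L := by
    intro e e' h h'
    have h2 : (2 : K) ∈ L := ofNat_mem L 2
    have hs : ∀ a b c d, e a * e' b - e c * e' d ∈ L := fun a b c d =>
      L.sub_mem (L.mul_mem (h _) (h' _)) (L.mul_mem (h _) (h' _))
    intro i
    fin_cases i
    · exact hs _ _ _ _
    · exact L.mul_mem h2 (hs _ _ _ _)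
    · exact hs _ _ _ _
  have hkL : qf (eO d 0 P) (eO d 0 P) ∈ L := by
    have h2 : (2 : K) ∈ L := ofNat_mem L 2
    unfold qf
    exact L.sub_mem (L.mul_mem (hm _ _) (hm _ _)) (L.mul_mem h2 (L.add_mem (L.mul_mem (hm _ _) (hm _ _)) (L.mul_mem (hm _ _) (hm _ _))))
  have hc := fun γ k => (hl γ).eO (hg γ) k
  have hck := fun γ => (hc γ 0).qf (hg γ) (hc γ 0)
  refine frame_of (fun γ => (σ γ : K →+* K)) g L ![br (eO d 0 P) (eO d 2 P), br (eO d 0 P) (eO d 4 P), br (eO d 2 P) (eO d 4 P)]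
    ![qf (eO d 0 P) (eO d 0 P) ^2, qf (eO d 0 P) (eO d 0 P) ^3, qf (eO d 0 P) (eO d 0 P) ^4]
    (fun γ => ![l γ ^ (0 +1) * l γ ^ (2 +1), l γ ^ (0 +1) * l γ ^ (4 +1), l γ ^ (2 +1) * l γ ^ (4 +1)]) ?_ ?_ ?_ ?_ ?_ ?_
  · intro j; fin_cases j <;> simp [hk]
  · intro j; fin_cases j <;> exact pow_mem hkL _
  · intro j; fin_cases j <;> exact hbr _ _ (hm _) (hm _)
  · generalize eO d 0 P = e at *
    generalize eO d 2 P = e' at *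
    generalize eO d 4 P = e'' at *
    have h : (Matrix.of ![br e e', br e e'', br e' e'']).det = -2 * (Matrix.of ![e, e', e'']).det ^2 := by
      rw [det_fin_three, det_fin_three]
      simp [br]
      ring
    have : CharZero K := charZero_of_injective_algebraMap (aM K).injective
    rw [h]; simp [hd]
  · intro γ j
    fin_cases j
    · exact (hc γ 0).br (hg γ) (hc γ 2)
    · exact (hc γ 0).br (hg γ) (hc γ 4)
    · exact (hc γ 2).br (hg γ) (hc γ 4)
  · intro γ j
    have := hck γ
    fin_cases j <;> simp [map_pow] <;> simp at this <;> rw [this] <;> ring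

lemma frame_odd (M : ℕ) : FrameThm (2 * M +5) := by
  refine ⟨fun R _ _ P => thO (2 * M +5) P,11, ?_, ?_, ?_, ?_⟩
  · intro R _ _ S _ _ f P
    have h := fun k => eO_map (2*M+5) k P (f : R →+* S)
    have h' := qf_map (f : R →+* S) (eO (2*M+5) 0 P) (eO (2*M+5) 0 P)
    have h3 : f (Matrix.of ![eO (2*M+5) 0 P, eO (2*M+5) 2 P, eO (2*M+5) 4 P]).det = 
       (Matrix.of ![f ∘ eO (2*M+5) 0 P, f ∘ eO (2*M+5) 2 P, f ∘ eO (2*M+5) 4 P]).det := by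
      rw [det_fin_three, det_fin_three]; simp
    simp only [RingHom.coe_coe] at h h'
    simp only [thO, map_mul, h', h3, h]
  · intro R _ _ c P
    simp only [thO, eO_smul, qf_smul]
    rw [det_fin_three, det_fin_three]
    simp
    ring
  · have hM : (M : ℂ) +1 ≠0 := by exact_mod_cast Nat.succ_ne_zero M
    have hM2 : (M : ℂ) +2 ≠0 := by exact_mod_cast Nat.succ_ne_zero (M+1)
    have hM4 : (M : ℂ) +4 ≠0 := by exact_mod_cast Nat.succ_ne_zero (M+3)
    have hM5 : (M : ℂ) +5 ≠0 := by exact_mod_cast Nat.succ_ne_zero (M+4)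
    have hM3 : (M : ℂ) +3 ≠0 := by exact_mod_cast Nat.succ_ne_zero (M+2)
    set f : Fin (2 * M +5 +1) → ℂ := (((M : ℂ) +3) / (2 * (M +4))) • ub _ (M +1) + ub _ (M +2) + ub _ (M +3)
      + (-((M : ℂ) +2) / (M +5)) • ub _ (M +5) with hf
    set W := wv (2 * M +5) (M +2) with hW
    have hW0 : W ≠0 := wv_ne (by omega)
    have w1 : wv (2 * M +5) (M +1) = -((M +4) / (M +2)) * W := by
      have := wv_succ (d :=2 * M +5) (j := M +1) (by omega)
      push_cast at this
      field_simp
      linear_combination this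
    have w3 : wv (2 * M +5) (M +3) = - W := by
      have := wv_succ (d :=2 * M +5) (j := M +2) (by omega)
      push_cast at this
      apply mul_left_cancel₀ hM3
      linear_combination this
    have w4 : wv (2 * M +5) (M +4) = (M +4) / (M +2) * W := by
      have := wv_succ (d :=2 * M +5) (j := M +3) (by omega)
      push_cast at this
      rw [w3] at this
      field_simp
      linear_combination this
    have w5 : wv (2 * M +5) (M +5) = - ((M +4) * (M +5) / ((M +2) * (M +1))) * W := by
      have := wv_succ (d :=2 * M +5) (j := M +4) (by omega)
      push_cast at this
      rw [w4] at this
      field_simp at this ⊢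
      linear_combination this
    have hX1 : ∀ k : ℕ, Xk (2*M+5) 1 ^ k *ᵥ f = (3 ^ k * (((M : ℂ) +3) / (2 * (M +4)))) • ub _ (M +1)
        + ub _ (M +2) + ((-1) ^ k : ℂ) • ub _ (M +3)
      + ((-5) ^ k * (-((M : ℂ) +2) / (M +5))) • ub _ (M +5) := by
      intro k
      induction k with
      | zero => simp [hf]
      | succ k ih =>
        rw [pow_succ', ← mulVec_mulVec, ih]
        simp (disch := (clear * -; omega)) only [mulVec_add, mulVec_smul, Xau, smul_smul]
        have e1 : ((2 * M +5 : ℕ) : ℂ) -2 * ((M +1 : ℕ) : ℂ) =3 := by push_cast; ring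
        have e2 : ((2 * M +5 : ℕ) : ℂ) -2 * ((M +2 : ℕ) : ℂ) =1 := by push_cast; ring
        have e3 : ((2 * M +5 : ℕ) : ℂ) -2 * ((M +3 : ℕ) : ℂ) = -1 := by push_cast; ring
        have e5 : ((2 * M +5 : ℕ) : ℂ) -2 * ((M +5 : ℕ) : ℂ) = -5 := by push_cast; ring
        rw [e1, e2, e3, e5]
        module
    have h2 : ∀ k : ℕ, om _ f (Xk (2*M+5) 2 *ᵥ (Xk (2*M+5) 1 ^ k *ᵥ f)) = -((M+3) * W) * (-2 * (1 : ℂ) +3 ^ k + (-1) ^ k) := by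
      intro k
      rw [hX1, hf]
      simp (disch := (clear * -; omega)) only [omA, omB, omL, omR, mulVec_add, mulVec_smul, Xbu, omE, omN, w1, w3, w4, w5]
      push_cast
      field_simp
      ring
    have h0 : ∀ k : ℕ, om _ f (Xk (2*M+5) 0 *ᵥ (Xk (2*M+5) 1 ^ k *ᵥ f)) = -((M+3) * W) * (-2 * (-1) ^ k +3 ^ k + (-5) ^ k) := by
      intro k
      rw [hX1, hf]
      simp (disch := (clear * -; omega)) only [omA, omB, omL, omR, mulVec_add, mulVec_smul, Xou, omE, omN, w1, w3, w4, w5]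
      push_cast
      field_simp
      ring
    have h1 : ∀ k : ℕ, om _ f (Xk (2*M+5) 1 *ᵥ (Xk (2*M+5) 1 ^ k *ᵥ f)) = - W * (1 + (-1)^k) := by
      intro k
      rw [hX1, hf]
      simp (disch := (clear * -; omega)) only [omA, omB, omL, omR, mulVec_add, mulVec_smul, Xau, omE, omN, w1, w3, w4, w5]
      push_cast
      field_simp
      ring
    have h3 := eO_test f (-2 * W) (by have := h0 0; norm_num at this; simpa using this) (by have := h2 0; norm_num at this; simpa using this)
      (by have := h1 0; norm_num at this; linear_combination this)
    refine ⟨f, ⟨?_, Om_skew (by use M +2; ring) f⟩, ?_⟩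
    · have e : 2 * M +5 - (2 * M +5 -1) /2 = M +3 := by omega
      simp only [hf, ub, e, Pi.add_apply, Pi.smul_apply]
      simp
    · simp only [thO, h3, h2, h1, h0, qf_smul]
      rw [det_fin_three]
      simp [qf]
      ring_nf
      simp [hW0, hM3]
      have : (W : ℂ) ^9 * ((M : ℂ) +3) ^2 ≠0 := mul_ne_zero (pow_ne_zero _ hW0) (pow_ne_zero _ hM3)
      intro h
      apply this
      linear_combination (-1/50331648:ℂ) * h
  · intro K _ _ Γ σ g hg L P hP l hl hΘ
    exact thO_frame σ g hg L P hP l hl hΘ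

section even
variable {R : Type*} [CommRing R] {S : Type*} [CommRing S] (d : ℕ)

def ta2 (P : MM d d R) : R := trace (S1 d P * Gb * S1 d P * Gb)
def ta3 (P : MM d d R) : R := (S1 d P).det
def YE (P : MM d d R) : MM d d R :=
  qOp d ((12 * ta2 d P ^2) • (S1 d P * Gb * S1 d P) + (288 * (ta2 d P * ta3 d P)) • S1 d P + (ta2 d P ^3) • Ga)
def w1E (P : MM d d R) : Fin 3 → R := pi2 d (YE d P * YE d P * P)
def w2E (P : MM d d R) : Fin 3 → R := pi2 d (YE d P * YE d P * P * YE d P)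
def thE (P : MM d d R) : R :=
  ta2 d P * ta3 d P * (Matrix.of ![w1E d P, w2E d P, br (w1E d P) (w2E d P)]).det

variable {d}
lemma ta2_map (f : R →+* S) (P) : f (ta2 d P) = ta2 d (P.map f) := by
  unfold ta2
  rw [trace_map', Matrix.map_mul, Matrix.map_mul, Matrix.map_mul, Gb_map, S1_map]
lemma ta3_map (f : R →+* S) (P) : f (ta3 d P) = ta3 d (P.map f) := by
  unfold ta3
  rw [RingHom.map_det, ← S1_map]; rfl
lemma smul_map' {n m : Type*} (f : R →+* S) (c : R) (Z : Matrix n m R) : (c • Z).map f = f c • Z.map f := by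
  ext i j; simp
lemma YE_map (f : R →+* S) (P) : (YE d P).map f = YE d (P.map f) := by
  unfold YE
  rw [qOp_map, Matrix.map_add _ (map_add f), Matrix.map_add _ (map_add f)]
  simp only [smul_map', Matrix.map_mul, Gb_map, Ga_map, S1_map, map_mul, map_pow, ta2_map, ta3_map, map_ofNat]
lemma w1E_map (f : R →+* S) (P) : f ∘ w1E d P = w1E d (P.map f) := by
  unfold w1E
  rw [pi2_map, Matrix.map_mul, Matrix.map_mul, YE_map]
lemma w2E_map (f : R →+* S) (P) : f ∘ w2E d P = w2E d (P.map f) := by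
  unfold w2E
  rw [pi2_map, Matrix.map_mul, Matrix.map_mul, Matrix.map_mul, YE_map]

lemma ta2_smul (c : R) (P : MM d d R) : ta2 d (c • P) = c ^2 * ta2 d P := by
  simp only [ta2, S1_smul, Matrix.smul_mul, Matrix.mul_smul, trace_smul, smul_eq_mul]; ring
lemma ta3_smul (c : R) (P : MM d d R) : ta3 d (c • P) = c ^3 * ta3 d P := by
  simp only [ta3, S1_smul, det_smul]; simp
lemma qOp_smul (c : R) (T : M3 R) : qOp d (c • T) = c • qOp d T := by
  simp [qOp, smul_smul]
lemma YE_smul (c : R) (P : MM d d R) : YE d (c • P) = c ^6 • YE d P := by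
  unfold YE
  rw [← qOp_smul]
  congr 1
  simp only [S1_smul, ta2_smul, ta3_smul, Matrix.smul_mul, Matrix.mul_smul]
  module
lemma w1E_smul (c : R) (P : MM d d R) : w1E d (c • P) = c ^13 • w1E d P := by
  unfold w1E
  rw [YE_smul, ← pi2_smul]
  simp only [Matrix.smul_mul, Matrix.mul_smul, smul_smul]; congr 2; ring
lemma w2E_smul (c : R) (P : MM d d R) : w2E d (c • P) = c ^19 • w2E d P := by
  unfold w2E
  rw [YE_smul, ← pi2_smul]
  simp only [Matrix.smul_mul, Matrix.mul_smul, smul_smul]; congr 2; ring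

variable {σ : R →+* R} {g : M2 R} {l : R}

lemma CovM.ta2 (hg : g.det =1) {P} (h : CovM σ g d l P) : σ (ta2 d P) = l ^2 * ta2 d P := by
  have := ((h.S1 hg).mul hg (h.S1 hg)).tr hg
  rw [← pow_two] at this; exact this
lemma CovM.ta3 (hg : g.det =1) {P} (h : CovM σ g d l P) : σ (ta3 d P) = l ^3 * ta3 d P :=
  (h.S1 hg).det hg
lemma CovS.of_eq {T} {l l' : R} (h : CovS σ g l T) (e : l = l') : CovS σ g l' T := e ▸ h
lemma CovM.YE (hg : g.det =1) {P} (h : CovM σ g d l P) : CovM σ g d (l ^6) (YE d P) := by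
  have h2 := h.ta2 hg
  have h3 := h.ta3 hg
  apply CovS.qOp hg
  refine CovS.add (CovS.add ?_ ?_) ?_
  · exact (((h.S1 hg).mul hg (h.S1 hg)).smul (l' := l ^4) (by simp [map_ofNat, h2]; ring)).of_eq (by ring)
  · exact ((h.S1 hg).smul (l' := l ^5) (by simp [map_ofNat, h2, h3]; ring)).of_eq (by ring)
  · exact ((CovS.Ga hg).smul (l' := l ^6) (by simp [h2]; ring)).of_eq (by ring)

lemma CovM.w1E (hg : g.det =1) {P} (h : CovM σ g d l P) : CovV σ g (l ^6 * l ^6 * l) (w1E d P) :=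
  (((h.YE hg).mul (h.YE hg)).mul h).pi2 hg
lemma CovM.w2E (hg : g.det =1) {P} (h : CovM σ g d l P) : CovV σ g (l ^6 * l ^6 * l * l ^6) (w2E d P) :=
  ((((h.YE hg).mul (h.YE hg)).mul h).mul (h.YE hg)).pi2 hg

end even

lemma thE_frame {d : ℕ} {K : Type*} [Field K] [Algebra ℂ K] {Γ : Type*} (σ : Γ → AE K) (g : Γ → M2 K)
    (hg : ∀ γ, (g γ).det =1) (L : IF K) (P : MM d d K)
    (hP : ∀ i j, P i j ∈ L) (l : Γ → K) (hl : ∀ γ, CovM (σ γ : K →+* K) (g γ) d (l γ) P) (hΘ : thE d P ≠0) :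
    ∃ E : M3 K, E.det ≠0 ∧ (∀ i j, E i j ∈ L) ∧ ∀ γ, E.map (σ γ) = rep 2 (g γ) * E := by
  unfold thE at hΘ
  have hd := right_ne_zero_of_mul hΘ
  have ht2 := left_ne_zero_of_mul (left_ne_zero_of_mul hΘ)
  have ht3 := right_ne_zero_of_mul (left_ne_zero_of_mul hΘ)
  have hm : (∀ i, w1E d P i ∈ L) ∧ (∀ i, w2E d P i ∈ L) ∧ (∀ i, br (w1E d P) (w2E d P) i ∈ L) ∧ ta2 d P ∈ L ∧ ta3 d P ∈ L := by
    obtain ⟨P0, rfl⟩ := lift_mat L P hP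
    refine ⟨fun i => ?_, fun i => ?_, fun i => ?_, ?_, ?_⟩
    · rw [← w1E_map]; exact (w1E d P0 i).2
    · rw [← w2E_map]; exact (w2E d P0 i).2
    · rw [← w1E_map, ← w2E_map, ← br_map]; exact (br (w1E d P0) (w2E d P0) i).2
    · rw [← ta2_map]; exact (ta2 d P0).2
    · rw [← ta3_map]; exact (ta3 d P0).2
  obtain ⟨m1, m2, m3, m4, m5⟩ := hm
  set s := ta3 d P / ta2 d P with hs
  have hs0 : s ≠0 := div_ne_zero ht3 ht2
  have hsL : s ∈ L := L.div_mem m5 m4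
  have hl0 : ∀ γ, l γ ≠0 := by
    intro γ h
    have := (hl γ).ta2 (hg γ)
    rw [h] at this
    simp at this
    exact ht2 this
  have hsσ : ∀ γ, (σ γ) s = l γ * s := by
    intro γ
    have e2 := (hl γ).ta2 (hg γ)
    have e3 := (hl γ).ta3 (hg γ)
    simp only [RingHom.coe_coe] at e2 e3
    have := hl0 γ
    rw [hs, map_div₀, e2, e3]
    field_simp
  refine frame_of (fun γ => (σ γ : K →+* K)) g L ![w1E d P, w2E d P, br (w1E d P) (w2E d P)]
    ![s ^13, s ^19, s ^32]
    (fun γ => ![l γ ^6 * l γ ^6 * l γ, l γ ^6 * l γ ^6 * l γ * l γ ^6,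
      (l γ ^6 * l γ ^6 * l γ) * (l γ ^6 * l γ ^6 * l γ * l γ ^6)]) ?_ ?_ ?_ hd ?_ ?_
  · intro j; fin_cases j <;> simp [hs0]
  · intro j; fin_cases j <;> exact pow_mem hsL _
  · intro j; fin_cases j
    exacts [m1, m2, m3]
  · intro γ j
    fin_cases j
    · exact (hl γ).w1E (hg γ)
    · exact (hl γ).w2E (hg γ)
    · exact ((hl γ).w1E (hg γ)).br (hg γ) ((hl γ).w2E (hg γ))
  · intro γ j
    fin_cases j <;> simp [map_pow, hsσ] <;> ring

lemma thE_det (x y p r p' r' : ℂ) : (Matrix.of ![x • ![p,0, r], y • ![p',0, r'],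
      br (x • ![p,0, r]) (y • ![p',0, r'])]).det = (x * y) ^2 * (2 * (r * p' - p * r') ^2) := by
  rw [det_fin_three]
  simp [br]
  ring

lemma thE_test {d : ℕ} (f : FS d → ℂ) (B C p r p' r' : ℂ)
    (t00 : om d f (Xk d 0 *ᵥ (Xk d 0 *ᵥ f)) =0) (t01 : om d f (Xk d 0 *ᵥ (Xk d 1 *ᵥ f)) =0)
    (t02 : om d f (Xk d 0 *ᵥ (Xk d 2 *ᵥ f)) = C) (t10 : om d f (Xk d 1 *ᵥ (Xk d 0 *ᵥ f)) =0)
    (t11 : om d f (Xk d 1 *ᵥ (Xk d 1 *ᵥ f)) = C) (t12 : om d f (Xk d 1 *ᵥ (Xk d 2 *ᵥ f)) =0)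
    (t20 : om d f (Xk d 2 *ᵥ (Xk d 0 *ᵥ f)) = C) (t21 : om d f (Xk d 2 *ᵥ (Xk d 1 *ᵥ f)) =0)
    (t22 : om d f (Xk d 2 *ᵥ (Xk d 2 *ᵥ f)) = B) (h : FS d → ℂ)
    (hh : Xk d 1 *ᵥ (Xk d 1 *ᵥ (Xk d 1 *ᵥ (Xk d 1 *ᵥ f))) = h)
    (q2 : om d f (Xk d 2 *ᵥ h) = p) (q1 : om d f (Xk d 1 *ᵥ h) =0) (q0 : om d f (Xk d 0 *ᵥ h) = r)
    (q2' : om d f (Xk d 1 *ᵥ (Xk d 1 *ᵥ (Xk d 2 *ᵥ h))) = p') (q1' : om d f (Xk d 1 *ᵥ (Xk d 1 *ᵥ (Xk d 1 *ᵥ h))) =0)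
    (q0' : om d f (Xk d 1 *ᵥ (Xk d 1 *ᵥ (Xk d 0 *ᵥ h))) = r') (hC : C ≠0) (hpr : r * p' - p * r' ≠0) :
    thE d (vecMulVec f f * Om d) ≠0 := by
  have hS : S1 d (vecMulVec f f * Om d) = !![B,0, C; 0,4 * C,0; C,0,0] := by
    unfold S1
    have : (Matrix.of fun k l => trace (Xk d k * Xk d l * (vecMulVec f f * Om d))) = !![0,0, C; 0, C,0; C,0, B] := by
      ext k l
      simp only [of_apply, trace_om, ← mulVec_mulVec]
      fin_cases k <;> fin_cases l <;> simp [-mulVec_mulVec, t00, t01, t02, t10, t11, t12, t20, t21, t22]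
    rw [this]
    ext k l
    fin_cases k <;> fin_cases l <;> simp [Ga, mul_apply, Fin.sum_univ_three] <;> ring
  have hSG : S1 d (vecMulVec f f * Om d) * Gb * S1 d (vecMulVec f f * Om d) = !![4 * B * C,0,2 * C ^2; 0, -16 * C ^2,0; 2 * C ^2,0,0] := by
    rw [hS]
    ext k l
    fin_cases k <;> fin_cases l <;> simp [Gb, mul_apply, Fin.sum_univ_three] <;> ring
  have h2 : ta2 d (vecMulVec f f * Om d) =24 * C ^2 := by
    unfold ta2
    rw [hSG]
    simp [trace, Fin.sum_univ_three, Gb, mul_apply]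
    ring
  have h3 : ta3 d (vecMulVec f f * Om d) = -4 * C ^3 := by
    unfold ta3
    rw [hS, det_fin_three]
    simp
    ring
  have hY : YE d (vecMulVec f f * Om d) = (-248832 * C ^6) • (Xk d 1 * Xk d 1) := by
    unfold YE
    rw [hSG, h2, h3, hS]
    have : ((12 * (24 * C ^2) ^2) • !![4 * B * C,0,2 * C ^2; 0, -16 * C ^2,0; 2 * C ^2,0,0] +
      (288 * (24 * C ^2 * (-4 * C ^3))) • !![B,0, C; 0,4 * C,0; C,0,0] + (24 * C ^2) ^3 • Ga) =
       !![0,0,0; 0, -248832 * C ^6,0; 0,0,0] := by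
      ext k l
      fin_cases k <;> fin_cases l <;> simp [Ga] <;> ring
    rw [this]
    simp [qOp]
  obtain ⟨c, hc, hc0⟩ : ∃ c : ℂ, -248832 * C ^6 = c ∧ c ≠0 := ⟨_, rfl, by simp [hC]⟩
  rw [hc] at hY
  have hw1 : w1E d (vecMulVec f f * Om d) = (c * c) • ![p,0, r] := by
    unfold w1E
    rw [hY]
    simp only [Matrix.smul_mul, Matrix.mul_smul, smul_smul, pi2_smul]
    refine congrArg (fun v => (c * c) • v) ?_
    simp only [pi2, ← Matrix.mul_assoc (Xk d _) (Xk d 1 * Xk d 1 * (Xk d 1 * Xk d 1)), trace_om, ← mulVec_mulVec, hh, q0, q1, q2]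
    simp
  have hw2 : w2E d (vecMulVec f f * Om d) = (c * (c * c)) • ![p',0, r'] := by
    unfold w2E
    rw [hY]
    simp only [Matrix.smul_mul, Matrix.mul_smul, smul_smul, pi2_smul]
    have e : ∀ k, trace (Xk d k * (Xk d 1 * Xk d 1 * (Xk d 1 * Xk d 1) * (vecMulVec f f * Om d) * (Xk d 1 * Xk d 1))) = 
       om d f (Xk d 1 *ᵥ (Xk d 1 *ᵥ (Xk d k *ᵥ h))) := by
      intro k
      rw [← Matrix.mul_assoc, trace_mul_comm, ← Matrix.mul_assoc, ← Matrix.mul_assoc, trace_om]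
      simp only [← mulVec_mulVec, hh]
    refine congrArg (fun v => (c * (c * c)) • v) ?_
    simp only [pi2, e, q0', q1', q2']
    simp
  unfold thE
  rw [h2, h3, hw1, hw2, thE_det]
  refine mul_ne_zero (mul_ne_zero ?_ ?_) ?_
  · simp [hC]
  · simp [hC]
  · simp [hc0, hpr]

lemma frame_even_of (n : ℕ) (hn : 3 ≤ n) (h : ∃ f0 : Fin (2 * n +1) → ℂ, (f0 ⟨n +1, by omega⟩ ≠0 ∧ f0 ⬝ᵥ (Om _ *ᵥ f0) =0) ∧
    thE (2 * n) (vecMulVec f0 f0 * Om (2 * n)) ≠0) : FrameThm (2 * n) := by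
  refine ⟨fun R _ _ P => thE (2 * n) P,69, ?_, ?_, ?_, ?_⟩
  · intro R _ _ S _ _ f P
    have h1 := w1E_map (f : R →+* S) P
    have h2 := w2E_map (f : R →+* S) P
    have h4 := ta2_map (f : R →+* S) P
    have h5 := ta3_map (f : R →+* S) P
    have h6 := br_map (f : R →+* S) (w1E (2 * n) P) (w2E (2 * n) P)
    have h3 : f (Matrix.of ![w1E (2*n) P, w2E (2*n) P, br (w1E (2*n) P) (w2E (2*n) P)]).det = 
       (Matrix.of ![f ∘ w1E (2*n) P, f ∘ w2E (2*n) P, f ∘ br (w1E (2*n) P) (w2E (2*n) P)]).det := by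
      rw [det_fin_three, det_fin_three]; simp
    simp only [RingHom.coe_coe] at h1 h2 h4 h5 h6
    simp only [thE, map_mul, h3, h1, h2, h4, h5, h6]
  · intro R _ _ c P
    simp only [thE, ta2_smul, ta3_smul, w1E_smul, w2E_smul, br_smul]
    rw [det_fin_three, det_fin_three]
    simp
    ring
  · obtain ⟨f0, ⟨h0, h2⟩, h1⟩ := h
    refine ⟨f0, ⟨?_, h2⟩, h1⟩
    have e : 2 * n - (2 * n -1) /2 = n +1 := by omega
    convert h0
  · intro K _ _ Γ σ g hg L P hP l hl hΘ
    exact thE_frame σ g hg L P hP l hl hΘ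

lemma even_core {d : ℕ} (n W : ℂ) (n0 : n ≠0) (n1 : n -1 ≠0) (n2 : n -2 ≠0) (p1 : n +1 ≠0) (p2 : n +2 ≠0) (p3 : n +3 ≠0) (hW0 : W ≠0)
    (em4 em3 em2 em1 e0 e1 e2 e3 e4 e5 e6 f : FS d → ℂ)
    (x0em3 : Xk d 0 *ᵥ em3 = (-2 : ℂ) • em4)
    (x1em3 : Xk d 1 *ᵥ em3 = (6 : ℂ) • em3)
    (x2em3 : Xk d 2 *ᵥ em3 = (2 * (n +3)) • em2)
    (x0em2 : Xk d 0 *ᵥ em2 = (-2 * (n -2)) • em3)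
    (x1em2 : Xk d 1 *ᵥ em2 = (4 : ℂ) • em2)
    (x2em2 : Xk d 2 *ᵥ em2 = (2 * (n +2)) • em1)
    (x0em1 : Xk d 0 *ᵥ em1 = (-2 * (n -1)) • em2)
    (x1em1 : Xk d 1 *ᵥ em1 = (2 : ℂ) • em1)
    (x2em1 : Xk d 2 *ᵥ em1 = (2 * (n +1)) • e0)
    (x0e0 : Xk d 0 *ᵥ e0 = (-2 * (n +0)) • em1)
    (x1e0 : Xk d 1 *ᵥ e0 = (0 : ℂ) • e0)
    (x2e0 : Xk d 2 *ᵥ e0 = (2 * (n -0)) • e1)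
    (x0e1 : Xk d 0 *ᵥ e1 = (-2 * (n +1)) • e0)
    (x1e1 : Xk d 1 *ᵥ e1 = (-2 : ℂ) • e1)
    (x2e1 : Xk d 2 *ᵥ e1 = (2 * (n -1)) • e2)
    (x0e2 : Xk d 0 *ᵥ e2 = (-2 * (n +2)) • e1)
    (x1e2 : Xk d 1 *ᵥ e2 = (-4 : ℂ) • e2)
    (x2e2 : Xk d 2 *ᵥ e2 = (2 * (n -2)) • e3)
    (x0e3 : Xk d 0 *ᵥ e3 = (-2 * (n +3)) • e2)
    (x1e3 : Xk d 1 *ᵥ e3 = (-6 : ℂ) • e3)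
    (x2e3 : Xk d 2 *ᵥ e3 = (2 : ℂ) • e4)
    (x0e4 : Xk d 0 *ᵥ e4 = (-2 * (n +4) * (n -3)) • e3)
    (x1e4 : Xk d 1 *ᵥ e4 = (-8 : ℂ) • e4)
    (x2e4 : Xk d 2 *ᵥ e4 = (2 : ℂ) • e5)
    (x0e5 : Xk d 0 *ᵥ e5 = (-2 * (n +5) * (n -4)) • e4)
    (x1e5 : Xk d 1 *ᵥ e5 = (-10 : ℂ) • e5)
    (x2e5 : Xk d 2 *ᵥ e5 = (2 * (n -5)) • e6)
    (fem4 : om d f em4 = -3 * (n +1) ^2 * (n +2) * (n +4) * (n -3) / (5 * n ^3 * (n -2)) * W)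
    (fem3 : om d f em3 =6 * (n +1) ^2 * (n +2) / (5 * n ^2 * (n -2)) * W)
    (fem2 : om d f em2 =0)
    (fem1 : om d f em1 = -((n +1) / n) * W)
    (fe0 : om d f e0 = W)
    (fe1 : om d f e1 = -(1 /2) * W)
    (fe2 : om d f e2 = n / (6 * (n -1)) * W)
    (fe3 : om d f e3 =0)
    (fe4 : om d f e4 =0)
    (fe5 : om d f e5 =0)
    (fe6 : om d f e6 =0)
    (hf : f = e0 + e1 + (n / (2 * (n +1))) • em1 + (n ^2 / (6 * (n +1) * (n +2))) • em2
    + (-6 * (n +1) * (n -1) / (5 * (n +3) * n)) • e3 + (-3 * (n +1) * (n -1) / (5 * n ^2 * (n +3))) • e4) :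
    om d f f =0 ∧ thE d (vecMulVec f f * Om d) ≠0 := by
  constructor
  · conv_lhs => arg 3; rw [hf]
    simp only [omB, omR, fem2, fem1, fe0, fe1, fe3, fe4]
    field_simp
    ring
  refine thE_test f (n ^2 * W /3) (-4 * W) (-64 * n * W) (384 * (n +1) * W)
    (-256 * n * W) (4608 * (n +1) * W) ?_ ?_ ?_ ?_ ?_ ?_ ?_ ?_ ?_ _ rfl ?_ ?_ ?_ ?_ ?_ ?_ ?_ ?_
  iterate 15
    · conv_lhs => arg 3; rw [hf]
      simp only [mulVec_add, mulVec_smul, smul_smul, x0em3, x1em3, x2em3, x0em2, x1em2, x2em2, x0em1, x1em1, x2em1, x0e0, x1e0, x2e0, x0e1, x1e1, x2e1, x0e2, x1e2, x2e2, x0e3, x1e3, x2e3, x0e4, x1e4, x2e4, x0e5, x1e5, x2e5, omB, omR, fem4, fem3, fem2, fem1, fe0, fe1, fe2, fe3, fe4, fe5, fe6]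
      field_simp
      ring
  · simp [hW0]
  · have : ((384 : ℂ) * (n +1) * W) * (-256 * n * W) - (-64 * n * W) * (4608 * (n +1) * W) =196608 * ((n +1) * n * W ^2) := by ring
    rw [this]
    simp [hW0, n0, p1]

lemma frame_even3 (N : ℕ) : FrameThm (2 * (N +3)) := by
  apply frame_even_of _ (by omega)
  set d :=2 * (N +3) with hd
  have hd' : (d : ℂ) =2 * (N +3) := by rw [hd]; push_cast; ring
  have n1 : (N : ℂ) +1 ≠0 := by exact_mod_cast Nat.succ_ne_zero N
  have n2 : (N : ℂ) +2 ≠0 := by exact_mod_cast Nat.succ_ne_zero (N+1)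
  have n3 : (N : ℂ) +3 ≠0 := by exact_mod_cast Nat.succ_ne_zero (N+2)
  have n4 : (N : ℂ) +4 ≠0 := by exact_mod_cast Nat.succ_ne_zero (N+3)
  have n5 : (N : ℂ) +5 ≠0 := by exact_mod_cast Nat.succ_ne_zero (N+4)
  have n6 : (N : ℂ) +6 ≠0 := by exact_mod_cast Nat.succ_ne_zero (N+5)
  have n7 : (N : ℂ) +7 ≠0 := by exact_mod_cast Nat.succ_ne_zero (N+6)
  obtain ⟨W, hW⟩ : ∃ W, wv d (N +3) = W := ⟨_, rfl⟩
  have hW0 : W ≠0 := by rw [← hW]; exact wv_ne (by omega)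
  have w2 : wv d (N +2) = -((N +4) / (N +3)) * W := by
    have := wv_succ (d := d) (j := N +2) (by omega)
    rw [hW, hd'] at this
    push_cast at this
    field_simp
    linear_combination this
  have w1 : wv d (N +1) = ((N +4) * (N +5) / ((N +3) * (N +2))) * W := by
    have := wv_succ (d := d) (j := N +1) (by omega)
    rw [w2, hd'] at this
    push_cast at this
    field_simp at this ⊢
    linear_combination this
  have w4 : wv d (N +4) = -((N +4) / (N +3)) * W := by
    have := wv_succ (d := d) (j := N +3) (by omega)
    rw [hW, hd'] at this
    push_cast at this
    field_simp
    linear_combination this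
  have w5 : wv d (N +5) = ((N +4) * (N +5) / ((N +3) * (N +2))) * W := by
    have := wv_succ (d := d) (j := N +4) (by omega)
    rw [w4, hd'] at this
    push_cast at this
    field_simp at this ⊢
    linear_combination this
  have w6 : wv d (N +6) = -((N +4) * (N +5) * (N +6) / ((N +3) * (N +2) * (N +1))) * W := by
    have := wv_succ (d := d) (j := N +5) (by omega)
    rw [w5, hd'] at this
    push_cast at this
    field_simp at this ⊢
    linear_combination this
  have w7 : (N : ℂ) * wv d (N +7) = N * (((N +4) * (N +5) * (N +6) * (N +7) / ((N +3) * (N +2) * (N +1) * N)) * W) := by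
    rcases Nat.eq_zero_or_pos N with h0 | h0
    · simp [h0]
    have n0 : (N : ℂ) ≠0 := by exact_mod_cast h0.ne'
    have := wv_succ (d := d) (j := N +6) (by omega)
    rw [w6, hd'] at this
    push_cast at this
    field_simp at this ⊢
    linear_combination this
  have X0' : ∀ j : ℕ, j +1 ≤ d → Xk d 0 *ᵥ ub d (j +1) = (-2 * ((j +1 : ℕ) : ℂ)) • ub d j := fun j hj => Xou hj
  have r1 : (N : ℂ) +3 +1 = N +4 := by ring
  have r2 : (N : ℂ) +3 +2 = N +5 := by ring
  have r3 : (N : ℂ) +3 +3 = N +6 := by ring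
  have r4 : (N : ℂ) +3 -1 = N +2 := by ring
  have r5 : (N : ℂ) +3 -2 = N +1 := by ring
  refine ⟨_, and_assoc.2 ⟨?_, even_core (d := d) (N +3) W n3 (by rw [r4]; exact n2) (by rw [r5]; exact n1)
    (by rw [r1]; exact n4) (by rw [r2]; exact n5) (by rw [r3]; exact n6) hW0
    ((N : ℂ) • ub d (N -1)) (ub d N) (ub d (N +1)) (ub d (N +2)) (ub d (N +3)) (ub d (N +4)) (ub d (N +5)) (ub d (N +6))
    ((N : ℂ) • ub d (N +7)) (((N : ℂ) * (N -1)) • ub d (N +8)) (((N : ℂ) * (N -1)) • ub d (N +9)) _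
    ?_ ?_ ?_ ?_ ?_ ?_ ?_ ?_ ?_ ?_ ?_ ?_ ?_ ?_ ?_ ?_ ?_ ?_ ?_ ?_ ?_ ?_ ?_ ?_ ?_ ?_ ?_ ?_ ?_ ?_ ?_ ?_ ?_ ?_ ?_ ?_ ?_ ?_ rfl⟩⟩
  · simp [ub]
  · rw [Xou (by omega), smul_smul]
  · simp only [mulVec_smul, Xau, hd', smul_smul]; push_cast; module
  · simp only [mulVec_smul, Xbu, hd', smul_smul]; push_cast; module
  iterate 5
    · rw [X0' _ (by omega)]; push_cast; module
    · simp only [mulVec_smul, Xau, hd', smul_smul]; push_cast; module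
    · simp only [mulVec_smul, Xbu, hd', smul_smul]; push_cast; module
  · rw [X0' _ (by omega)]; push_cast; module
  · simp only [mulVec_smul, Xau, hd', smul_smul]; push_cast; module
  · rw [Xbu, hd', smul_smul]; push_cast; module
  · rcases Nat.eq_zero_or_pos N with h0 | h0
    · simp [h0]
    rw [mulVec_smul, X0' (N +6) (by omega)]; push_cast; module
  · simp only [mulVec_smul, Xau, hd', smul_smul]; push_cast; module
  · rw [mulVec_smul, Xbu, hd', smul_smul, smul_smul]; push_cast; module
  · rcases Nat.eq_zero_or_pos (N * (N -1)) with h0 | h0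
    · rcases Nat.eq_zero_or_pos N with h1 | h1
      · simp [h1]
      · have : N =1 := by rcases Nat.mul_eq_zero.1 h0 with h | h <;> omega
        simp [this]; norm_num
    have hN : 1 < N := by by_contra h; have : N =0 ∨ N =1 := by omega
                          rcases this with h | h <;> simp [h] at h0
    rw [mulVec_smul, X0' (N +7) (by omega)]; push_cast; module
  · simp only [mulVec_smul, Xau, hd', smul_smul]; push_cast; module
  · simp only [mulVec_smul, Xbu, hd', smul_smul]; push_cast; module
  · rcases Nat.eq_zero_or_pos N with h0 | h0
    · simp [h0, om]
    have n0 : (N : ℂ) ≠0 := by exact_mod_cast h0.ne'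
    simp (disch := omega) only [omA, omL, omR, omE, omN]; rw [mul_left_cancel₀ n0 w7]; simp only [r1, r2, r3, r4, r5]; field_simp; ring
  all_goals
    simp (disch := (clear * - hd; omega)) only [omA, omL, omR, omE, omN, hW, w1, w2, w4, w5, w6]
    try (simp only [r1, r2, r3, r4, r5]; field_simp)
    try ring

lemma frame_thm {b : ℕ} (hb : 4 < b) : FrameThm b := by
  rcases Nat.even_or_odd' b with ⟨n, rfl | rfl⟩
  · obtain ⟨N, rfl⟩ : ∃ N, n = N +3 := ⟨n -3, by omega⟩
    exact frame_even3 N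
  · obtain ⟨M, rfl⟩ : ∃ N, n = N +2 := ⟨n -2, by omega⟩
    exact frame_odd M

section
variable {K : Type} [Field K] [Algebra ℂ K]

lemma spec {ι : Type} (F : ∀ (R : Type) [CommRing R] [Algebra ℂ R], (ι → R) → R)
    (hF : ∀ (R : Type) [CommRing R] [Algebra ℂ R] (S : Type) [CommRing S] [Algebra ℂ S] (f : R →ₐ[ℂ] S) x,
      f (F R x) = F S (f ∘ x)) {x : ι → K} (hx : AI x) (c : ι → ℂ) (h : F ℂ c ≠0) : F K x ≠0 := by
  intro h0
  have h1 := hF _ _ (aeval x) (X : ι → MvPolynomial ι ℂ)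
  have h2 := hF _ _ (aeval c) (X : ι → MvPolynomial ι ℂ)
  have e1 : (aeval x : MvPolynomial ι ℂ →ₐ[ℂ] K) ∘ X = x := by funext i; simp
  have e2 : (aeval c : MvPolynomial ι ℂ →ₐ[ℂ] ℂ) ∘ X = c := by funext i; simp
  rw [e1, h0] at h1
  rw [e2] at h2
  have := hx (a₁ := F _ X) (a₂ :=0) (by rw [h1, map_zero])
  rw [this, map_zero] at h2
  exact h h2.symm

/-- entries in a subfield -/
abbrev EM {m n : Type*} (L : IF K) (A : Matrix m n K) : Prop := ∀ i j, A i j ∈ L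

lemma EM.mul {l m n : Type*} [Fintype m] {L : IF K} {A : Matrix l m K} {B : Matrix m n K}
    (hA : EM L A) (hB : EM L B) : EM L (A * B) := fun i j => sum_mem fun k _ => L.mul_mem (hA i k) (hB k j)

lemma EM.mulVec {l m : Type*} [Fintype m] {L : IF K} {A : Matrix l m K} {v : m → K}
    (hA : EM L A) (hB : ∀ i, v i ∈ L) (i) : (A *ᵥ v) i ∈ L := sum_mem fun k _ => L.mul_mem (hA i k) (hB k)

lemma EM.inv {m : Type*} [Fintype m] [DecidableEq m] {L : IF K} {A : Matrix m m K}
    (hA : EM L A) : EM L A⁻¹ := by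
  obtain ⟨A0, rfl⟩ := lift_mat L A hA
  by_cases h : IsUnit A0.det
  · have e : (A0.map (algebraMap L K))⁻¹ = A0⁻¹.map (algebraMap L K) := by
      apply Matrix.inv_eq_left_inv
      rw [← Matrix.map_mul, Matrix.nonsing_inv_mul _ h, Matrix.map_one _ (map_zero _) (map_one _)]
    rw [e]
    exact fun i j => (A0⁻¹ i j).2
  · have e : (A0.map (algebraMap L K))⁻¹ =0 := by
      apply Matrix.nonsing_inv_apply_not_isUnit
      have : (A0.map (algebraMap L K)).det = algebraMap L K A0.det := (RingHom.map_det (algebraMap L K) A0).symm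
      rw [isUnit_iff_ne_zero, not_not] at h
      simp [this, h]
    rw [e]
    exact fun i j => L.zero_mem

lemma EM.Om {d : ℕ} {L : IF K} : EM L (Om d : Matrix _ _ K) := by
  intro i j
  simp only [QB.Om, of_apply]
  split_ifs
  · exact L.algebraMap_mem _
  · exact L.zero_mem

lemma EM.det {m : Type*} [Fintype m] [DecidableEq m] {L : IF K} {A : Matrix m m K}
    (hA : EM L A) : A.det ∈ L := by
  obtain ⟨A0, rfl⟩ := lift_mat L A hA
  have : (A0.map (algebraMap L K)).det = algebraMap L K A0.det := (RingHom.map_det (algebraMap L K) A0).symm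
  rw [this]; exact (A0.det).2

lemma EM.one {m : Type*} [DecidableEq m] {L : IF K} : EM L (1 : Matrix m m K) := by
  intro i j
  rw [one_apply]; split_ifs
  exacts [L.one_mem, L.zero_mem]
end

/-- choose an invertible block of columns -/
lemma colsel {K : Type*} [Field K] {m : ℕ} {n : Type*} [Fintype n] [DecidableEq n] (A : Matrix (Fin m) n K) (X : Matrix n (Fin m) K)
    (h : (A * X).det ≠0) : ∃ c : Fin m → n, Function.Injective c ∧ (A.submatrix id c).det ≠0 := by
  by_contra! hc
  apply h
  rw [← det_transpose]
  have e : (A * X)ᵀ = fun j => ∑ k, X k j • Aᵀ k := by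
    ext j i
    simp [mul_apply, mul_comm]
  have := (detRowAlternating (R := K) (n := Fin m)).toMultilinearMap.map_sum (fun j k => X k j • Aᵀ k)
  rw [e]
  refine this.trans (Finset.sum_eq_zero fun c _ => ?_)
  rw [MultilinearMap.map_smul_univ]
  have h2 : (A.submatrix id c).det =0 := by
    by_cases hi : Function.Injective c
    · exact hc c hi
    · simp only [Function.Injective, not_forall] at hi
      obtain ⟨i, j, hij, hne⟩ := hi
      exact det_zero_of_column_eq hne (by intro k; simp [hij])
  rw [← det_transpose] at h2
  have h3 : (detRowAlternating (R := K) (n := Fin m)).toMultilinearMap (fun i => Aᵀ (c i)) =0 := h2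
  rw [h3, smul_zero]

lemma om_swap {d : ℕ} (v w : FS d → ℂ) : om d v w = (-1) ^ d * om d w v := by
  unfold om
  rw [dotProduct_mulVec, ← mulVec_transpose, dotProduct_comm, Om_tr, smul_mulVec, dotProduct_smul, smul_eq_mul]

def Gm {R : Type*} [CommRing R] [Algebra ℂ R] {a b : ℕ} (M : MM a b R) : MM a a R :=
  M * (Om b : Matrix _ _ R) * Mᵀ

def sj (a b j : ℕ) : ℕ := if 2 * j +1 < a then j else if 2 * j +1 = a then b /2 else b +1 - a + j

lemma adj_block {a : ℕ} {R : Type*} [CommRing R] (G : MM a a R) (h1 : ∀ j, G 0 j =0)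
    (h2 : ∀ j, G j 0 =0) : G.adjugate = single 0 0 (G.submatrix Fin.succ Fin.succ).det := by
  ext i j
  rw [adjugate_fin_succ_eq_det_submatrix]
  rcases Fin.eq_zero_or_eq_succ j with rfl | ⟨j, rfl⟩
  · rcases Fin.eq_zero_or_eq_succ i with rfl | ⟨i, rfl⟩
    · simp [single]
    · rcases a with _ | a
      · exact i.elim0
      rw [det_eq_zero_of_column_eq_zero (0 : FS a), mul_zero]
      · simp [single, (Fin.succ_ne_zero i).symm]
      · intro k; simp [h2]
  · rcases a with _ | a
    · exact j.elim0
    rw [det_eq_zero_of_row_eq_zero (0 : FS a), mul_zero]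
    · simp [single, (Fin.succ_ne_zero j).symm]
    · intro k; simp [h1]

lemma gram_test {a b : ℕ} (ha : 1 < a) (hab : a < b) (hev : Even (a * b)) (f0 : FS b → ℂ)
    (h1 : f0 ⟨b - (b -1) /2, by omega⟩ ≠0) (h2 : om b f0 f0 =0) :
    ∃ (M0 : MM a b ℂ) (δ : ℂ), δ ≠0 ∧
      (Gm M0).adjugate = single 0 0 δ ∧ M0 0 = f0 := by
  have hodd : ∀ j,2 * j +1 = a → b % 2 =0 := by
    intro j hj
    rcases Nat.even_mul.1 hev with h | h
    · obtain ⟨k, hk⟩ := h; omega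
    · obtain ⟨k, hk⟩ := h; omega
  set k0 := (b -1) /2 with hk0
  have hs1 : ∀ j < a, sj a b j ≠ k0 ∧ sj a b j + k0 ≠ b ∧ sj a b j ≤ b := by
    intro j hj
    have := hodd j
    unfold sj
    split_ifs <;> omega
  have hs2 : ∀ i < a, ∀ j < a, (sj a b i + sj a b j = b ↔ i + j +1 = a) := by
    intro i hi j hj
    have h3 := hodd i
    have h4 := hodd j
    unfold sj
    split_ifs <;> omega
  have hfk : om b f0 (ub b k0) ≠0 := by
    have e : om b (ub b k0) f0 = wv b k0 * f0 ⟨b - k0, by omega⟩ := by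
      have : ub b k0 = Pi.single (⟨k0, by omega⟩ : FS b) 1 := ub_eq (d := b) ⟨k0, by omega⟩
      rw [om, this, single_dotProduct, one_mul, mulVec, dotProduct, Finset.sum_eq_single ⟨b - k0, by omega⟩]
      · simp only [Om, of_apply]; rw [if_pos (by omega)]; simp
      · intro j _ hj
        simp only [Om, of_apply]; rw [if_neg, zero_mul]
        intro h; apply hj; ext; simp only; omega
      · simp
    rw [om_swap, e]
    exact mul_ne_zero (pow_ne_zero _ (by norm_num)) (mul_ne_zero (wv_ne (by omega)) h1)
  let r : ℕ → FS b → ℂ := fun j => ub b (sj a b j) + (-(om b f0 (ub b (sj a b j)) / om b f0 (ub b k0))) • ub b k0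
  let M0 : MM a b ℂ := Matrix.of (Fin.cons f0 fun j : Fin a => r j)
  have hG : ∀ i j, (Gm M0) i j = om b (M0 i) (M0 j) := by
    intro i j
    rw [om, Gm, Matrix.mul_assoc, mul_apply]
    rfl
  have hr : ∀ j, om b f0 (r j) =0 := by
    intro j
    simp only [r, omB, omR]
    field_simp
    ring
  have hrr : ∀ i < a, ∀ j < a, om b (r i) (r j) = if i + j +1 = a then wv b (sj a b i) else 0 := by
    intro i hi j hj
    obtain ⟨a1, a2, a3⟩ := hs1 i hi
    obtain ⟨b1, b2, b3⟩ := hs1 j hj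
    simp only [r, omA, omB, omL, omR]
    rw [omN (i := sj a b i) (j := k0) a2, omN (i := k0) (j := sj a b j) (by omega), omN (i := k0) (j := k0) (by omega),
      om_u a3 b3]
    simp only [hs2 i hi j hj, mul_zero, add_zero]
  refine ⟨M0, _, ?_, adj_block _ ?_ ?_, rfl⟩
  · have e : (Gm M0).submatrix Fin.succ Fin.succ =
        diagonal (fun i : Fin a => wv b (sj a b i)) * (Fin.revPerm : Equiv.Perm (Fin a)).permMatrix ℂ := by
      ext i j
      rw [submatrix_apply, hG, diagonal_mul]
      change om b (r i) (r j) = _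
      rw [hrr i i.2 j j.2, Equiv.Perm.permMatrix, PEquiv.toMatrix_apply]
      have : (j ∈ (Equiv.toPEquiv (Fin.revPerm : Equiv.Perm (Fin a))) i) ↔ (i : ℕ) + j +1 = a := by
        simp [Equiv.toPEquiv_apply, Fin.ext_iff, Fin.val_rev]; omega
      simp only [this, mul_ite, mul_one, mul_zero]
    rw [e, det_mul, det_diagonal, det_permutation]
    refine mul_ne_zero (Finset.prod_ne_zero_iff.2 fun i _ => wv_ne (hs1 i i.2).2.2) ?_
    have := (Equiv.Perm.sign (Fin.revPerm : Equiv.Perm (Fin a))).ne_zero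
    exact_mod_cast this
  · intro j
    rw [hG]
    refine Fin.cases ?_ (fun j => ?_) j
    · exact h2
    · exact hr j
  · intro j
    rw [hG, om_swap]
    refine mul_eq_zero_of_right _ ?_
    refine Fin.cases ?_ (fun j => ?_) j
    · exact h2
    · exact hr j

section
variable {K : Type} [Field K] [Algebra ℂ K] 

abbrev ent {m n : Type*} (M : Matrix m n K) : m × n → K := fun p => M p.1 p.2

lemma specM {m n : Type} (F : ∀ (R : Type) [CommRing R] [Algebra ℂ R], Matrix m n R → R)
    (hF : ∀ (R : Type) [CommRing R] [Algebra ℂ R] (S : Type) [CommRing S] [Algebra ℂ S] (f : R →ₐ[ℂ] S) M,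
      f (F R M) = F S (M.map f)) {M : Matrix m n K} (hM : AI (ent M)) (c : Matrix m n ℂ)
    (h : F ℂ c ≠0) : F K M ≠0 :=
  spec (fun R _ _ x => F R (Matrix.of fun i j => x (i, j))) (fun R _ _ S _ _ f x => hF R S f _) hM (ent c) h

lemma det_map' {m : Type*} [Fintype m] [DecidableEq m] {R S : Type*} [CommRing R] [CommRing S] [Algebra ℂ R] [Algebra ℂ S]
    (f : R →ₐ[ℂ] S) (A : Matrix m m R) : f A.det = (A.map f).det := AlgHom.map_det f A

def PM {R : Type*} [CommRing R] [Algebra ℂ R] {a b : ℕ} (M : MM a b R) : MM b b R :=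
  Mᵀ * (Gm M).adjugate * M * Om b

lemma adj_map {m : Type*} [Fintype m] [DecidableEq m] {R S : Type*} [CommRing R] [CommRing S] [Algebra ℂ R] [Algebra ℂ S]
    (f : R →ₐ[ℂ] S) (A : Matrix m m R) : A.adjugate.map f = (A.map f).adjugate := AlgHom.map_adjugate f A

lemma mapmul {l m n : Type*} [Fintype m] {R S : Type*} [CommRing R] [CommRing S] [Algebra ℂ R] [Algebra ℂ S]
    (f : R →ₐ[ℂ] S) (A : Matrix l m R) (B : Matrix m n R) : (A * B).map f = A.map f * B.map f := Matrix.map_mul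

lemma Gm_map {R S : Type*} [CommRing R] [Algebra ℂ R] [CommRing S] [Algebra ℂ S] {a b : ℕ}
    (M : MM a b R) (f : R →ₐ[ℂ] S) : (Gm M).map f = Gm (M.map f) := by
  simp only [Gm, mapmul, Om_map, transpose_map]

lemma PM_map {R S : Type*} [CommRing R] [Algebra ℂ R] [CommRing S] [Algebra ℂ S] {a b : ℕ}
    (M : MM a b R) (f : R →ₐ[ℂ] S) : (PM M).map f = PM (M.map f) := by
  simp only [PM, mapmul, adj_map, Om_map, Gm_map, transpose_map]

lemma gen1 {a b : ℕ} (ha : 1 < a) (hab : a < b) (hev : Even (a * b)) 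
    (Θ : ∀ (R : Type) [CommRing R] [Algebra ℂ R], MM b b R → R) (n : ℕ)
    (h1 : ∀ (R : Type) [CommRing R] [Algebra ℂ R] (S : Type) [CommRing S] [Algebra ℂ S] (f : R →ₐ[ℂ] S) P,
    f (Θ R P) = Θ S (P.map f))
    (h2 : ∀ (R : Type) [CommRing R] [Algebra ℂ R] (c : R) P, Θ R (c • P) = c ^ n * Θ R P) 
    (h3 : ∃ f0 : FS b → ℂ, (f0 ⟨b - (b -1) /2, by omega⟩ ≠0 ∧ f0 ⬝ᵥ (Om b *ᵥ f0) =0) ∧ Θ ℂ (vecMulVec f0 f0 * Om b) ≠0) 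
    {M : MM a b K} (hM : AI (ent M)) :
    Θ K (PM M) ≠0 ∧ (Gm M).adjugate 0 0 ≠0 := by
  obtain ⟨f0, ⟨hf1, hf2⟩, hf3⟩ := h3
  obtain ⟨M0, δ, hδ, hadj, hM0⟩ := gram_test ha hab hev f0 hf1 hf2
  constructor
  · refine specM (fun R _ _ M => Θ R (PM M)) ?_ hM M0 ?_
    · intro R _ _ S _ _ f M; simp only [h1, PM_map]
    · have : PM M0 = δ • (vecMulVec f0 f0 * Om b) := by
        rw [PM, hadj, ← smul_mul]
        congr 1
        ext i j
        rw [mul_apply, Finset.sum_eq_single 0]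
        · rw [mul_apply, Finset.sum_eq_single 0]
          · simp [vecMulVec_apply, hM0]; ring
          · intro k _ hk; simp [single, hk.symm]
          · simp
        · intro k _ hk
          rw [mul_apply, Finset.sum_eq_zero, zero_mul]
          intro x _; simp [single, hk.symm]
        · simp
      simp only [this, h2]
      exact mul_ne_zero (pow_ne_zero _ hδ) hf3
  · refine specM (fun R _ _ M => (Gm M).adjugate 0 0) ?_ hM M0 ?_
    · intro R _ _ S _ _ f M
      have := congrFun (congrFun (adj_map f (Gm M)) 0) 0
      rw [Gm_map] at this
      exact this
    · simp only [hadj]; simpa [single] using hδ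
end

lemma ker_line {K : Type*} [Field K] {n : Type*} [Fintype n] [DecidableEq n] (G : Matrix n n K) {i j : n}
    (h : G.adjugate i j ≠0) {x y : n → K} (hx : G *ᵥ x =0) (hy : G *ᵥ y =0) (hy0 : y ≠0) : ∃ c : K, x = c • y := by
  have key : ∀ z : n → K, G *ᵥ z =0 → z i =0 → z =0 := by
    intro z hz hzi
    rw [adjugate_apply] at h
    by_contra hne
    apply h
    apply Matrix.exists_mulVec_eq_zero_iff.1 ⟨z, hne, ?_⟩
    funext k
    by_cases hk : k = j
    · subst hk; simp [mulVec, hzi]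
    · have := congrFun hz k
      simpa [mulVec, updateRow_ne hk] using this
  have hyi : y i ≠0 := fun h0 => hy0 (key y hy h0)
  refine ⟨x i / y i, ?_⟩
  have := key (x - (x i / y i) • y) (by rw [mulVec_sub, mulVec_smul, hx, hy]; simp) (by simp [hyi])
  exact sub_eq_zero.1 this

lemma Gm_JNB {R : Type*} [CommRing R] [Algebra ℂ R] {a b : ℕ} (N : MM a b R)
    (J : MM a a R) {B : MM b b R} (hB : Bᵀ * Om b * B = Om b) :
    Gm (J * N * Bᵀ) = J * Gm N * Jᵀ := by
  have : Gm (J * N * Bᵀ) = J * N * (Bᵀ * Om b * B) * (J * N)ᵀ := by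
    simp only [Gm, transpose_mul, transpose_transpose, Matrix.mul_assoc]
  rw [this, hB]
  simp only [Gm, transpose_mul, Matrix.mul_assoc]

lemma PM_JNB {R : Type*} [CommRing R] [Algebra ℂ R] {a b : ℕ} (N : MM a b R)
    (J : MM a a R) {B : MM b b R} (hB : Bᵀ * Om b * B = Om b) :
    PM (J * N * Bᵀ) * B = (J.det ^2) • (B * PM N) := by
  have e : PM (J * N * Bᵀ) * B = B * Nᵀ * (Jᵀ * (Jᵀ).adjugate) * (Gm N).adjugate * (J.adjugate * J) * N * (Bᵀ * Om b * B) := by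
    rw [PM, Gm_JNB N J hB, adjugate_mul_distrib, adjugate_mul_distrib]
    simp only [transpose_mul, transpose_transpose, Matrix.mul_assoc]
  rw [e, hB, mul_adjugate, adjugate_mul, det_transpose, PM]
  simp only [Matrix.mul_smul, Matrix.smul_mul, Matrix.mul_one, smul_smul, Matrix.mul_assoc, sq]

section
variable {K : Type} [Field K] [Algebra ℂ K] {a b : ℕ}

abbrev cl {a b : ℕ} (hab : a < b) : FS a → FS b := Fin.castLE (by omega)

lemma det_ne_map {m : Type*} [Fintype m] [DecidableEq m] (f : AE K) {A : Matrix m m K} (h : A.det ≠0) : (A.map f).det ≠0 := by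
  rw [← det_map']; simpa using h

lemma ndU {m : Type*} [Fintype m] [DecidableEq m] {A : Matrix m m K} (h : A.det ≠0) : IsUnit A.det := isUnit_iff_ne_zero.2 h

/-- step 1, the reduced matrix -/
lemma step1a (hab : a < b) (M : MM a b K)
    (hM : AI (ent M)) (σ : GG → AE K)
    (hσ : ∀ γ : GG, M.map (σ γ) = aM K γ.2.2 • (rep a (ic K γ.1) * M * (rep b (ic K γ.2.1))ᵀ)) :
    ∃ (M1 : MM a a K) (N : MM a b K) (J : GG → MM a a K),
    M1 = M.submatrix id (cl hab) ∧ M1.det ≠0 ∧ M = M1 * N ∧ N.submatrix id (cl hab) =1 ∧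
    (∀ γ, N.map (σ γ) = J γ * N * (rep b (ic K γ.2.1))ᵀ) ∧ (∀ γ, γ.2.1 =1 → J γ =1) := by
  set M1 := M.submatrix id (cl hab) with hM1
  have hd : M1.det ≠0 := by
    refine specM (fun R _ _ M => (M.submatrix id (cl hab)).det) ?_ hM (Matrix.of fun i j => if j = cl hab i then 1 else 0) ?_
    · intro R _ _ S _ _ f M; exact det_map' f _
    · have : (Matrix.of fun i j => if j = cl hab i then (1 : ℂ) else 0).submatrix id (cl hab) =1 := by
        ext i j; simp [one_apply, Fin.ext_iff, eq_comm]
      simp only [this]; simp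
  have hN1 : (M1⁻¹ * M).submatrix id (cl hab) =1 := by
    rw [submatrix_mul _ _ _ id _ Function.bijective_id, submatrix_id_id, ← hM1, nonsing_inv_mul _ (ndU hd)]
  have hMN : M = M1 * (M1⁻¹ * M) := by rw [← Matrix.mul_assoc, mul_nonsing_inv _ (ndU hd), Matrix.one_mul]
  generalize M1⁻¹ * M = N at hN1 hMN
  have hs : ∀ γ, N.map (σ γ) = ((M1.map (σ γ))⁻¹ * (aM K γ.2.2 • (rep a (ic K γ.1) * M1))) * N * (rep b (ic K γ.2.1))ᵀ := by
    intro γ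
    have h1 : M1.map (σ γ) * N.map (σ γ) = aM K γ.2.2 • (rep a (ic K γ.1) * M1) * N * (rep b (ic K γ.2.1))ᵀ := by
      rw [← mapmul, ← hMN, hσ γ]
      conv_lhs => rw [hMN]
      simp only [Matrix.smul_mul, Matrix.mul_assoc]
    have h2 := congrArg (fun Z => (M1.map (σ γ))⁻¹ * Z) h1
    simp only [← Matrix.mul_assoc] at h2
    rw [nonsing_inv_mul _ (ndU (det_ne_map _ hd)), Matrix.one_mul] at h2
    rw [h2]
  refine ⟨M1, N, _, rfl, hd, hMN, hN1, hs, ?_⟩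
  intro γ hγ
  have := hs γ
  generalize (M1.map (σ γ))⁻¹ * (aM K γ.2.2 • (rep a (ic K γ.1) * M1)) = J at this
  have e1 : ic K γ.2.1 =1 := by rw [hγ]; simp [ic]
  rw [e1, repO, transpose_one, Matrix.mul_one] at this
  have h3 := congrArg (fun Z => Z.submatrix id (cl hab)) this
  simp only [submatrix_mul J N id id (cl hab) Function.bijective_id, submatrix_id_id, hN1, Matrix.mul_one] at h3
  rw [← h3, submatrix_map, hN1]
  simp

lemma fix_adj {ι : Type*} (x : ι → K) (τ : AE K) (h : ∀ i, τ (x i) = x i) : ∀ y ∈ AR x, τ y = y := by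
  intro y hy
  have : AR x ≤ (AlgHom.equalizer τ (AlgHom.id ℂ K)).toIntermediateField (by
      intro z hz; rw [AlgHom.mem_equalizer] at *; simpa using hz) := by
    apply adL
    intro i
    rw [← SetLike.mem_coe]
    exact h i
  exact this hy

lemma EM.tr {m n : Type*} {L : IF K} {A : Matrix m n K} (hA : EM L A) : EM L Aᵀ := fun i j => hA j i

lemma EM.adj {m : Type*} [Fintype m] [DecidableEq m] {L : IF K} {A : Matrix m m K}
    (hA : EM L A) : EM L A.adjugate := by
  obtain ⟨A0, rfl⟩ := lift_mat L A hA
  have : (A0.map (algebraMap L K)).adjugate = A0.adjugate.map (algebraMap L K) := (RingHom.map_adjugate (algebraMap L K) A0).symm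
  rw [this]; exact fun i j => (A0.adjugate i j).2

lemma pw_mem {L : IF K} {r : ℕ} (d k : ℕ) {e : FS r → K} (h : ∀ i, e i ∈ L) (i) : pw d k e i ∈ L := by
  have := pw_map d k (fun i => (⟨e i, h i⟩ : L)) (algebraMap L K)
  have e2 : (algebraMap L K) ∘ (fun i => (⟨e i, h i⟩ : L)) = e := rfl
  rw [e2] at this
  rw [← this]
  exact (pw d k (fun i => (⟨e i, h i⟩ : L)) i).2

lemma step1 (ha : 1 < a) (hab : a < b) (hb : 4 < b) (hev : Even (a * b)) (M : MM a b K)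
    (hM : AI (ent M)) (σ : GG → AE K)
    (hσ : ∀ γ : GG, M.map (σ γ) = aM K γ.2.2 • (rep a (ic K γ.1) * M * (rep b (ic K γ.2.1))ᵀ)) :
    ∃ (L : IF K) (M1 : MM a a K) (N : MM a b K)
      (Q1 : MM b a K) (χ : GG → K),
      L = adj (Set.range (ent N)) ∧ M = M1 * N ∧ M1.det ≠0 ∧ N.submatrix id (cl hab) =1 ∧ EM L Q1 ∧ (M * (Om b : Matrix _ _ K) * Q1).det ≠0 ∧
      (∀ γ, Q1.map (σ γ) = χ γ • (rep b (ic K γ.2.1) * Q1)) ∧ (∀ γ, γ.2.1 =1 → χ γ =1) ∧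
      (Even b → ∀ γ, χ γ =1) := by
  obtain ⟨Θ, n, hΘ1, hΘ2, hΘ3, hΘ4⟩ := frame_thm hb
  obtain ⟨gΘ, gadj⟩ := gen1 ha hab hev Θ n hΘ1 hΘ2 hΘ3 hM
  obtain ⟨M1, N, J, hM1, hd, hMN, hN1, hs, hs1⟩ := step1a hab M hM σ hσ
  set L := adj (Set.range (ent N)) with hL
  have hNL : EM L N := fun i j => maO ⟨(i, j), rfl⟩
  have hGL : EM L (Gm N) := (hNL.mul EM.Om).mul hNL.tr
  have hPL : EM L (PM N) := ((hNL.tr.mul hGL.adj).mul hNL).mul EM.Om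
  have hMN' : M = M1 * N * (1 : MM b b K)ᵀ := by simp [hMN]
  have h1Om : (1 : MM b b K)ᵀ * Om b *1 = Om b := by simp
  have hgd : ∀ γ : GG, (ic K γ.2.1).det =1 := fun γ => icD _
  have hΘN : Θ K (PM N) ≠0 := by
    have := PM_JNB N M1 h1Om
    rw [← hMN', Matrix.mul_one, Matrix.one_mul] at this
    rw [this, hΘ2] at gΘ
    exact right_ne_zero_of_mul gΘ
  obtain ⟨E, hE, hEL, hσE⟩ := hΘ4 K GG σ (fun γ => ic K γ.2.1) hgd L (PM N) hPL (fun γ => (J γ).det ^2) (fun γ => by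
    have e := PM_map N (σ γ)
    rw [hs γ] at e
    have := PM_JNB N (J γ) (rep_Om b (hgd γ))
    rw [← e] at this
    exact this) hΘN
  have hfix : ∀ γ : GG, γ.2.1 =1 → ∀ y ∈ L, σ γ y = y := by
    intro γ hγ
    apply fix_adj
    rintro ⟨i, j⟩
    have := hs γ
    have e1 : ic K γ.2.1 =1 := by rw [hγ]; simp [ic]
    rw [hs1 γ hγ, e1, repO, transpose_one, Matrix.mul_one, Matrix.one_mul] at this
    exact congrFun (congrFun this i) j
  obtain ⟨v, χ, hv0, hvL, hv, hχ⟩ : ∃ (v : FS b → K) (χ : GG → K), v ≠0 ∧ (∀ i, v i ∈ L) ∧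
      (∀ γ, σ γ ∘ v = χ γ • (rep b (ic K γ.2.1) *ᵥ v)) ∧ (Even b → ∀ γ, χ γ =1) := by
    by_cases hbe : Even b
    · obtain ⟨k, hk⟩ := hbe
      have hk2 : b =2 * k := by omega
      refine ⟨pw b k (fun i => E i 0), fun _ =>1, pw_ne_zero hk2 ?_, pw_mem _ _ fun i => hEL i 0, ?_, fun _ _ => rfl⟩
      · intro h0
        exact hE (det_eq_zero_of_column_eq_zero 0 fun i => congrFun h0 i)
      · intro γ
        rw [one_smul, rep_pw hk2]
        have := pw_map b k (fun i => E i 0) (σ γ : K →+* K)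
        refine this.trans ?_
        congr 1
        funext i
        exact congrFun (congrFun (hσE γ) i) 0
    · have hae : Even a := (Nat.even_mul.1 hev).resolve_right hbe
      have hbo : Odd b := Nat.not_even_iff_odd.1 hbe
      have hG0 : (Gm N).det =0 := by
        have : (Gm N)ᵀ = - Gm N := by
          simp only [Gm, transpose_mul, transpose_transpose, Om_tr, hbo.neg_one_pow]
          simp [Matrix.mul_assoc]
        have h2 := congrArg Matrix.det this
        rw [det_transpose, det_neg, Fintype.card_fin, (hae.add_one).neg_one_pow] at h2
        have : CharZero K := charZero_of_injective_algebraMap (aM K).injective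
        have h3 : (2 : K) * (Gm N).det =0 := by linear_combination h2
        simpa using h3
      have hGM : Gm M = M1 * Gm N * M1ᵀ := by
        have := Gm_JNB N M1 h1Om
        rwa [← hMN'] at this
      obtain ⟨i0, j0, hij⟩ : ∃ i j, (Gm N).adjugate i j ≠0 := by
        by_contra! h
        have : (Gm N).adjugate =0 := by ext i j; exact h i j
        rw [hGM, adjugate_mul_distrib, adjugate_mul_distrib, this] at gadj
        simp at gadj
      set w : FS a → K := fun i => (Gm N).adjugate i j0 with hw
      have hw0 : w ≠0 := fun h => hij (congrFun h i0)
      have hGw : Gm N *ᵥ w =0 := by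
        funext i
        have := congrFun (congrFun (mul_adjugate (Gm N)) i) j0
        rw [hG0, zero_smul] at this
        exact this
      have hvw : (Nᵀ *ᵥ w) ≠0 := by
        intro h
        apply hw0
        have h1 : (N.submatrix id (cl hab))ᵀ *ᵥ w =0 := by
          funext i
          exact congrFun h (cl hab i)
        rwa [hN1, transpose_one, one_mulVec] at h1
      have hex : ∀ γ, ∃ c : K, (J γ)ᵀ *ᵥ (σ γ ∘ w) = c • w := by
        intro γ
        refine ker_line (Gm N) hij ?_ hGw hw0
        have h1 : (Gm N).map (σ γ) *ᵥ (σ γ ∘ w) =0 := by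
          have := map_mulVec' (σ γ : K →+* K) (Gm N) w
          rw [hGw] at this
          refine this.symm.trans ?_
          funext i; simp
        rw [Gm_map, hs γ, Gm_JNB _ _ (rep_Om b (hgd γ))] at h1
        have hJ : (J γ).det ≠0 := by
          intro h0
          obtain ⟨u, hu, hu0⟩ := Matrix.exists_vecMul_eq_zero_iff.2 h0
          have h3 := congrArg (fun Z => u ᵥ* Z.submatrix id (cl hab)) (hs γ)
          rw [submatrix_map, hN1, submatrix_mul _ _ _ id _ Function.bijective_id, ← vecMul_vecMul,
            submatrix_id_id, ← vecMul_vecMul, hu0] at h3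
          simp at h3
          exact hu h3
        rw [← mulVec_mulVec, ← mulVec_mulVec] at h1
        by_contra hne
        exact hJ (Matrix.exists_mulVec_eq_zero_iff.1 ⟨_, hne, h1⟩)
      choose χ hχ using hex
      refine ⟨Nᵀ *ᵥ w, χ, hvw, hNL.tr.mulVec fun i => hGL.adj i j0, ?_, fun h => absurd h hbe⟩
      intro γ
      have h1 := map_mulVec' (σ γ : K →+* K) Nᵀ w
      refine h1.trans ?_
      have h2 : Nᵀ.map (σ γ) = (rep b (ic K γ.2.1)) * Nᵀ * (J γ)ᵀ := by
        rw [transpose_map, hs γ]; simp [transpose_mul, Matrix.mul_assoc]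
      have h3 : Nᵀ.map (σ γ) *ᵥ (σ γ ∘ w) = χ γ • rep b (ic K γ.2.1) *ᵥ Nᵀ *ᵥ w := by
        rw [h2, ← mulVec_mulVec, hχ γ, mulVec_smul, ← mulVec_mulVec]
      exact h3
  have hχ1 : ∀ γ : GG, γ.2.1 =1 → χ γ =1 := by
    intro γ hγ
    have h1 := hv γ
    have e1 : ic K γ.2.1 =1 := by rw [hγ]; simp [ic]
    rw [e1, repO, one_mulVec] at h1
    obtain ⟨i, hi⟩ := Function.ne_iff.1 hv0
    have h2 := congrFun h1 i
    simp only [Function.comp, Pi.smul_apply, smul_eq_mul, hfix γ hγ _ (hvL i)] at h2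
    exact (mul_right_cancel₀ hi (by rw [one_mul]; exact h2)).symm
  obtain ⟨Q, hQ, hQL, hQσ, -⟩ := V2FL (fun γ => (σ γ : K →+* K)) (fun γ => ic K γ.2.1) hgd L E hE hEL hσE v hv0 hvL χ hv
  obtain ⟨c, hc, hcd⟩ := colsel (M * (Om b : Matrix _ _ K) * Q) (Q⁻¹ * (Om' b : Matrix _ _ K) * (1 : MM b b K).submatrix id (cl hab)) (by
    have : (M * (Om b : Matrix _ _ K) * Q) * (Q⁻¹ * (Om' b : Matrix _ _ K) * (1 : MM b b K).submatrix id (cl hab)) = M1 := by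
      calc _ = M * (Om b : Matrix _ _ K) * (Q * Q⁻¹) * (Om' b : Matrix _ _ K) * (1 : MM b b K).submatrix id (cl hab) := by
            simp only [Matrix.mul_assoc]
        _ = M * ((Om b : Matrix _ _ K) * (Om' b : Matrix _ _ K)) * (1 : MM b b K).submatrix id (cl hab) := by
            rw [mul_nonsing_inv _ (ndU hQ)]; simp only [Matrix.mul_one, Matrix.mul_assoc]
        _ = M1 := by
            rw [Om_Om', Matrix.mul_one, hM1]
            have := submatrix_mul M 1 (id : FS a → _) (id : FS b → _) (cl hab) Function.bijective_id
            rw [Matrix.mul_one, submatrix_id_id] at this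
            exact this.symm
    rw [this]; exact hd)
  refine ⟨L, M1, N, Q.submatrix id c, χ, hL, hMN, hd, hN1, fun i j => hQL _ _, ?_, ?_, hχ1, hχ⟩
  · have := submatrix_mul (M * (Om b : Matrix _ _ K)) Q (id : FS a → _) (id : FS b → _) c Function.bijective_id
    rw [submatrix_id_id] at this
    rw [← this]; exact hcd
  · intro γ
    rw [← submatrix_map]
    have h1 : Q.map (σ γ) = χ γ • (rep b (ic K γ.2.1) * Q) := hQσ γ
    rw [h1, submatrix_smul, Pi.smul_apply, Pi.smul_apply, submatrix_mul _ Q _ id c Function.bijective_id, submatrix_id_id]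
end

section
variable {K : Type} [Field K] [Algebra ℂ K] {a b : ℕ}

lemma smap {m n : Type*} (f : AE K) (c : K) (A : Matrix m n K) : (c • A).map f = f c • A.map f := by
  ext i j; simp

lemma inv_map' {m : Type*} [Fintype m] [DecidableEq m] (f : AE K) {A : Matrix m m K} (h : A.det ≠0) :
    A⁻¹.map f = (A.map f)⁻¹ := by
  symm
  apply Matrix.inv_eq_left_inv
  rw [← mapmul, nonsing_inv_mul _ (ndU h), Matrix.map_one _ (map_zero _) (map_one _)]

lemma gen_le {L : IF K} {ι : Type*} {x : ι → K} (h : AR x = ⊤) (h2 : ∀ i, x i ∈ L) : L = ⊤ :=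
  top_le_iff.1 (h ▸ adL h2)

lemma step1b (ha : 1 < a) (hab : a < b) (hb : 4 < b) (hev : Even (a * b)) (M : MM a b K)
    (hM : AI (ent M)) (hMt : adj (Set.range (ent M)) = ⊤) (σ : GG → AE K)
    (hσ : ∀ γ : GG, M.map (σ γ) = aM K γ.2.2 • (rep a (ic K γ.1) * M * (rep b (ic K γ.2.1))ᵀ)) :
    ∃ (B : MM a a K) (F : MM a b K)
      (Q : MM b a K) (χ : GG → K),
      M = B * F ∧ B.det ≠0 ∧ F * (Om b : Matrix _ _ K) * Q =1 ∧ AI (ent B) ∧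
      (∀ γ, B.map (σ γ) = (aM K γ.2.2 * χ γ) • (rep a (ic K γ.1) * B)) ∧
      (∀ γ, F.map (σ γ) = (χ γ)⁻¹ • (F * (rep b (ic K γ.2.1))ᵀ)) ∧
      (∀ γ, χ γ ≠0) ∧ (∀ γ, γ.2.1 =1 → χ γ =1) ∧ (Even b → ∀ γ, χ γ =1) ∧
      (∀ (L' : IF K) (S : MM a a K) (H : MM a b K), F = S * H → EM L' H → EM L' F ∧ EM L' Q) := by
  obtain ⟨L, M1, N, Q, χ, hL, hMN, hd, hN1, hQL, hBd, hQσ, hχ1, hχe⟩ := step1 ha hab hb hev M hM σ hσ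
  set B := M * (Om b : Matrix _ _ K) * Q with hB
  have hNL : EM L N := fun i j => by rw [hL]; exact maO ⟨(i, j), rfl⟩
  have hBu := ndU hBd
  have hMBF : M = B * (B⁻¹ * M) := by rw [← Matrix.mul_assoc, mul_nonsing_inv _ hBu, Matrix.one_mul]
  have hBσ : ∀ γ, B.map (σ γ) = (aM K γ.2.2 * χ γ) • (rep a (ic K γ.1) * B) := by
    intro γ
    have h1 := rep_Om b (icD (K := K) γ.2.1)
    calc B.map (σ γ) = (aM K γ.2.2 * χ γ) • (rep a (ic K γ.1) * M * ((rep b (ic K γ.2.1))ᵀ * (Om b : Matrix _ _ K) * rep b (ic K γ.2.1)) * Q) := by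
          rw [hB, mapmul, mapmul, hσ, hQσ, Om_map]
          simp only [Matrix.smul_mul, Matrix.mul_smul, smul_smul, Matrix.mul_assoc]
          rw [mul_comm]
      _ = _ := by rw [h1]; simp only [hB, Matrix.mul_assoc]
  have hχ0 : ∀ γ, χ γ ≠0 := by
    intro γ h
    have h1 := hBσ γ
    rw [h, mul_zero, zero_smul] at h1
    apply det_ne_map (σ γ) hBd
    rw [h1]; simp
  have hNQ : (N * (Om b : Matrix _ _ K) * Q).det ≠0 := by
    have : B = M1 * (N * (Om b : Matrix _ _ K) * Q) := by rw [hB]; conv_lhs => rw [hMN]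
                                                          simp only [Matrix.mul_assoc]
    rw [this, det_mul] at hBd
    exact right_ne_zero_of_mul hBd
  have hFN : B⁻¹ * M = (N * (Om b : Matrix _ _ K) * Q)⁻¹ * N := by
    have e : B = M1 * (N * (Om b : Matrix _ _ K) * Q) := by rw [hB]; conv_lhs => rw [hMN]
                                                            simp only [Matrix.mul_assoc]
    rw [e, Matrix.mul_inv_rev, Matrix.mul_assoc]
    conv_lhs => rw [hMN]
    rw [← Matrix.mul_assoc M1⁻¹, nonsing_inv_mul _ (ndU hd), Matrix.one_mul]
  have hFL : EM L (B⁻¹ * M) := by rw [hFN]; exact (((hNL.mul EM.Om).mul hQL).inv).mul hNL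
  refine ⟨B, B⁻¹ * M, Q, χ, hMBF, hBd, ?_, ?_, hBσ, ?_, hχ0, hχ1, hχe, ?_⟩
  · rw [Matrix.mul_assoc, Matrix.mul_assoc, ← Matrix.mul_assoc M, ← hB, nonsing_inv_mul _ hBu]
  · have hc := count (Sum.elim (ent B) (fun p : FS a × Fin (b - a) => N p.1 ⟨a +1 + p.2, by omega⟩)) (ent M) hM hMt ?_ ?_
    · exact hc.comp Sum.inl Sum.inl_injective
    · set L2 := adj (Set.range (Sum.elim (ent B) (fun p : FS a × Fin (b - a) => N p.1 ⟨a +1 + p.2, by omega⟩)))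
      have hLL : L ≤ L2 := by
        rw [hL]; apply adL
        rintro ⟨i, j⟩
        by_cases hj : (j : ℕ) < a +1
        · have : N i j = (1 : MM a a K) i ⟨j, hj⟩ := by rw [← hN1]; rfl
          simp only [ent, this]; exact EM.one _ _
        · have : N i j = N i ⟨a +1 + (⟨j - (a +1), by omega⟩ : Fin (b - a)), by simp only; omega⟩ := by
            congr 1; ext; simp only; omega
          simp only [ent, this]
          exact maO ⟨Sum.inr (i, ⟨j - (a +1), by omega⟩), rfl⟩
      refine gen_le hMt ?_
      rintro ⟨i, j⟩
      have : EM L2 M := by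
        rw [hMBF]
        exact EM.mul (fun i j => maO ⟨Sum.inl (i, j), rfl⟩) fun i j => hLL (hFL i j)
      exact this i j
    · simp
      have : b +1 = (a +1) + (b - a) := by omega
      rw [this]; ring
  · intro γ
    rw [mapmul, inv_map' _ hBd, hBσ γ, hσ γ]
    have hA : IsUnit (rep a (ic K γ.1)).det := rdU a (icD _)
    have ht : (aM K γ.2.2) ≠0 := by simp
    have hi : ((aM K γ.2.2 * χ γ) • (rep a (ic K γ.1) * B))⁻¹ = (aM K γ.2.2 * χ γ)⁻¹ • (B⁻¹ * (rep a (ic K γ.1))⁻¹) := by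
      apply Matrix.inv_eq_left_inv
      rw [smul_mul_smul_comm, inv_mul_cancel₀ (mul_ne_zero ht (hχ0 γ)), one_smul, Matrix.mul_assoc, ← Matrix.mul_assoc _ _ B,
        nonsing_inv_mul _ hA, Matrix.one_mul, nonsing_inv_mul _ hBu]
    rw [hi, Matrix.smul_mul, Matrix.mul_smul, smul_smul, mul_inv, mul_right_comm, inv_mul_cancel₀ ht, one_mul]
    refine congrArg (fun v => (χ γ)⁻¹ • v) ?_
    rw [Matrix.mul_assoc, Matrix.mul_assoc _ M, ← Matrix.mul_assoc _ _ (M * _), nonsing_inv_mul _ hA, Matrix.one_mul, Matrix.mul_assoc]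
  · intro L' S H hF hH
    have hS : L ≤ L' := by
      have e0 : N = M1⁻¹ * B * S * H := by
        rw [Matrix.mul_assoc _ S, ← hF, Matrix.mul_assoc, ← hMBF]
        conv_rhs => rw [hMN]
        rw [← Matrix.mul_assoc, nonsing_inv_mul _ (ndU hd), Matrix.one_mul]
      generalize M1⁻¹ * B * S = T at e0
      have e1 : T * H.submatrix id (cl hab) =1 := by
        rw [← hN1]
        conv_rhs => rw [e0]
        rw [submatrix_mul _ _ _ id _ Function.bijective_id, submatrix_id_id]
      have e2 : T = (H.submatrix id (cl hab))⁻¹ := (Matrix.inv_eq_left_inv e1).symm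
      have e3 : EM L' N := by
        rw [e0, e2]; exact EM.mul (EM.inv fun i j => hH _ _) hH
      rw [hL]; exact adL fun p => e3 _ _
    exact ⟨fun i j => hS (hFL i j), fun i j => hS (hQL i j)⟩

lemma zlem (hab : a < b) (F : MM a b K) (Q : MM b a K)
    (hFQ : F * (Om b : Matrix _ _ K) * Q =1) (U : IF K) (R : MM b b K) (hR : R.det ≠0)
    (hRU : EM U R) (c : FS a → K) (hc0 : c ≠0) (f0 : K) (hf0 : f0 ≠0) (hc : c ᵥ* F = f0 • fun i => R i 0) :
    ∃ (ρ : Type) (_ : Fintype ρ) (z : ρ → K) (S : MM a a K) (H : MM a b K),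
      Fintype.card ρ = a * (b - a) ∧ F = S * H ∧ EM (U ⊔ AR z) H ∧
      ∀ (τ : AE K) (B : MM b b K) (x y : K), B.det ≠0 → x ≠0 → y ≠0 →
        F.map τ = x • (F * Bᵀ) → R.map τ = y • (B * R) → ∀ i, τ (z i) = z i := by
  classical
  set C := F * (Rᵀ)⁻¹ with hC
  have hRt : (Rᵀ).det ≠0 := by rwa [det_transpose]
  have hFC : F = C * Rᵀ := by rw [hC, Matrix.mul_assoc, nonsing_inv_mul _ (ndU hRt), Matrix.mul_one]
  have hcC : c ᵥ* C = f0 • Pi.single 0 1 := by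
    rw [hC, ← vecMul_vecMul, hc, smul_vecMul]
    congr 1
    have : (fun i => R i 0) = Pi.single (0 : FS b) (1 : K) ᵥ* Rᵀ := by
      funext i; simp [vecMul_transpose]
    rw [this, vecMul_vecMul, mul_nonsing_inv _ (ndU hRt), vecMul_one]
  obtain ⟨κ, hκ, hS⟩ := colsel C (Rᵀ * (Om b : Matrix _ _ K) * Q) (by
    rw [← Matrix.mul_assoc, ← Matrix.mul_assoc, ← hFC, hFQ]; simp)
  have hSu := ndU hS
  set S := C.submatrix id κ with hSdef
  have hcS : c ᵥ* S = f0 • (fun i => if κ i =0 then 1 else 0) := by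
    funext i
    have := congrFun hcC (κ i)
    simp only [Pi.smul_apply, Pi.single_apply] at this ⊢
    exact this
  obtain ⟨i0, hi0⟩ : ∃ i, κ i =0 := by
    by_contra! h
    have : c ᵥ* S =0 := by rw [hcS]; funext i; simp [h i]
    exact hS (Matrix.exists_vecMul_eq_zero_iff.1 ⟨c, hc0, this⟩)
  set H := S⁻¹ * C with hH
  have hCS : C = S * H := by rw [hH, ← Matrix.mul_assoc, mul_nonsing_inv _ hSu, Matrix.one_mul]
  have hH1 : ∀ i j, H i (κ j) = if i = j then 1 else 0 := by
    intro i j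
    have : H.submatrix id κ =1 := by
      rw [hH, submatrix_mul _ _ _ id _ Function.bijective_id, submatrix_id_id, ← hSdef, nonsing_inv_mul _ hSu]
    exact (congrFun (congrFun this i) j).trans (by rw [one_apply])
  have hH0 : ∀ j, H i0 j = if j =0 then 1 else 0 := by
    intro j
    have h1 := hcC
    rw [hCS, ← vecMul_vecMul, hcS] at h1
    have h2 := congrFun h1 j
    have h3 : (fun i => if κ i =0 then (1 : K) else 0) = Pi.single i0 1 := by
      funext i
      rw [Pi.single_apply]
      congr 1
      rw [← hi0]; exact propext ⟨fun h => hκ h, fun h => h ▸ rfl⟩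
    rw [h3, smul_vecMul, single_vecMul, one_smul] at h2
    simp only [Pi.smul_apply, Pi.single_apply, smul_eq_mul] at h2
    exact mul_left_cancel₀ hf0 h2
  refine ⟨{i : FS a // i ≠ i0} × {j : FS b // j ∉ Set.range κ}, inferInstance, fun p => H p.1 p.2, S, H * Rᵀ, ?_, ?_, ?_, ?_⟩
  · rw [Fintype.card_prod]
    have h1 : Fintype.card {i : FS a // i ≠ i0} = a := by
      rw [Fintype.card_subtype_compl]; simp
    have h2 : Fintype.card {j : FS b // j ∉ Set.range κ} = b - a := by
      rw [Fintype.card_subtype_compl, Fintype.card_fin]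
      have : Fintype.card {x // x ∈ Set.range κ} = a +1 := by
        have := Set.card_range_of_injective hκ
        rw [Fintype.card_fin] at this
        convert this
      rw [this]; omega
    rw [h1, h2]
  · rw [← Matrix.mul_assoc, ← hCS, ← hFC]
  · have hRU' : EM (U ⊔ adj (Set.range fun p : {i : FS a // i ≠ i0} × {j : FS b // j ∉ Set.range κ} => H p.1 p.2)) Rᵀ :=
      fun i j => le_sup_left (α := IF K) (hRU j i)
    refine EM.mul ?_ hRU'
    intro i j
    by_cases hi : i = i0
    · rw [hi, hH0]; split_ifs
      exacts [one_mem _, zero_mem _]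
    · by_cases hj : j ∈ Set.range κ
      · obtain ⟨j, rfl⟩ := hj
        rw [hH1]; split_ifs
        exacts [one_mem _, zero_mem _]
      · exact msr (fun p : {i : FS a // i ≠ i0} × {j : FS b // j ∉ Set.range κ} => H p.1 p.2) (⟨i, hi⟩, ⟨j, hj⟩)
  · intro τ B x y hB hx hy hFτ hRτ
    have h1 : C.map τ = (x * y⁻¹) • C := by
      have hBR : ((B * R)ᵀ).det ≠0 := by
        rw [det_transpose, det_mul]; exact mul_ne_zero hB hR
      have h2 : C.map τ * (y • (B * R)ᵀ) = x • (F * Bᵀ) := by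
        have e := mapmul τ C Rᵀ
        rw [← hFC, transpose_map, hRτ, transpose_smul] at e
        rw [← hFτ, e]
      have h3 : C.map τ * (B * R)ᵀ = ((x * y⁻¹) • C) * (B * R)ᵀ := by
        have e : x • (F * Bᵀ) = x • (C * (B * R)ᵀ) := by
          conv_lhs => rw [hFC]
          simp only [transpose_mul, Matrix.mul_assoc]
        rw [e, Matrix.mul_smul] at h2
        have := congrArg (fun v => y⁻¹ • v) h2
        simp only [smul_smul, inv_mul_cancel₀ hy, one_smul] at this
        rw [this, Matrix.smul_mul, mul_comm]
      have h4 := congrArg (fun Z => Z * ((B * R)ᵀ)⁻¹) h3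
      simp only [Matrix.mul_assoc, mul_nonsing_inv _ (ndU hBR), Matrix.mul_one] at h4
      exact h4
    have h2 : S.map τ = (x * y⁻¹) • S := by
      rw [hSdef, ← submatrix_map, h1]; rfl
    have h3 : H.map τ = H := by
      have hxy : x * y⁻¹ ≠0 := mul_ne_zero hx (inv_ne_zero hy)
      have e := congrArg (fun Z => Z.map τ) hCS
      simp only [mapmul, h1, h2] at e
      rw [Matrix.smul_mul] at e
      have e2 : C = S * H.map τ := by
        have := congrArg (fun v => (x * y⁻¹)⁻¹ • v) e
        simpa only [smul_smul, inv_mul_cancel₀ hxy, one_smul] using this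
      have e3 := congrArg (fun Z => S⁻¹ * Z) e2
      simp only [← Matrix.mul_assoc, nonsing_inv_mul _ hSu, Matrix.one_mul] at e3
      rw [← e3]
    intro p
    exact congrFun (congrFun h3 p.1) p.2
end

section
variable {K : Type} [Field K] [Algebra ℂ K] {a b : ℕ}

lemma inf_zero {d : ℕ} (f : FS d → K) (h : ∀ g : SL2, (rep d (ic K g) *ᵥ f) 0 =0) : f =0 := by
  have h0 : cfp f =0 := by
    refine Polynomial.eq_zero_of_infinite_isRoot _ ((Set.infinite_range_of_injective (aM K).injective).mono ?_)
    rintro _ ⟨s, rfl⟩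
    have h1 := h ⟨!![1, s; 0,1], by simp [det_fin_two]⟩
    have e : Pi.single (0 : FS d) (1 : K) = mon d 0 1 := by
      funext i
      by_cases hi : i =0
      · subst hi; simp [mon]
      · simp [mon, hi]
    rw [← one_mul ((rep d _ *ᵥ f) 0), ← single_dotProduct, e, dotProduct_mulVec, monR] at h1
    simp only [Polynomial.IsRoot, Set.mem_setOf_eq, cfp, Polynomial.eval_finset_sum, Polynomial.eval_mul, Polynomial.eval_C,
      Polynomial.eval_pow, Polynomial.eval_X]
    rw [← h1, dotProduct]
    refine Finset.sum_congr rfl fun i _ => ?_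
    simp [mon, mul_comm]
  funext i
  rw [← cfp_coeff f i, h0]; simp

lemma theta_u (hb : 4 < b) (σ : GG → AE K) (u : FS b → K) (hu0 : u 0 =1)
    (hi : AI fun i : Fin b => u i.succ) (m : GG → K) 
    (hu : ∀ γ, σ γ ∘ u = m γ • (rep b (ic K γ.2.1) *ᵥ u)) :
    ∃ R : MM b b K, R.det ≠0 ∧ EM (AR u) R ∧
      (∀ γ, R.map (σ γ) = m γ • (rep b (ic K γ.2.1) * R)) ∧ ∀ i, R i 0 = u i := by
  obtain ⟨Θ, n, h1, h2, ⟨v, -, h3⟩, h4⟩ := frame_thm hb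
  have hvm : ∀ {R S : Type} [CommRing R] [Algebra ℂ R] [CommRing S] [Algebra ℂ S] (f : R →ₐ[ℂ] S) (x : FS b → R),
      f (Θ R (vecMulVec x x * Om b)) = Θ S (vecMulVec (f ∘ x) (f ∘ x) * Om b) := by
    intro R S _ _ _ _ f x
    rw [h1, mapmul, Om_map]
    congr 2; ext i j; simp [vecMulVec_apply]
  have hvs : ∀ (c : ℂ) (x : FS b → ℂ), Θ ℂ (vecMulVec (c • x) (c • x) * Om b) = (c * c) ^ n * Θ ℂ (vecMulVec x x * Om b) := by
    intro c x
    rw [← h2, ← Matrix.smul_mul]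
    congr 2; ext i j; simp [vecMulVec_apply]; ring
  have hΘ : Θ K (vecMulVec u u * Om b) ≠0 := by
    have hu' : u = Fin.cons 1 fun i : Fin b => u i.succ := by
      funext i; refine Fin.cases ?_ (fun i => ?_) i
      · simpa using hu0
      · simp
    obtain ⟨c, hc⟩ := dens' (K := ℂ) (Θ _ (vecMulVec X X * Om b) * X (0 : FS b)) (by
      refine mul_ne_zero (fun h => h3 ?_) (X_ne_zero _)
      have := hvm (aeval v : MvPolynomial (FS b) ℂ →ₐ[ℂ] ℂ) X
      rw [h, map_zero] at this
      rw [this]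
      congr <;> funext i <;> simp)
    rw [eval_mul] at hc
    have hc1 := left_ne_zero_of_mul hc
    have hc2 : c 0 ≠0 := by simpa using right_ne_zero_of_mul hc
    have e := hvm (aeval c : MvPolynomial (FS b) ℂ →ₐ[ℂ] ℂ) X
    have e1 : (aeval c : MvPolynomial (FS b) ℂ →ₐ[ℂ] ℂ) ∘ X = c := by funext i; simp
    have e3 : c = c 0 • (Fin.cons 1 fun i : Fin b => (c 0)⁻¹ * c i.succ : FS b → ℂ) := by
      funext i; refine Fin.cases ?_ (fun i => ?_) i
      · simp
      · simp [mul_inv_cancel_left₀ hc2]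
    rw [e1] at e
    have e4 := congrArg (fun y => Θ ℂ (vecMulVec y y * Om b)) e3
    simp only [hvs, ← e] at e4
    rw [hu']
    refine spec (fun R _ _ x => Θ R (vecMulVec (Fin.cons 1 x) (Fin.cons 1 x) * Om b)) ?_ hi (fun i : Fin b => (c 0)⁻¹ * c i.succ) ?_
    · intro R _ _ S _ _ f x
      have : f ∘ (Fin.cons 1 x : FS b → R) = Fin.cons 1 (f ∘ x) := by
        funext i; refine Fin.cases ?_ (fun i => ?_) i <;> simp
      rw [hvm, this]
    · intro h
      simp only [h, mul_zero] at e4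
      exact hc1 e4
  have huU : ∀ i, u i ∈ AR u := fun i => maO ⟨i, rfl⟩
  obtain ⟨E, hE, hEU, hEσ⟩ := h4 K GG σ (fun γ => ic K γ.2.1) (fun γ => icD _) (AR u) (vecMulVec u u * Om b)
    (EM.mul (fun i j => mul_mem (huU i) (huU j)) EM.Om) (fun γ => m γ * m γ) (fun γ => by
      have h5 : (vecMulVec u u).map (σ γ) = (m γ * m γ) • (rep b (ic K γ.2.1) * vecMulVec u u * (rep b (ic K γ.2.1))ᵀ) := by
        rw [mul_vecMulVec, vecMulVec_mul, vecMul_transpose]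
        ext i j
        have a1 := congrFun (hu γ) i
        have a2 := congrFun (hu γ) j
        simp only [Function.comp, Pi.smul_apply, smul_eq_mul] at a1 a2
        simp only [map_apply, vecMulVec_apply, map_mul, a1, a2, Matrix.smul_apply, smul_eq_mul]
        ring
      have h6 : (vecMulVec u u * (Om b : Matrix _ _ K)).map (σ γ) = (vecMulVec u u).map (σ γ) * Om b := by rw [mapmul, Om_map]
      change (vecMulVec u u * (Om b : Matrix _ _ K)).map (σ γ) * _ = _
      rw [h6, h5]
      have h7 := rep_Om b (icD (K := K) γ.2.1)
      simp only [Matrix.smul_mul, Matrix.mul_assoc] at h7 ⊢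
      rw [h7]) hΘ
  exact V2FL (fun γ => (σ γ : K →+* K)) (fun γ => ic K γ.2.1) (fun γ => icD _) _ E hE hEU hEσ u
    (fun h => by rw [h] at hu0; simp at hu0) huU m hu

structure S3 (a : ℕ) (σ : GG → AE K) (χ : GG → K) (c : FS a → K) {ω ρ : Type} [Fintype ρ] (w : ω → K)
    (u : FS b → K) (f0 : K) (z : ρ → K) (μ : GG → K) : Prop where
  u0 : u 0 =1
  ind : AI fun i : Fin b => u i.succ
  us : ∀ γ, σ γ ∘ u = (μ γ)⁻¹ • (rep b (ic K γ.2.1) *ᵥ u)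
  hμ : ∀ γ, μ γ = (rep b (ic K γ.2.1) *ᵥ u) 0
  f00 : f0 ≠0
  fs : ∀ γ, σ γ f0 = (χ γ)⁻¹ * μ γ * f0
  card : Fintype.card ρ = a * (b - a)
  zs : ∀ i, z i ∈ Fx σ
  gen : ∀ L' : IF K, (∀ i, u i ∈ L') → (∀ i, z i ∈ L') →
    f0 ∈ L' ∧ (∀ i, c i ∈ L') ∧ ((∀ i, w i ∈ L') → L' = ⊤)

lemma step3 (hab : a < b) (hb : 4 < b) (M : MM a b K)
    (hM : AI (ent M)) (hMt : adj (Set.range (ent M)) = ⊤) (σ : GG → AE K)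
    (B : MM a a K) (F : MM a b K)
    (Q : MM b a K) (χ : GG → K)
    (hMBF : M = B * F) (hFQ : F * (Om b : Matrix _ _ K) * Q =1)
    (hF : ∀ γ, F.map (σ γ) = (χ γ)⁻¹ • (F * (rep b (ic K γ.2.1))ᵀ)) (hχ : ∀ γ, χ γ ≠0)
    (hL : ∀ (L' : IF K) (S : MM a a K) (H : MM a b K),
      F = S * H → EM L' H → EM L' F ∧ EM L' Q)
    (c : FS a → K) (hc : ∀ i, c i ∈ Fx σ) (i0 : FS a) (hc1 : c i0 =1) {ω : Type} [Fintype ω] (w : ω → K)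
    (hω : Fintype.card ω = a * (a +1) +1)
    (hw : ∀ L' : IF K, (∀ i, c i ∈ L') → (∀ i, w i ∈ L') → EM L' B) :
    ∃ (ρ : Type) (_ : Fintype ρ) (u : FS b → K) (f0 : K) (z : ρ → K) (μ : GG → K), S3 a σ χ c w u f0 z μ := by
  have hc0 : c ≠0 := fun h => by rw [h] at hc1; simp at hc1
  have hfQ : (c ᵥ* F) ᵥ* ((Om b : Matrix _ _ K) * Q) = c := by
    rw [vecMul_vecMul, ← Matrix.mul_assoc, hFQ, vecMul_one]
  have hfσ : ∀ γ, σ γ ∘ (c ᵥ* F) = (χ γ)⁻¹ • (rep b (ic K γ.2.1) *ᵥ (c ᵥ* F)) := by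
    intro γ
    have e : σ γ ∘ (c ᵥ* F) = c ᵥ* F.map (σ γ) := by
      funext j
      simp only [Function.comp, vecMul, dotProduct, map_sum, map_mul, map_apply]
      exact Finset.sum_congr rfl fun i _ => by rw [(mFx σ).1 (hc i) γ]
    rw [e, hF, vecMul_smul, ← vecMul_vecMul, vecMul_transpose]
  set f := c ᵥ* F with hf
  have hfn : f ≠0 := fun h => hc0 (by rw [← hfQ, h, zero_vecMul])
  set f0 := f 0 with hf0d
  have hf0 : f0 ≠0 := by
    intro h
    apply hfn
    apply inf_zero
    intro g
    have := congrFun (hfσ (1, g,1)) 0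
    simp only [Function.comp, ← hf0d, h, map_zero, Pi.smul_apply, smul_eq_mul] at this
    exact (mul_eq_zero.1 this.symm).resolve_left (inv_ne_zero (hχ _))
  set u := f0⁻¹ • f with hu
  have hfu : f = f0 • u := by rw [hu, smul_smul, mul_inv_cancel₀ hf0, one_smul]
  have hu0 : u 0 =1 := by simp only [hu, Pi.smul_apply, smul_eq_mul]; exact inv_mul_cancel₀ hf0
  set μ : GG → K := fun γ => (rep b (ic K γ.2.1) *ᵥ u) 0 with hμ
  have hfs : ∀ γ, σ γ f0 = (χ γ)⁻¹ * μ γ * f0 := by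
    intro γ
    have := congrFun (hfσ γ) 0
    rw [hfu, mulVec_smul] at this
    simp only [Function.comp, Pi.smul_apply, smul_eq_mul, hu0, mul_one] at this
    rw [this, hμ]; ring
  have hμ0 : ∀ γ, μ γ ≠0 := by
    intro γ h
    have := hfs γ
    rw [h, mul_zero, zero_mul] at this
    exact hf0 ((map_eq_zero _).1 this)
  have hus : ∀ γ, σ γ ∘ u = (μ γ)⁻¹ • (rep b (ic K γ.2.1) *ᵥ u) := by
    intro γ
    have h1 : σ γ ∘ u = (σ γ f0)⁻¹ • (σ γ ∘ f) := by funext i; simp [hu]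
    rw [h1, hfσ, hfs, hfu, mulVec_smul, smul_smul, smul_smul]
    congr 1
    have := hχ γ; have := hμ0 γ
    field_simp
  have close : ∀ (L' : IF K) (S : MM a a K) (H : MM a b K),
      F = S * H → EM L' H → (∀ i, u i ∈ L') → f0 ∈ L' ∧ (∀ i, c i ∈ L') ∧ ((∀ i, w i ∈ L') → L' = ⊤) := by
    intro L' S H h1 h2 h3
    obtain ⟨hF', hQ'⟩ := hL L' S H h1 h2
    have h4 : ∀ i, (u ᵥ* ((Om b : Matrix _ _ K) * Q)) i ∈ L' := fun i => by
      rw [vecMul, dotProduct]; exact sum_mem fun k _ => L'.mul_mem (h3 k) (EM.mul EM.Om hQ' k i)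
    have h5 : ∀ i, c i = f0 * (u ᵥ* ((Om b : Matrix _ _ K) * Q)) i := by
      intro i
      rw [← congrFun hfQ i, hfu, smul_vecMul]; rfl
    have h6 : f0 ∈ L' := by
      have := h5 i0
      rw [hc1] at this
      rw [eq_inv_of_mul_eq_one_left this.symm]
      exact inv_mem (h4 _)
    have h7 : ∀ i, c i ∈ L' := fun i => by rw [h5]; exact mul_mem h6 (h4 i)
    refine ⟨h6, h7, fun h8 => gen_le hMt ?_⟩
    have := EM.mul (hw L' h7 h8) hF'
    rw [← hMBF] at this
    exact fun p => this _ _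
  have hi : AI fun i : Fin b => u i.succ := by
    obtain ⟨ρ, _, z, S, H, hρ, hS, hH, -⟩ := zlem hab F Q hFQ (AR u) ((1 : Matrix _ _ K).updateCol 0 u)
      (by rw [← cramer_apply, cramer_one]; simp [hu0]) (by
        intro i j
        rw [updateCol_apply]; split_ifs
        exacts [maO ⟨i, rfl⟩, EM.one _ _]) c hc0 f0 hf0 (by rw [← hf, hfu]; congr 1)
    have := count (Sum.elim (fun i : Fin b => u i.succ) (Sum.elim z w)) (ent M) hM hMt ?_ ?_
    · exact this.comp Sum.inl Sum.inl_injective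
    · have hu' : ∀ i, u i ∈ adj (Set.range (Sum.elim (fun i : Fin b => u i.succ) (Sum.elim z w))) := by
        intro i; refine Fin.cases ?_ (fun i => ?_) i
        · rw [hu0]; exact one_mem _
        · exact maO ⟨Sum.inl i, rfl⟩
      refine (close _ S H hS (fun i j => ?_) hu').2.2 fun i => maO ⟨Sum.inr (Sum.inr i), rfl⟩
      exact saL (adL hu') (fun i => maO ⟨Sum.inr (Sum.inl i), rfl⟩) (hH i j)
    · simp only [Fintype.card_sum, Fintype.card_fin, hρ, hω, Fintype.card_prod]
      obtain ⟨d, rfl⟩ := Nat.exists_eq_add_of_lt hab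
      have : a + d +1 - a = d +1 := by omega
      rw [this]; ring
  obtain ⟨R, hR, hRU, hRσ, hR0⟩ := theta_u hb σ u hu0 hi _ hus
  obtain ⟨ρ, _, z, S, H, hρ, hS, hH, hz⟩ := zlem hab F Q hFQ (AR u) R hR hRU c hc0 f0 hf0
    (by rw [← hf, hfu]; congr 1; funext i; rw [hR0])
  exact ⟨ρ, inferInstance, u, f0, z, μ, hu0, hi, hus, fun _ => rfl, hf0, hfs, hρ,
    fun i => (mFx σ).2 fun γ => hz (σ γ) (rep b (ic K γ.2.1)) _ _ (rdU b (icD _)).ne_zero (inv_ne_zero (hχ γ))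
      (inv_ne_zero (hμ0 γ)) (hF γ) (hRσ γ) i,
    fun L' h1 h2 => close L' S H hS (fun i j => saL (adL h1) h2 (hH i j)) h1⟩
end

section
variable {K : Type} [Field K] [Algebra ℂ K] {a b : ℕ}

lemma trace_om' {d : ℕ} (A : MM d d ℂ) (v w : FS d → ℂ) :
    trace (A * (vecMulVec v w * Om d)) = om d w (A *ᵥ v) := by
  rw [← Matrix.mul_assoc, mul_vecMulVec, vecMulVec_mul, trace_vecMulVec, om, dotProduct_comm, ← dotProduct_mulVec]

def ff {R : Type*} [CommRing R] [Algebra ℂ R] (C : Matrix (FS a) (Fin 3) R) : Fin 3 → Fin 3 → R :=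
  fun j => pi2 a (vecMulVec (C.col (![0,0,1] j)) (C.col (![1,2,2] j)) * Om a)

def f1 {R : Type*} [CommRing R] [Algebra ℂ R] (C : Matrix (FS a) (Fin 3) R) : R := C.col 0 ⬝ᵥ (Om a *ᵥ C.col 1)

lemma ff_test (a : ℕ) : ∃ C : Matrix (Fin (a +4)) (Fin 3) ℂ, (Matrix.of (ff C)).det ≠0 := by
  have h0 : ∀ v w : Fin (a +4) → ℂ, pi2 (a +3) (vecMulVec v w * Om (a +3)) =
      ![om (a +3) w (Xk _ 2 *ᵥ v), -2 * om _ w (Xk _ 1 *ᵥ v), om _ w (Xk _ 0 *ᵥ v)] := by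
    intro v w
    simp only [pi2, trace_om']
  have hd : ∀ v : Fin 3 → Fin (a +4) → ℂ, Matrix.of (ff (Matrix.of v)ᵀ) = Matrix.of fun j => ![om (a +3) (v (![1,2,2] j)) (Xk _ 2 *ᵥ v (![0,0,1] j)),
      -2 * om _ (v (![1,2,2] j)) (Xk _ 1 *ᵥ v (![0,0,1] j)), om _ (v (![1,2,2] j)) (Xk _ 0 *ᵥ v (![0,0,1] j))] :=
    fun v => congrArg Matrix.of (funext fun j => h0 _ _)
  rcases Nat.even_or_odd' (a +3) with ⟨m, hm | hm⟩
  · refine ⟨(Matrix.of ![ub _ m, ub _ (m +1), ub _ (m -1)])ᵀ, ?_⟩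
    rw [hd, det_fin_three]
    simp only [of_apply, cons_val]
    rw [Xou (by omega), Xou (by omega)]
    simp only [Xau, Xbu, omR, Nat.add_sub_cancel]
    have e1 := omE (d := a +3) (i := m +1) (j := m -1) (by omega)
    have e2 := omE (d := a +3) (i := m -1) (j := m +1) (by omega)
    rw [omN (i := m +1) (j := m +1) (by omega), omN (i := m +1) (j := m) (by omega), omN (i := m -1) (j := m) (by omega),
      omN (i := m -1) (j := m -1) (by omega), omN (i := m -1) (j := m +1 +1) (by omega), e1, e2]
    have n1 : wv (a +3) (m +1) ≠0 := wv_ne (by omega)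
    have n2 : wv (a +3) (m -1) ≠0 := wv_ne (by omega)
    have h : ((a +3 : ℕ) : ℂ) =2 * m := by exact_mod_cast hm
    have hm0 : (m : ℂ) ≠0 := by norm_cast; omega
    rw [h]
    have : (m : ℂ) * m * wv (a +3) (m -1) * wv (a +3) (m -1) * wv (a +3) (m +1) ≠0 := by positivity
    intro h
    apply this
    push_cast at h
    linear_combination h / (-16)
  · refine ⟨(Matrix.of ![ub _ (m +1), ub _ m, ub _ (m +1) + ub _ m])ᵀ, ?_⟩
    rw [hd, det_fin_three]
    simp only [of_apply, cons_val]
    rw [Xou (by omega), Xou (by omega)]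
    simp only [Xau, Xbu, omR, omA, Nat.add_sub_cancel]
    have e1 := omE (d := a +3) (i := m +1) (j := m) (by omega)
    have e2 := omE (d := a +3) (i := m) (j := m +1) (by omega)
    rw [omN (i := m) (j := m) (by omega), omN (i := m) (j := m +1 +1) (by omega), omN (i := m +1) (j := m +1) (by omega),
      omN (i := m +1) (j := m +1 +1) (by omega), omN (i := m +1) (j := m -1) (by omega), omN (i := m) (j := m -1) (by omega), e1, e2]
    have n1 : wv (a +3) (m +1) ≠0 := wv_ne (by omega)
    have n2 : wv (a +3) m ≠0 := wv_ne (by omega)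
    have h : ((a +3 : ℕ) : ℂ) =2 * m +1 := by exact_mod_cast hm
    have hm0 : (m : ℂ) +1 ≠0 := by norm_cast
    rw [h]
    have : ((m : ℂ) +1) * (m +1) * wv (a +3) m * wv (a +3) m * wv (a +3) (m +1) ≠0 := by positivity
    intro h
    apply this
    push_cast at h
    linear_combination h / (-8)

lemma f1_test (a : ℕ) : ∃ C : Matrix (Fin (a +4)) (Fin 3) ℂ, f1 C ≠0 := by
  refine ⟨Matrix.of fun i j => ![ub (a +3) 0 i, ub _ (a +3) i,0] j, ?_⟩
  change om (a +3) (ub _ 0) (ub _ (a +3)) ≠0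
  rw [omE (by omega)]; exact wv_ne (by omega)

lemma frameA (ha : 3 ≤ a) (C : Matrix (FS a) (Fin 3) K) (hC : AI (ent C)) (σ : GG → AE K) (l : GG → K)
    (h : ∀ γ, C.map (σ γ) = l γ • (rep a (ic K γ.1) * C)) :
    ∃ E : M3 K, E.det ≠0 ∧ EM (adj (Set.range (ent C))) E ∧ ∀ γ, E.map (σ γ) = rep 2 (ic K γ.1) * E := by
  obtain ⟨a, rfl⟩ := Nat.exists_eq_add_of_le' ha
  have hCL : EM (adj (Set.range (ent C))) C := fun i j => maO ⟨(i, j), rfl⟩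
  have hcol : ∀ γ j, σ γ ∘ C.col j = l γ • (rep _ (ic K γ.1) *ᵥ C.col j) := by
    intro γ j; funext i
    exact congrFun (congrFun (h γ) i) j
  have mm : ∀ {R S : Type} [CommRing R] [Algebra ℂ R] [CommRing S] [Algebra ℂ S] (f : R →ₐ[ℂ] S) (C : Matrix (Fin (a +4)) (Fin 3) R) (i j),
      (vecMulVec (C.col i) (C.col j) * Om (a +3)).map f = vecMulVec ((C.map f).col i) ((C.map f).col j) * Om (a +3) := by
    intro R S _ _ _ _ f C i j
    rw [mapmul, Om_map]
    congr 1; ext i j; simp [vecMulVec_apply]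
  have hd : (Matrix.of (ff C)).det ≠0 := by
    obtain ⟨C0, h0⟩ := ff_test a
    refine specM (fun R _ _ C => (Matrix.of (ff C)).det) ?_ hC C0 h0
    intro R _ _ S _ _ f M
    rw [det_map']
    congr 1
    ext i j
    have := congrFun (pi2_map (a +3) (vecMulVec (M.col (![0,0,1] i)) (M.col (![1,2,2] i)) * Om _) (f : R →+* S)) j
    refine this.trans ?_
    exact congrFun (congrArg (pi2 (a +3)) (mm f M _ _)) j
  have h1 : f1 C ≠0 := by
    obtain ⟨C0, h0⟩ := f1_test a
    refine specM (fun R _ _ C => f1 C) ?_ hC C0 h0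
    intro R _ _ S _ _ f M
    simp only [f1, dotProduct, mulVec, map_sum, map_mul]
    refine Finset.sum_congr rfl fun i _ => congrArg (fun v => f (M i 0) * v) (Finset.sum_congr rfl fun j _ => ?_)
    rw [← map_apply (f := f) (M := (Om (a +3) : Matrix _ _ R)), Om_map]; rfl
  refine frame_of (fun γ => (σ γ : K →+* K)) (fun γ => ic K γ.1) _ (ff C) (fun _ => f1 C) (fun γ _ => l γ * l γ) (fun _ => h1) (fun _ => ?_) ?_ hd ?_ ?_
  · rw [f1, dotProduct]; exact sum_mem fun i _ => mul_mem (hCL i 0) (EM.mulVec EM.Om (fun j => hCL j 1) i)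
  · intro j i
    have hZ : ∀ k, EM (adj (Set.range (ent C))) (Xk (a +3) k * (vecMulVec (C.col (![0,0,1] j)) (C.col (![1,2,2] j)) * Om (a +3))) := by
      intro k
      refine EM.mul (fun i j => ?_) (EM.mul (fun i' j' => mul_mem (hCL i' _) (hCL j' _)) EM.Om)
      have := congrFun (congrFun (Xk_map (a +3) k (aM K)) i) j
      rw [← this]; exact IntermediateField.algebraMap_mem _ _
    have ht : ∀ k, trace (Xk (a +3) k * (vecMulVec (C.col (![0,0,1] j)) (C.col (![1,2,2] j)) * Om (a +3))) ∈ adj (Set.range (ent C)) :=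
      fun k => sum_mem fun i _ => hZ k i i
    fin_cases i
    · exact ht 2
    · refine mul_mem ?_ (ht 1)
      have : (-2 : K) = aM K (-2) := by rw [map_neg, map_ofNat]
      rw [this]; exact IntermediateField.algebraMap_mem _ _
    · exact ht 0
  · intro γ j
    refine CovM.pi2 (icD _) ?_
    change (vecMulVec (C.col (![0,0,1] j)) (C.col (![1,2,2] j)) * (Om (a +3) : Matrix _ _ K)).map (σ γ) * _ = _
    have e : ∀ i j, vecMulVec ((C.map (σ γ)).col i) ((C.map (σ γ)).col j) =
        (l γ * l γ) • (rep (a +3) (ic K γ.1) * vecMulVec (C.col i) (C.col j) * (rep (a +3) (ic K γ.1))ᵀ) := by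
      intro i j
      rw [mul_vecMulVec, vecMulVec_mul, vecMul_transpose]
      have e1 : (C.map (σ γ)).col i = l γ • (rep _ (ic K γ.1) *ᵥ C.col i) := hcol γ i
      have e2 : (C.map (σ γ)).col j = l γ • (rep _ (ic K γ.1) *ᵥ C.col j) := hcol γ j
      rw [e1, e2, smul_vecMulVec, vecMulVec_smul, smul_smul]
    rw [mm, e]
    have h7 := rep_Om (a +3) (icD (K := K) γ.1)
    simp only [Matrix.smul_mul, Matrix.mul_assoc] at h7 ⊢
    rw [h7]
  · intro γ _
    have h7 := rep_Om (a +3) (icD (K := K) γ.1)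
    have e : σ γ (f1 C) = (σ γ ∘ C.col 0) ⬝ᵥ ((Om (a +3) : Matrix _ _ K) *ᵥ (σ γ ∘ C.col 1)) := by
      have := map_mulVec' (σ γ : K →+* K) (Om (a +3) : Matrix _ _ K) (C.col 1)
      have o := Om_map (a +3) (σ γ)
      change _ = (Om (a +3) : Matrix _ _ K).map (σ γ) *ᵥ (σ γ ∘ C.col 1) at this
      rw [o] at this
      rw [← this]
      simp only [f1, dotProduct, map_sum, map_mul]
      rfl
    refine e.trans ?_
    rw [hcol, hcol, mulVec_smul, smul_dotProduct, dotProduct_smul, smul_smul, f1]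
    refine congrArg (fun v => l γ * l γ * v) ?_
    rw [dotProduct_mulVec, dotProduct_mulVec, ← vecMul_transpose, vecMul_vecMul, vecMul_vecMul, ← Matrix.mul_assoc, h7, dotProduct_mulVec]
end

section
variable {K : Type} [Field K] [Algebra ℂ K] {a b : ℕ}

/-- target -/
def MC (a b : ℕ) (σ : GG → AE K) : Prop :=
  ∃ (u : FS b → K) (m : GG → K), u 0 =1 ∧ AI (fun i : Fin b => u i.succ) ∧
    (∀ γ, σ γ ∘ u = m γ • (rep b (ic K γ.2.1) *ᵥ u)) ∧ Concl σ (AR u) (a * (b +1) -3)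

lemma ind_of {M : MM a b K}
    (hM : AI (ent M)) (hMt : adj (Set.range (ent M)) = ⊤) {u : FS b → K} (hu0 : u 0 =1)
    {κ : Type} [Fintype κ] (x : κ → K) (hx : ∀ L' : IF K, (∀ i, u i ∈ L') → (∀ i, x i ∈ L') → L' = ⊤)
    (hc : b + Fintype.card κ = (a +1) * (b +1)) :
    AlgebraicIndependent ↥(AR u) x ∧ AI x := by
  have hu : ∀ (L' : IF K), (∀ i : Fin b, u i.succ ∈ L') → ∀ i, u i ∈ L' := by
    intro L' h i; refine Fin.cases ?_ (fun i => h i) i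
    rw [hu0]; exact one_mem _
  have h := count (Sum.elim (fun i : Fin b => u i.succ) x) (ent M) hM hMt
    (hx _ (hu _ fun i => maO ⟨Sum.inl i, rfl⟩) fun i => maO ⟨Sum.inr i, rfl⟩)
    (by simp only [Fintype.card_sum, Fintype.card_fin, Fintype.card_prod, hc])
  exact ⟨indep_sub (adL (hu _ fun i => maO (Set.mem_range_self (f := fun i : Fin b => u i.succ) i))) (indep_over h), h.comp Sum.inr Sum.inr_injective⟩

section
variable {σ : GG → AE K} {χ : GG → K} {c : FS a → K} {ω ρ : Type} [Fintype ρ] {w : ω → K}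
    {u : FS b → K} {f0 : K} {z : ρ → K} {μ : GG → K}

lemma S3.pack (h : S3 a σ χ c w u f0 z μ) : (∀ γ, ∀ k ∈ AR u, σ γ k ∈ AR u) ∧
    (∀ γ : GG, γ.2.1 =1 → ∀ k ∈ AR u, σ γ k = k) ∧ (∀ γ, μ γ ∈ AR u) ∧
    (∀ γ : GG, γ.2.1 =1 → μ γ =1) := by
  have hu : ∀ i, u i ∈ AR u := fun i => maO ⟨i, rfl⟩
  have h3 : ∀ γ, μ γ ∈ AR u := fun γ => by rw [h.hμ]; exact rep2_mem _ _ hu _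
  have h5 : ∀ γ : GG, γ.2.1 =1 → rep b (ic K γ.2.1) =1 := fun γ hγ => by
    rw [hγ, ← repO]; congr 1
    exact Matrix.map_one _ (map_zero _) (map_one _)
  have h4 : ∀ γ : GG, γ.2.1 =1 → μ γ =1 := fun γ hγ => by
    rw [h.hμ, h5 γ hγ, one_mulVec, h.u0]
  refine ⟨fun γ => ?_, fun γ hγ => fix_adj _ _ fun i => ?_, h3, h4⟩
  · have : AR u ≤ (AR u).comap (σ γ) := adL fun i => by
      change (σ γ ∘ u) i ∈ AR u
      rw [congrFun (h.us γ) i]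
      exact mul_mem (inv_mem (h3 γ)) (rep2_mem _ _ hu i)
    exact this
  · change (σ γ ∘ u) i = _
    rw [congrFun (h.us γ) i, h4 γ hγ, h5 γ hγ, one_mulVec, inv_one, one_smul]

lemma S3.even (h : S3 a σ χ c w u f0 z μ) (ha : 1 < a) {M : MM a b K}
    (hM : AI (ent M)) (hMt : adj (Set.range (ent M)) = ⊤) {τ : Type} [Fintype τ]
    (e e' : Fin 3 → K) (ξ : K) (T : τ → K)
    (hx : ∀ L' : IF K, (∀ i, u i ∈ L') → (∀ i, e i ∈ L') → (∀ i, e' i ∈ L') → ξ ∈ L' → (∀ i, T i ∈ L') → L' = ⊤)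
    (he : ∀ γ, σ γ ∘ e = rep 2 (ic K γ.1) *ᵥ e) (he' : ∀ γ, σ γ ∘ e' = rep 2 (ic K γ.1) *ᵥ e')
    (hξ : ∀ γ, σ γ ξ = aM K (γ.2.2 : ℂ) * μ γ * ξ)
    (hT : ∀ i, T i ∈ Fx σ) (hc : Fintype.card τ +6 = a * (b +1)) : MC a b σ := by
  obtain ⟨h1, h2, h3, h4⟩ := h.pack
  have hx' : ∀ L' : IF K, (∀ i, u i ∈ L') → (∀ i, Sum.elim (Sum.elim (Sum.elim e e') (fun _ : Unit => ξ)) T i ∈ L') → L' = ⊤ :=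
    fun L' h5 h6 => hx L' h5 (fun i => h6 (Sum.inl (Sum.inl (Sum.inl i)))) (fun i => h6 (Sum.inl (Sum.inl (Sum.inr i))))
      (h6 (Sum.inl (Sum.inr ()))) (fun i => h6 (Sum.inr i))
  refine ⟨u, _, h.u0, h.ind, h.us, ?_⟩
  rw [show a * (b +1) -3 =3 + Fintype.card τ by omega]
  exact even_finish σ _ h1 h2 e e' ξ T (ind_of hM hMt h.u0 _ hx' (by
      simp only [Fintype.card_sum, Fintype.card_fin, Fintype.card_unit]; rw [add_mul]; omega)).1
    (hx' _ (fun i => SetLike.le_def.1 le_sup_left (maO (Set.mem_range_self i))) (msr _)) he he' _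
    (fun γ => mul_mem (IntermediateField.algebraMap_mem _ _) (h3 γ)) (fun γ hγ => by rw [h4 γ hγ, mul_one]) hξ hT

lemma S3.odd (h : S3 a σ χ c w u f0 z μ) (ha : 1 < a) {M : MM a b K}
    (hM : AI (ent M)) (hMt : adj (Set.range (ent M)) = ⊤) {τ : Type} [Fintype τ]
    (P : M2 K) (T : τ → K)
    (hx : ∀ L' : IF K, (∀ i, u i ∈ L') → EM L' P → (∀ i, T i ∈ L') → L' = ⊤)
    (hP : P.det ≠0) (he : ∀ γ, P.map (σ γ) = aM K (γ.2.2 : ℂ) • (rep 1 (ic K γ.1) * P))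
    (hT : ∀ i, T i ∈ Fx σ) (hc : Fintype.card τ +3 = a * (b +1)) : MC a b σ := by
  obtain ⟨h1, h2, h3, h4⟩ := h.pack
  have hx' : ∀ L' : IF K, (∀ i, u i ∈ L') → (∀ i, Sum.elim (fun p : Fin 2 × Fin 2 => P p.1 p.2) T i ∈ L') → L' = ⊤ :=
    fun L' h5 h6 => hx L' h5 (fun i j => h6 (Sum.inl (i, j))) (fun i => h6 (Sum.inr i))
  refine ⟨u, _, h.u0, h.ind, h.us, ?_⟩
  rw [show a * (b +1) -3 = Fintype.card τ by omega]
  exact odd_finish σ _ h1 h2 P T hP (ind_of hM hMt h.u0 _ hx' (by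
      simp only [Fintype.card_sum, Fintype.card_fin, Fintype.card_prod]; rw [add_mul]; omega)).1
    (hx' _ (fun i => SetLike.le_def.1 le_sup_left (maO (Set.mem_range_self i))) (msr _)) he hT
end

lemma quot_map {m n : Type*} [Fintype m] [DecidableEq m] (f : AE K) {A W : Matrix m m K} {Y : Matrix m n K} {l l' : K}
    (hW : W.det ≠0) (hA : A.det ≠0) (hl : l ≠0) (h1 : W.map f = l • (A * W)) (h2 : Y.map f = l' • (A * Y)) :
    (W⁻¹ * Y).map f = (l⁻¹ * l') • (W⁻¹ * Y) := by
  have h3 : (A * W) * (W⁻¹ * Y).map f = (A * W) * ((l⁻¹ * l') • (W⁻¹ * Y)) := by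
    rw [Matrix.mul_smul, Matrix.mul_assoc A W (W⁻¹ * Y), mul_nonsing_inv_cancel_left _ _ (ndU hW), ← smul_smul, ← h2]
    have : A * W = l⁻¹ • W.map f := by rw [h1, smul_smul, inv_mul_cancel₀ hl, one_smul]
    rw [this, Matrix.smul_mul, ← mapmul, mul_nonsing_inv_cancel_left _ _ (ndU hW)]
  have h4 := congrArg (fun Z => (A * W)⁻¹ * Z) h3
  have h5 : IsUnit (A * W).det := ndU (by rw [det_mul]; exact mul_ne_zero hA hW)
  simpa only [nonsing_inv_mul_cancel_left _ _ h5] using h4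

/-- frame -/
def brW {R : Type*} [CommRing R] (e e' : Fin 3 → R) : M3 R := Matrix.of fun i => ![e i, e' i, br e e' i]

lemma brW_ne {e e' : Fin 3 → K} (h : AI (Sum.elim e e')) : (brW e e').det ≠0 := by
  have := spec (fun R _ _ x => (brW (fun i => x (Sum.inl i)) (fun i => x (Sum.inr i)) : Matrix _ _ R).det) ?_ h
    (Sum.elim ![1,0,0] ![0,0,1]) ?_
  · exact this
  · intro R _ _ S _ _ f x
    rw [det_map']; congr 1
    ext i j
    have := congrFun (br_map (f : R →+* S) (fun i => x (Sum.inl i)) (fun i => x (Sum.inr i))) i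
    fin_cases j
    · rfl
    · rfl
    · exact this
  · simp [brW, det_fin_three, br]

lemma brW_mem {L' : IF K} {e e' : Fin 3 → K} (h3 : ∀ i, e i ∈ L') (h4 : ∀ i, e' i ∈ L') : EM L' (brW e e') := by
  intro i j
  fin_cases j
  · exact h3 i
  · exact h4 i
  · have h2 : (2 : K) ∈ L' := ofNat_mem L' 2
    change br e e' i ∈ L'
    fin_cases i <;> simp only [br]
    · exact sub_mem (mul_mem (h3 1) (h4 0)) (mul_mem (h3 0) (h4 1))
    · exact mul_mem h2 (sub_mem (mul_mem (h3 2) (h4 0)) (mul_mem (h3 0) (h4 2)))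
    · exact sub_mem (mul_mem (h3 2) (h4 1)) (mul_mem (h3 1) (h4 2))
end

section
variable {K : Type} [Field K] [Algebra ℂ K] {a b : ℕ}

lemma case2 (hb : 4 < b) (M : MM 2 b K)
    (hM : AI (ent M)) (hMt : adj (Set.range (ent M)) = ⊤) (σ : GG → AE K)
    (hσ : ∀ γ : GG, M.map (σ γ) = aM K γ.2.2 • (rep 2 (ic K γ.1) * M * (rep b (ic K γ.2.1))ᵀ)) : MC 2 b σ := by
  obtain ⟨B, F, Q, χ, hMBF, hBd, hFQ, hB, hBσ, hF, hχ, hχ1, -, hL⟩ := step1b one_lt_two (by omega) hb (by simp) M hM hMt σ hσ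
  set l : GG → K := fun γ => aM K γ.2.2 * χ γ with hl
  have hl0 : ∀ γ, l γ ≠0 := fun γ => mul_ne_zero (by simp) (hχ γ)
  have hcol : ∀ γ j, σ γ ∘ B.col j = l γ • (rep 2 (ic K γ.1) *ᵥ B.col j) := by
    intro γ j; funext i
    exact congrFun (congrFun (hBσ γ) i) j
  set W := brW (B.col 0) (B.col 1) with hW
  have hWd : W.det ≠0 := by
    have := hB.comp (Sum.elim (fun i => (i,0)) (fun i => (i,1))) (by
      clear * -
      decide)
    apply brW_ne
    convert this using 1
    funext i; rcases i with i | i <;> rfl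
  set y := W⁻¹ *ᵥ B.col 2 with hy
  have hWy : W *ᵥ y = B.col 2 := by rw [hy, mulVec_mulVec, mul_nonsing_inv _ (ndU hWd), one_mulVec]
  have hyσ : ∀ γ, σ γ (y 0) = y 0 ∧ σ γ (y 1) = y 1 ∧ l γ * σ γ (y 2) = y 2 := by
    intro γ
    set A := rep 2 (ic K γ.1) with hA
    have hAu : IsUnit A.det := rdU 2 (icD _)
    have h1 : W.map (σ γ) = A * (W * diagonal ![l γ, l γ, l γ * l γ]) := by
      have h3 := CovV.br (σ := (σ γ : K →+* K)) (icD γ.1) (hcol γ 0) (hcol γ 1)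
      ext i j
      rw [← Matrix.mul_assoc, mul_diagonal]
      fin_cases j
      · exact (congrFun (hcol γ 0) i).trans (mul_comm _ _)
      · exact (congrFun (hcol γ 1) i).trans (mul_comm _ _)
      · exact (congrFun h3 i).trans (mul_comm _ _)
    have h2 : W.map (σ γ) *ᵥ (σ γ ∘ y) = l γ • (A *ᵥ B.col 2) := by
      rw [← hcol, ← hWy]; exact (map_mulVec' (σ γ : K →+* K) _ _).symm
    rw [h1, ← hWy, ← mulVec_mulVec, ← mulVec_mulVec, ← mulVec_smul, ← mulVec_smul] at h2
    have h4 := congrArg (fun v => W⁻¹ *ᵥ (A⁻¹ *ᵥ v)) h2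
    simp only [mulVec_mulVec, nonsing_inv_mul_cancel_left _ _ hAu, nonsing_inv_mul_cancel_left _ _ (ndU hWd), 
      nonsing_inv_mul _ hAu, nonsing_inv_mul _ (ndU hWd), one_mulVec, Matrix.mul_assoc] at h4
    have h5 : ∀ i, (![l γ, l γ, l γ * l γ] : Fin 3 → K) i * σ γ (y i) = l γ * y i := fun i => by
      have := congrFun h4 i
      rw [mulVec_diagonal] at this
      exact this
    exact ⟨mul_left_cancel₀ (hl0 γ) (h5 0), mul_left_cancel₀ (hl0 γ) (h5 1), mul_left_cancel₀ (hl0 γ) (by rw [← mul_assoc]; exact h5 2)⟩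
  have hy2 : y 2 ≠0 := by
    intro h
    apply hBd
    rw [← exists_mulVec_eq_zero_iff]
    refine ⟨![y 0, y 1, -1], fun h => by simpa using congrFun h 2, ?_⟩
    funext i
    have := congrFun hWy i
    simp [mulVec, dotProduct, Fin.sum_univ_three, h, hW, brW] at this ⊢
    linear_combination this
  have hw : ∀ L' : IF K, (∀ i, (![y 0, y 1,1] : Fin 3 → K) i ∈ L') → (∀ i, Sum.elim (ent (B.submatrix id ![0,1])) (fun _ : Unit => y 2) i ∈ L') → EM L' B := by
    intro L' h1 h2
    have h3 : ∀ i, B.col 0 i ∈ L' := fun i => h2 (Sum.inl (i,0))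
    have h4 : ∀ i, B.col 1 i ∈ L' := fun i => h2 (Sum.inl (i,1))
    have h5 : EM L' W := brW_mem h3 h4
    have h6 : ∀ i, y i ∈ L' := by
      intro i; fin_cases i
      · exact h1 0
      · exact h1 1
      · exact h2 (Sum.inr ())
    intro i j; fin_cases j
    · exact h3 i
    · exact h4 i
    · have := EM.mulVec h5 h6 i
      rwa [hWy] at this
  have hfx : ∀ i, (![y 0, y 1,1] : Fin 3 → K) i ∈ Fx σ := by
    intro i; fin_cases i
    · exact (mFx σ).2 fun γ => (hyσ γ).1
    · exact (mFx σ).2 fun γ => (hyσ γ).2.1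
    · exact one_mem _
  obtain ⟨ρ, _, u, f0, z, μ, h⟩ := step3 (by omega) hb M hM hMt σ B F Q χ hMBF hFQ hF hχ hL _ hfx 2 rfl _ (by simp) hw
  have hyl : ∀ γ, σ γ (y 2) = (l γ)⁻¹ * y 2 := fun γ => by
    rw [eq_inv_mul_iff_mul_eq₀ (hl0 γ), (hyσ γ).2.2]
  have hcov : ∀ γ j, σ γ ∘ (y 2 • B.col j) = rep 2 (ic K γ.1) *ᵥ (y 2 • B.col j) := by
    intro γ j
    have : σ γ ∘ (y 2 • B.col j) = σ γ (y 2) • (σ γ ∘ B.col j) := by funext i; simp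
    rw [this, hcol, hyl, mulVec_smul, smul_smul]
    congr 1
    have := hl0 γ
    field_simp
  refine h.even one_lt_two hM hMt (y 2 • B.col 0) (y 2 • B.col 1) ((y 2)⁻¹ * f0) z ?_ (fun γ => hcov γ 0) (fun γ => hcov γ 1) ?_ h.zs ?_
  · intro L' h1 h2 h3 h4 h5
    obtain ⟨h6, -, h7⟩ := h.gen L' h1 h5
    have h8 : y 2 ∈ L' := by
      have := div_mem h6 h4
      rwa [div_eq_mul_inv, mul_inv, inv_inv, mul_comm, mul_assoc, inv_mul_cancel₀ h.f00, mul_one] at this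
    have h9 : ∀ k, y 2 * k ∈ L' → k ∈ L' := fun k hk => by
      have := mul_mem (inv_mem h8) hk
      rwa [inv_mul_cancel_left₀ hy2] at this
    refine h7 ?_
    rintro (⟨i, j⟩ | _)
    · fin_cases j
      · exact h9 _ (h2 i)
      · exact h9 _ (h3 i)
    · exact h8
  · intro γ
    rw [map_mul, map_inv₀, hyl, h.fs, mul_inv, inv_inv]
    have := hχ γ
    simp only [hl]
    field_simp
  · rw [h.card]; omega
end

section
variable {K : Type} [Field K] [Algebra ℂ K] {a b : ℕ}

lemma setup3 (ha : 3 ≤ a) (hab : a < b) (hb : 4 < b) (hev : Even (a * b)) (M : MM a b K)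
    (hM : AI (ent M)) (hMt : adj (Set.range (ent M)) = ⊤) (σ : GG → AE K)
    (hσ : ∀ γ : GG, M.map (σ γ) = aM K γ.2.2 • (rep a (ic K γ.1) * M * (rep b (ic K γ.2.1))ᵀ))
    (κ : Type) [Fintype κ] (hκ : Fintype.card κ ≤6) :
    ∃ (χ μ : GG → K) (u : FS b → K) (f0 : K) (C : Matrix (FS a) (Fin 3) K) (m : ℕ) (x1 : κ → K) (x2 : Fin m → K)
      (ω ρ : Type) (_ : Fintype ρ) (c : FS a → K) (w : ω → K) (z : ρ → K), S3 a σ χ c w u f0 z μ ∧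
      (∀ γ, C.map (σ γ) = (aM K γ.2.2 * χ γ) • (rep a (ic K γ.1) * C)) ∧ (∀ γ, χ γ ≠0) ∧ (Even b → ∀ γ, χ γ =1) ∧
      (∀ i, x1 i ∈ Fx σ) ∧ (∀ i, x2 i ∈ Fx σ) ∧ Fintype.card κ + m +2 * a +2 = a * b ∧
      ∀ L' : IF K, (∀ i, u i ∈ L') → (∀ i, x1 i ∈ L') → (∀ i, x2 i ∈ L') → f0 ∈ L' ∧ (EM L' C → L' = ⊤) := by
  obtain ⟨B, F, Q, χ, hMBF, hBd, hFQ, hB, hBσ, hF, hχ, hχ1, hχe, hL⟩ := step1b (by omega) hab hb hev M hM hMt σ hσ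
  obtain ⟨n, rfl⟩ := Nat.exists_eq_add_of_le' ha
  set l : GG → K := fun γ => aM K γ.2.2 * χ γ with hl
  have hl0 : ∀ γ, l γ ≠0 := fun γ => mul_ne_zero (by simp) (hχ γ)
  set C := B.submatrix id (Fin.castLE (by omega) : Fin 3 → Fin (n +3 +1)) with hC
  have hinj : Function.Injective (fun p : Fin (n +3 +1) × Fin 3 => (p.1, (Fin.castLE (by omega) p.2 : Fin (n +3 +1)))) := by
    rintro ⟨i, j⟩ ⟨i', j'⟩ h
    simpa using h
  have hCi : AI (ent C) := by
    have h := hB.comp _ hinj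
    exact h
  have hCσ : ∀ γ, C.map (σ γ) = l γ • (rep _ (ic K γ.1) * C) := by
    intro γ; ext i j
    exact congrFun (congrFun (hBσ γ) i) (Fin.castLE (by omega) j)
  obtain ⟨E, hE, hEL, hEσ⟩ := frameA ha C hCi σ l hCσ
  obtain ⟨W, hW, hWL, hWσ, -⟩ := V2FL (fun γ => (σ γ : K →+* K)) (fun γ => ic K γ.1) (fun γ => icD _) _ E hE hEL hEσ
    (C.col 0) (fun h => hCi.ne_zero (0,0) (congrFun h 0)) (fun i => maO ⟨(i,0), rfl⟩) l
    (fun γ => funext fun i => congrFun (congrFun (hCσ γ) i) 0)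
  set Y := W⁻¹ * B with hY
  have hYσ : ∀ i j, Y i j ∈ Fx σ := fun i j => (mFx σ).2 fun γ => by
    have := quot_map (σ γ) hW (rdU _ (icD γ.1)).ne_zero (hl0 γ) (hWσ γ) (hBσ γ)
    rw [inv_mul_cancel₀ (hl0 γ), one_smul] at this
    exact congrFun (congrFun this i) j
  have hWY : W * Y = B := mul_nonsing_inv_cancel_left _ _ (ndU hW)
  have hYd : Y.det ≠0 := by
    rw [← hWY, det_mul] at hBd; exact right_ne_zero_of_mul hBd
  let j3 : Fin (n +3 +1) := ⟨3, by omega⟩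
  obtain ⟨i0, hi0⟩ : ∃ i, Y i j3 ≠0 := by
    by_contra! h
    exact hYd (det_eq_zero_of_column_eq_zero j3 h)
  let w2 : Unit ⊕ (Fin (n +3 +1) × Fin n) → K := Sum.elim (fun _ => Y i0 j3) (fun p => Y p.1 ⟨p.2 +4, by omega⟩)
  have hw : ∀ L' : IF K, (∀ i, Y i j3 / Y i0 j3 ∈ L') → (∀ i, Sum.elim (ent C) w2 i ∈ L') → EM L' B := by
    intro L' h1 h2
    have h3 : ∀ i (j : Fin (n +3 +1)),3 ≤ j.1 → Y i j ∈ L' := by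
      intro i j hj
      rcases hj.eq_or_lt with h | h
      · obtain rfl : j = j3 := Fin.ext h.symm
        have := mul_mem (h1 i) (h2 (Sum.inr (Sum.inl ())))
        rwa [show Sum.elim (ent C) w2 (Sum.inr (Sum.inl ())) = Y i0 j3 from rfl, div_mul_cancel₀ _ hi0] at this
      · have := h2 (Sum.inr (Sum.inr (i, ⟨j.1 -4, by omega⟩)))
        convert this using 1
        change _ = Y i _
        congr 1; apply Fin.ext; dsimp only; omega
    have h4 : EM L' W := fun i j => adL (fun p => h2 (Sum.inl p)) (hWL i j)
    intro i j
    by_cases hj : j.1 <3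
    · exact h2 (Sum.inl (i, ⟨j, hj⟩))
    · rw [← hWY, Matrix.mul_apply]
      exact sum_mem fun k _ => L'.mul_mem (h4 i k) (h3 k j (by omega))
  obtain ⟨ρ, _, u, f0, z, μ, h⟩ := step3 hab hb M hM hMt σ B F Q χ hMBF hFQ hF hχ hL _
    (fun i => div_mem (hYσ i j3) (hYσ i0 j3)) i0 (div_self hi0) _ (by
      simp only [Fintype.card_sum, Fintype.card_fin, Fintype.card_prod, Fintype.card_unit]; ring) hw
  have hcard : Fintype.card (ρ ⊕ (Unit ⊕ (Fin (n +3 +1) × Fin n))) +2 * (n +3) +2 = (n +3) * b := by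
    simp only [Fintype.card_sum, Fintype.card_fin, Fintype.card_prod, Fintype.card_unit, h.card]
    obtain ⟨d, rfl⟩ := Nat.exists_eq_add_of_lt hab
    rw [show n +3 + d +1 - (n +3) = d +1 by omega]; ring
  obtain ⟨m, hm⟩ : ∃ m, Fintype.card (ρ ⊕ (Unit ⊕ (Fin (n +3 +1) × Fin n))) = Fintype.card κ + m := by
    apply Nat.exists_eq_add_of_le
    have : 3 * (b -2) ≤ (n +3) * (b -2) := Nat.mul_le_mul_right _ (by omega)
    rw [Nat.mul_sub (n +3)] at this
    omega
  let e : κ ⊕ Fin m ≃ ρ ⊕ (Unit ⊕ (Fin (n +3 +1) × Fin n)) := Fintype.equivOfCardEq (by rw [hm]; simp)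
  have hm' : Fintype.card κ + m +2 * (n +3) +2 = (n +3) * b := by rw [← hm]; exact hcard
  clear_value e
  have hfx : ∀ i, Sum.elim z w2 i ∈ Fx σ := by
    rintro (i | i | i)
    exacts [h.zs i, hYσ _ _, hYσ _ _]
  refine ⟨χ, μ, u, f0, C, m, fun i => Sum.elim z w2 (e (Sum.inl i)), fun i => Sum.elim z w2 (e (Sum.inr i)), _, ρ, ‹_›, _, _, z, h,
    hCσ, hχ, hχe, fun i => hfx (e (Sum.inl i)), fun i => hfx (e (Sum.inr i)), hm', ?_⟩
  intro L' h1 h2 h3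
  have h4 : ∀ i, Sum.elim z w2 i ∈ L' := by
    intro i
    obtain ⟨j, rfl⟩ := e.surjective i
    rcases j with j | j
    exacts [h2 j, h3 j]
  obtain ⟨h5, -, h6⟩ := h.gen L' h1 fun i => h4 (Sum.inl i)
  refine ⟨h5, fun h7 => h6 ?_⟩
  rintro (⟨i, j⟩ | i)
  exacts [h7 i j, h4 (Sum.inr i)]
end

section
variable {K : Type} [Field K] [Algebra ℂ K] {a b : ℕ}

lemma caseEven (ha : 3 ≤ a) (hae : Even a) (hab : a < b) (hb : 4 < b) (M : MM a b K)
    (hM : AI (ent M)) (hMt : adj (Set.range (ent M)) = ⊤) (σ : GG → AE K)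
    (hσ : ∀ γ : GG, M.map (σ γ) = aM K γ.2.2 • (rep a (ic K γ.1) * M * (rep b (ic K γ.2.1))ᵀ)) : MC a b σ := by
  obtain ⟨χ, μ, u, f0, C0, m, x1, x2, ω, ρ, _, c, w, z, hS, hC0, hχ, -, hx1, hx2, hm, hgen⟩ := setup3 ha hab hb (hae.mul_right b) M hM hMt σ hσ
    (Fin 3 ⊕ Fin 3) (by simp)
  rw [Fintype.card_sum, Fintype.card_fin] at hm
  have har : (a +1) * (b +1) = a * b + a + b +1 := by ring
  obtain ⟨C, hCd⟩ : ∃ C, C = f0 • C0 := ⟨_, rfl⟩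
  have hC : ∀ γ, C.map (σ γ) = (aM K γ.2.2 * μ γ) • (rep a (ic K γ.1) * C) := by
    intro γ
    rw [hCd, smap, hC0, hS.fs, Matrix.mul_smul, smul_smul, smul_smul]
    refine congrArg (fun v => v • _) ?_
    have := hχ γ
    field_simp
  have hg : ∀ L' : IF K, (∀ i, u i ∈ L') → (∀ i, x1 i ∈ L') → (∀ i, x2 i ∈ L') → EM L' C → L' = ⊤ := by
    intro L' h1 h2 h3 h4
    obtain ⟨h5, h6⟩ := hgen L' h1 h2 h3
    refine h6 fun i j => ?_
    have := L'.mul_mem (inv_mem h5) (h4 i j)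
    rwa [hCd, Matrix.smul_apply, smul_eq_mul, inv_mul_cancel_left₀ hS.f00] at this
  clear hgen hC0
  have hCi : AI (ent C) := by
    have h := (ind_of hM hMt hS.u0 (Sum.elim (Sum.elim x1 x2) (ent C)) (fun L' h1 h2 => hg L' h1 (fun i => h2 (Sum.inl (Sum.inl i)))
      (fun i => h2 (Sum.inl (Sum.inr i))) (fun i j => h2 (Sum.inr (i, j)))) (by
        simp only [Fintype.card_sum, Fintype.card_fin, Fintype.card_prod]; rw [har]; omega)).2
    have h2 := h.comp Sum.inr Sum.inr_injective
    exact h2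
  obtain ⟨E, hE, hEL, hEσ⟩ := frameA ha C hCi σ (fun γ => aM K γ.2.2 * μ γ) hC
  have hEC : ∀ L' : IF K, EM L' C → EM L' E := fun L' h i j => adL (x := ent C) (fun p => h p.1 p.2) (hEL i j)
  have hfix : ∀ (v : Fin 3 → K), (∀ i, v i ∈ Fx σ) → ∀ γ, σ γ ∘ (E *ᵥ v) = rep 2 (ic K γ.1) *ᵥ (E *ᵥ v) := by
    intro v hv γ
    have h1 : σ γ ∘ v = v := funext fun i => (mFx σ).1 (hv i) γ
    have h2 := map_mulVec' (σ γ : K →+* K) E v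
    rw [mulVec_mulVec, ← hEσ]
    exact h2.trans (congrArg (fun w => E.map (σ γ) *ᵥ w) h1)
  have hback : ∀ (L' : IF K), EM L' E → ∀ v : Fin 3 → K, (∀ i, (E *ᵥ v) i ∈ L') → ∀ i, v i ∈ L' := by
    intro L' h1 v h2 i
    have := EM.mulVec (EM.inv h1) h2 i
    rwa [mulVec_mulVec, nonsing_inv_mul _ (ndU hE), one_mulVec] at this
  obtain ⟨e1, he1⟩ : ∃ e, e = E *ᵥ (fun i => x1 (Sum.inl i)) := ⟨_, rfl⟩
  obtain ⟨e2, he2⟩ : ∃ e, e = E *ᵥ (fun i => x1 (Sum.inr i)) := ⟨_, rfl⟩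
  have he1σ : ∀ γ, σ γ ∘ e1 = rep 2 (ic K γ.1) *ᵥ e1 := by rw [he1]; exact hfix _ fun i => hx1 _
  have he2σ : ∀ γ, σ γ ∘ e2 = rep 2 (ic K γ.1) *ᵥ e2 := by rw [he2]; exact hfix _ fun i => hx1 _
  have hg2 : ∀ L' : IF K, (∀ i, u i ∈ L') → (∀ i, e1 i ∈ L') → (∀ i, e2 i ∈ L') → (∀ i, x2 i ∈ L') → EM L' C → L' = ⊤ := by
    intro L' h1 h2 h3 h4 h5
    refine hg L' h1 ?_ h4 h5
    rintro (i | i)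
    · exact hback L' (hEC L' h5) (fun i => x1 (Sum.inl i)) (by rw [← he1]; exact h2) i
    · exact hback L' (hEC L' h5) (fun i => x1 (Sum.inr i)) (by rw [← he2]; exact h3) i
  have hei : AI (Sum.elim e1 e2) := by
    have h := (ind_of hM hMt hS.u0 (Sum.elim (Sum.elim e1 e2) (Sum.elim x2 (ent C))) (fun L' h1 h2 => hg2 L' h1 (fun i => h2 (Sum.inl (Sum.inl i)))
      (fun i => h2 (Sum.inl (Sum.inr i))) (fun i => h2 (Sum.inr (Sum.inl i))) (fun i j => h2 (Sum.inr (Sum.inr (i, j))))) (by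
        simp only [Fintype.card_sum, Fintype.card_fin, Fintype.card_prod]; rw [har]; omega)).2
    have h2 := h.comp Sum.inl Sum.inl_injective
    exact h2
  have hGL : EM (adj (Set.range (Sum.elim e1 e2))) (brW e1 e2) := by
    have h3 : ∀ i, e1 i ∈ adj (Set.range (Sum.elim e1 e2)) := fun i => maO ⟨Sum.inl i, rfl⟩
    have h4 : ∀ i, e2 i ∈ adj (Set.range (Sum.elim e1 e2)) := fun i => maO ⟨Sum.inr i, rfl⟩
    exact brW_mem h3 h4
  have hGσ : ∀ γ, (brW e1 e2).map (σ γ) = rep 2 (ic K γ.1) * brW e1 e2 := by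
    intro γ
    have h3 := CovV.br (σ := (σ γ : K →+* K)) (l :=1) (l' :=1) (icD γ.1) ((he1σ γ).trans (one_smul _ _).symm) ((he2σ γ).trans (one_smul _ _).symm)
    rw [CovV, one_mul, one_smul] at h3
    ext i j
    fin_cases j
    · exact congrFun (he1σ γ) i
    · exact congrFun (he2σ γ) i
    · exact congrFun h3 i
  obtain ⟨k, hk⟩ := hae
  obtain ⟨Φ, hΦ, hΦL, hΦσ, -⟩ := V2FL (fun γ => (σ γ : K →+* K)) (fun γ => ic K γ.1) (fun γ => icD _) _ _ (brW_ne hei) hGL hGσ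
    (pw a k e1) (pw_ne_zero (by omega) (fun h => hei.ne_zero (Sum.inl 0) (congrFun h 0))) 
    (pw_mem a k fun i => maO ⟨Sum.inl i, rfl⟩) (fun _ =>1)
    (fun γ => by rw [one_smul, rep_pw (by omega), pw_map, ← he1σ]; rfl)
  obtain ⟨Ξ, hΞ⟩ : ∃ Ξ, Ξ = Φ⁻¹ * C := ⟨_, rfl⟩
  have hΞσ : ∀ γ, Ξ.map (σ γ) = (aM K γ.2.2 * μ γ) • Ξ := by
    intro γ
    have := quot_map (σ γ) hΦ (rdU _ (icD γ.1)).ne_zero one_ne_zero (hΦσ γ) (hC γ)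
    rw [inv_one, one_mul, ← hΞ] at this
    exact this
  have hΦΞ : Φ * Ξ = C := by rw [hΞ]; exact mul_nonsing_inv_cancel_left _ _ (ndU hΦ)
  obtain ⟨p0, hp0⟩ : ∃ p, ent Ξ p ≠0 := by
    by_contra! h
    have h2 : Ξ =0 := by ext i j; exact h (i, j)
    rw [h2, Matrix.mul_zero] at hΦΞ
    exact hCi.ne_zero (0,0) (congrFun (congrFun hΦΞ.symm 0) 0)
  have hl0 : ∀ γ, aM K γ.2.2 * μ γ ≠0 := by
    intro γ h
    have := congrFun (congrFun (hΞσ γ) p0.1) p0.2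
    rw [h, zero_smul] at this
    exact hp0 ((map_eq_zero (σ γ)).1 this)
  refine hS.even (by omega) hM hMt e1 e2 (ent Ξ p0) (Sum.elim x2 (fun p : {p // p ≠ p0} => ent Ξ p.1 / ent Ξ p0)) ?_ he1σ he2σ
    (fun γ => congrFun (congrFun (hΞσ γ) p0.1) p0.2) ?_ ?_
  · intro L' h1 h2 h3 h4 h5
    refine hg2 L' h1 h2 h3 (fun i => h5 (Sum.inl i)) ?_
    rw [← hΦΞ]
    refine EM.mul (fun i j => adL ?_ (hΦL i j)) fun i j => ?_
    · rintro (i | i)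
      exacts [h2 i, h3 i]
    · by_cases h : (i, j) = p0
      · rw [← h] at h4; exact h4
      · have := L'.mul_mem (h5 (Sum.inr ⟨(i, j), h⟩)) h4
        change ent Ξ (i, j) / ent Ξ p0 * _ ∈ L' at this
        rwa [div_mul_cancel₀ _ hp0] at this
  · rintro (i | p)
    · exact hx2 i
    · refine (mFx σ).2 fun γ => ?_
      have h1 : ∀ p, σ γ (ent Ξ p) = (aM K γ.2.2 * μ γ) * ent Ξ p := fun p => congrFun (congrFun (hΞσ γ) p.1) p.2
      change σ γ (_ / _) = _ / _
      rw [map_div₀, h1, h1, mul_div_mul_left _ _ (hl0 γ)]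
  · rw [Fintype.card_sum, Fintype.card_subtype_compl]
    simp only [Fintype.card_sum, Fintype.card_fin, Fintype.card_prod, Fintype.card_unique]
    rw [mul_add]; omega
end

section
variable {R S : Type*} [CommRing R] [CommRing S] [Algebra ℂ R] [Algebra ℂ S]
def R2 (d : ℕ) (v : Fin (d +1 +1) → R) : Matrix (Fin 2) (FS d) R :=
  Matrix.of ![(v ᵥ* Om (d +1)) ᵥ* MX d, -((v ᵥ* Om (d +1)) ᵥ* MY d)]

lemma R2_map (d : ℕ) (f : R →ₐ[ℂ] S) (v : Fin (d +1 +1) → R) : (R2 d v).map f = R2 d (f ∘ v) := by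
  have h : ∀ {m n : Type} [Fintype m] (v : m → R) (A : Matrix m n R), f ∘ (v ᵥ* A) = (f ∘ v) ᵥ* A.map f := by
    intro m n _ v A; funext i; simp [vecMul, dotProduct]
  have h1 : f ∘ ((v ᵥ* Om (d +1)) ᵥ* MX d) = ((f ∘ v) ᵥ* Om (d +1)) ᵥ* MX d := by
    rw [h, h, Om_map]; congr 1; exact MX_map d (f : R →+* S)
  have h2 : f ∘ ((v ᵥ* Om (d +1)) ᵥ* MY d) = ((f ∘ v) ᵥ* Om (d +1)) ᵥ* MY d := by
    rw [h, h, Om_map]; congr 1; exact MY_map d (f : R →+* S)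
  ext i j
  fin_cases i
  · exact congrFun h1 j
  · exact (map_neg f _).trans (congrArg Neg.neg (congrFun h2 j))

lemma R2_smul (d : ℕ) (t : R) (v : Fin (d +1 +1) → R) : R2 d (t • v) = t • R2 d v := by
  ext i j
  fin_cases i <;> simp [R2, smul_vecMul]

lemma R2_rep (d : ℕ) {g : M2 R} (hg : g.det =1) (v : Fin (d +1 +1) → R) :
    R2 d (rep (d +1) g *ᵥ v) * rep d g = rep 1 g * R2 d v := by
  set q := v ᵥ* Om (d +1) with hq
  set q' := (rep (d +1) g *ᵥ v) ᵥ* Om (d +1) with hq'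
  have h0 : q' ᵥ* rep (d +1) g = q := by
    rw [hq', ← vecMul_transpose, vecMul_vecMul, vecMul_vecMul, ← Matrix.mul_assoc, rep_Om _ hg]
  have hX : ∀ q q' : Fin (d +1 +1) → R, q' ᵥ* rep (d +1) g = q → (q' ᵥ* MX d) ᵥ* rep d g = g 1 1 • (q ᵥ* MX d) - g 0 1 • (q ᵥ* MY d) := by
    intro q q' h0
    rw [← h0, vecMul_vecMul, vecMul_vecMul, vecMul_vecMul, rep_MX, rep_MY, ← vecMul_smul, ← vecMul_smul, ← vecMul_sub,
      ← Matrix.smul_mul, ← Matrix.smul_mul, ← Matrix.sub_mul]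
    congr 2
    rw [det_fin_two] at hg
    ext i j; simp only [Matrix.sub_apply, Matrix.smul_apply, Matrix.add_apply, smul_eq_mul]
    linear_combination (-(MX d : Matrix _ _ R) i j) * hg
  have hY : ∀ q q' : Fin (d +1 +1) → R, q' ᵥ* rep (d +1) g = q → (q' ᵥ* MY d) ᵥ* rep d g = g 0 0 • (q ᵥ* MY d) - g 1 0 • (q ᵥ* MX d) := by
    intro q q' h0
    rw [← h0, vecMul_vecMul, vecMul_vecMul, vecMul_vecMul, rep_MX, rep_MY, ← vecMul_smul, ← vecMul_smul, ← vecMul_sub,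
      ← Matrix.smul_mul, ← Matrix.smul_mul, ← Matrix.sub_mul]
    congr 2
    rw [det_fin_two] at hg
    ext i j; simp only [Matrix.sub_apply, Matrix.smul_apply, Matrix.add_apply, smul_eq_mul]
    linear_combination (-(MY d : Matrix _ _ R) i j) * hg
  rw [rep_oneD]
  ext i j
  fin_cases i
  · refine (congrFun (hX q q' h0) j).trans ?_
    simp [R2, Matrix.mul_apply, Fin.sum_univ_two, ← hq]; ring
  · have : ((-(q' ᵥ* MY d)) ᵥ* rep d g) j = -(g 0 0 • (q ᵥ* MY d) - g 1 0 • (q ᵥ* MX d)) j := by rw [neg_vecMul, hY q q' h0]; rfl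
    refine this.trans ?_
    simp [R2, Matrix.mul_apply, Fin.sum_univ_two, ← hq]; ring

def tw (P : M2 R) : M2 R := !![P 1 1, P 0 1; P 1 0, P 0 0]
lemma tw_cov (t : R) (g P : M2 R) : tw (t • (rep 1 g * P)) = t • (tw P * g) := by
  rw [rep_oneD]
  ext i j
  rw [Matrix.smul_apply, Matrix.mul_apply, Fin.sum_univ_two, smul_eq_mul]
  fin_cases i <;> fin_cases j <;> simp only [tw, of_apply, cons_val', cons_val_zero, cons_val_one, Matrix.smul_apply, Matrix.mul_apply,
    Fin.sum_univ_two, smul_eq_mul, Fin.zero_eta, Fin.mk_one, cons_val_fin_one, Fin.isValue] <;> ring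
end

section
variable {K : Type} [Field K] [Algebra ℂ K] {a b : ℕ}

lemma R2_ne {d : ℕ} (hd : 2 ≤ d) {v : Fin (d +1 +1) → K} (hv : AI v) :
    ((R2 d v).submatrix id (Fin.castLE (by omega) : Fin 2 → FS d)).det ≠0 := by
  refine spec (fun R _ _ x => ((R2 d x).submatrix id (Fin.castLE (by omega) : Fin 2 → FS d)).det) ?_ hv (Pi.single ⟨d, by omega⟩ 1) ?_
  · intro R _ _ S _ _ f x
    rw [det_map', ← submatrix_map, R2_map]
  · have hq : ∀ j, ((Pi.single ⟨d, by omega⟩ 1 : Fin (d +1 +1) → ℂ) ᵥ* Om (d +1)) j = if (j : ℕ) =1 then wv (d +1) d else 0 := by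
      intro j
      rw [single_one_vecMul]
      simp only [Om, of_apply, row_apply]
      congr 1; apply propext; constructor <;> intro h <;> omega
    have h0 : ∀ i, R2 d (Pi.single ⟨d, by omega⟩ 1 : Fin (d +1 +1) → ℂ) 0 i = if (i : ℕ) =0 then wv (d +1) d else 0 := by
      intro i
      change ∑ j : Fin (d +2), (_ ᵥ* _) j * _ = _
      simp only [hq]
      rw [Finset.sum_eq_single ⟨1, by omega⟩]
      · simp [MX]
      · intro k _ hk; rw [if_neg, zero_mul]; intro h; exact hk (Fin.ext h)
      · simp
    have h1 : ∀ i, R2 d (Pi.single ⟨d, by omega⟩ 1 : Fin (d +1 +1) → ℂ) 1 i = if (i : ℕ) =1 then -wv (d +1) d else 0 := by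
      intro i
      change -∑ j : Fin (d +2), (_ ᵥ* _) j * _ = _
      simp only [hq]
      rw [Finset.sum_eq_single ⟨1, by omega⟩]
      · by_cases h : (i : ℕ) =1
        · simp [MY, h]
        · simp [MY, h, Ne.symm h]
      · intro k _ hk; rw [if_neg, zero_mul]; intro h; exact hk (Fin.ext h)
      · simp
    rw [det_fin_two]
    simp [h0, h1]
    exact wv_ne (by omega)

lemma rep_mem {L : IF K} (d : ℕ) {g : M2 K} (hg : EM L g) : EM L (rep d g) := by
  have h : g = (Matrix.of fun i j => (⟨g i j, hg i j⟩ : L)).map (algebraMap L K) := by ext i j; rfl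
  rw [h, repM]
  exact fun i j => (rep d (Matrix.of fun i j => (⟨g i j, hg i j⟩ : L)) i j).2
end

section
variable {K : Type} [Field K] [Algebra ℂ K] {a b : ℕ}

lemma R2_mem {d : ℕ} {L : IF K} {v : Fin (d +1 +1) → K} (hv : ∀ i, v i ∈ L) : EM L (R2 d v) := by
  have h := R2_map d L.val (fun i => ⟨v i, hv i⟩)
  have h2 : L.val ∘ (fun i => (⟨v i, hv i⟩ : L)) = v := rfl
  rw [h2] at h
  rw [← h]
  exact fun i j => (R2 d (fun i => (⟨v i, hv i⟩ : L)) i j).2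

lemma caseOdd (k : ℕ) (hk : 1 ≤ k) (hbe : Even b) (hab : 2 * k +1 < b) (hb : 4 < b) (M : Matrix (Fin (2 * k +1 +1)) (FS b) K)
    (hM : AI (ent M)) (hMt : adj (Set.range (ent M)) = ⊤) (σ : GG → AE K)
    (hσ : ∀ γ : GG, M.map (σ γ) = aM K γ.2.2 • (rep (2 * k +1) (ic K γ.1) * M * (rep b (ic K γ.2.1))ᵀ)) : MC (2 * k +1) b σ := by
  obtain ⟨χ, μ, u, f0, C, m, x1, x2, ω, ρ, _, c, w, z, hS, hC, -, hχ, hx1, hx2, hm, hgen⟩ := setup3 (by omega) hab hb (hbe.mul_left _) M hM hMt σ hσ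
    (Fin 2 × Fin 2) (by simp)
  rw [Fintype.card_prod, Fintype.card_fin] at hm
  have har : (2 * k +1 +1) * (b +1) = (2 * k +1) * b + (2 * k +1) + b +1 := by ring
  have hC : ∀ γ, C.map (σ γ) = (aM K γ.2.2) • (rep (2 * k +1) (ic K γ.1) * C) := by
    intro γ; rw [hC, hχ hbe, mul_one]
  have ht : ∀ γ : GG, aM K γ.2.2 ≠0 := fun γ => (map_ne_zero _).2 γ.2.2.ne_zero
  have hind := (ind_of hM hMt hS.u0 (Sum.elim (Sum.elim x1 x2) (ent C)) (fun L' h1 h2 => (hgen L' h1 (fun i => h2 (Sum.inl (Sum.inl i)))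
      (fun i => h2 (Sum.inl (Sum.inr i)))).2 (fun i j => h2 (Sum.inr (i, j)))) (by
        simp only [Fintype.card_sum, Fintype.card_fin, Fintype.card_prod]; rw [har]; omega)).2
  have hCi : AI (ent C) := by
    have h2 := hind.comp Sum.inr Sum.inr_injective
    exact h2
  have hx1i : AI x1 := by
    have h2 := hind.comp (Sum.inl ∘ Sum.inl) (Sum.inl_injective.comp Sum.inl_injective)
    exact h2
  have hvi : AI (C.col 0) := by
    have h2 := hCi.comp (fun i => (i,0)) (fun i j h => (Prod.ext_iff.1 h).1)
    exact h2
  obtain ⟨N, hN⟩ : ∃ N : M2 K, N = Matrix.of fun i j => x1 (i, j) := ⟨_, rfl⟩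
  have hNd : N.det ≠0 := by
    rw [hN]
    refine spec (fun R _ _ x => (Matrix.of fun i j => x (i, j)).det) ?_ hx1i (fun p => (1 : M2 ℂ) p.1 p.2) ?_
    · intro R _ _ S _ _ f x
      rw [det_map']; rfl
    · change (1 : M2 ℂ).det ≠0
      rw [det_one]; exact one_ne_zero
  have hNσ : ∀ γ, N.map (σ γ) = N := by
    intro γ; rw [hN]; ext i j; exact (mFx σ).1 (hx1 (i, j)) γ
  obtain ⟨E, hE, hEL, hEσ⟩ := frameA (by omega) C hCi σ (fun γ => aM K γ.2.2) hC
  have hE0 : E.col 0 ≠0 := by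
    intro h
    exact hE (det_eq_zero_of_column_eq_zero 0 fun i => congrFun h i)
  obtain ⟨Φ, hΦ, hΦL, hΦσ, -⟩ := V2FL (fun γ => (σ γ : K →+* K)) (fun γ => ic K γ.1) (fun γ => icD _) _ _ hE hEL hEσ
    (pw (2 * k) k (E.col 0)) (pw_ne_zero (by omega) hE0)
    (pw_mem (2 * k) k fun i => hEL i 0) (fun _ =>1)
    (fun γ => by
      have h : σ γ ∘ E.col 0 = rep 2 (ic K γ.1) *ᵥ E.col 0 := by
        funext i; exact congrFun (congrFun (hEσ γ) i) 0
      rw [one_smul, rep_pw (by omega), pw_map, ← h]; rfl)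
  simp only [one_smul] at hΦσ
  obtain ⟨ρ', hρ⟩ : ∃ ρ', ρ' = R2 (2 * k) (C.col 0) * Φ := ⟨_, rfl⟩
  have hρσ : ∀ γ, ρ'.map (σ γ) = aM K γ.2.2 • (rep 1 (ic K γ.1) * ρ') := by
    intro γ
    have h : σ γ ∘ C.col 0 = aM K γ.2.2 • (rep (2 * k +1) (ic K γ.1) *ᵥ C.col 0) := by
      funext i; exact congrFun (congrFun (hC γ) i) 0
    have h2 : (R2 (2 * k) (C.col 0)).map (σ γ) = R2 (2 * k) (σ γ ∘ C.col 0) := R2_map _ _ _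
    have h3 : Φ.map (σ γ) = _ := hΦσ γ
    rw [hρ, mapmul, h2, h3, h, R2_smul, Matrix.smul_mul, ← Matrix.mul_assoc, R2_rep _ (icD γ.1), Matrix.mul_assoc]
  have hρL : EM (adj (Set.range (ent C))) ρ' := by
    rw [hρ]
    refine EM.mul (R2_mem ?_) hΦL
    exact fun i => maO ⟨(i,0), rfl⟩
  obtain ⟨s, -, hs⟩ := colsel ρ' (Φ⁻¹.submatrix id (Fin.castLE (by omega) : Fin 2 → Fin (2 * k +1))) (by
    have h := R2_ne (d :=2 * k) (by omega) hvi
    have h2 : ρ' * Φ⁻¹.submatrix id (Fin.castLE (by omega) : Fin 2 → Fin (2 * k +1)) = (R2 (2 * k) (C.col 0)).submatrix id (Fin.castLE (by omega) : Fin 2 → Fin (2 * k +1)) := by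
      have h3 : ρ' * Φ⁻¹ = R2 (2 * k) (C.col 0) := by
        rw [hρ, Matrix.mul_assoc, mul_nonsing_inv _ (ndU hΦ), Matrix.mul_one]
      rw [← h3]; rfl
    rw [h2]; exact h)
  obtain ⟨Q1, hQ1⟩ : ∃ Q1, Q1 = ρ'.submatrix id s := ⟨_, rfl⟩
  rw [← hQ1] at hs
  have hQ1L : EM (adj (Set.range (ent C))) Q1 := fun i j => by rw [hQ1]; exact hρL i (s j)
  obtain ⟨P, hP⟩ : ∃ P, P = Q1 * N := ⟨_, rfl⟩
  have hPd : P.det ≠0 := by rw [hP, det_mul]; exact mul_ne_zero hs hNd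
  have hPσ : ∀ γ, P.map (σ γ) = aM K γ.2.2 • (rep 1 (ic K γ.1) * P) := by
    intro γ
    have h : Q1.map (σ γ) = aM K γ.2.2 • (rep 1 (ic K γ.1) * Q1) := by
      rw [hQ1]; ext i j; exact congrFun (congrFun (hρσ γ) i) (s j)
    rw [hP, mapmul, hNσ, h, Matrix.smul_mul, Matrix.mul_assoc]
  have htd : (tw P).det = P.det := by rw [tw, det_fin_two, det_fin_two]; simp; ring
  have htσ : ∀ γ, (tw P).map (σ γ) = aM K γ.2.2 • (tw P * ic K γ.1) := by
    intro γ
    rw [← tw_cov, ← hPσ]; ext i j; fin_cases i <;> fin_cases j <;> rfl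
  have hdσ : ∀ γ, σ γ P.det = (aM K γ.2.2) ^2 * P.det := by
    intro γ
    have h : ((tw P).map (σ γ)).det = σ γ (tw P).det := (det_map' _ _).symm
    rw [← htd, ← h, htσ, det_smul, det_mul, icD, Fintype.card_fin, mul_one]
  obtain ⟨Ψ, hΨ⟩ : ∃ Ψ, Ψ = (P.det ^ k)⁻¹ • rep (2 * k +1) (tw P) := ⟨_, rfl⟩
  have hΨd : Ψ.det ≠0 := by
    rw [hΨ, det_smul]
    refine mul_ne_zero (pow_ne_zero _ (inv_ne_zero (pow_ne_zero _ hPd))) fun h => ?_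
    have h1 := congrArg Matrix.det (repP (2 * k +1) (tw P) (tw P)⁻¹)
    rw [nonsing_inv_mul _ (ndU (by rw [htd]; exact hPd)), repO, det_mul, h, zero_mul, det_one] at h1
    exact zero_ne_one h1
  have hΨσ : ∀ γ, Ψ.map (σ γ) = aM K γ.2.2 • (rep (2 * k +1) (ic K γ.1) * Ψ) := by
    intro γ
    have h : (rep (2 * k +1) (tw P)).map (σ γ) = rep (2 * k +1) ((tw P).map (σ γ)) := (repM _ _ _).symm
    rw [hΨ, smap, h, htσ, rep_smul, ← repP, map_inv₀, map_pow, hdσ, Matrix.mul_smul, smul_smul, smul_smul]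
    refine congrArg (fun v => v • _) ?_
    have := ht γ
    field_simp
    ring
  have hη : ∀ γ, (Ψ⁻¹ * C).map (σ γ) = Ψ⁻¹ * C := by
    intro γ
    have := quot_map (σ γ) hΨd (rdU _ (icD γ.1)).ne_zero (ht γ) (hΨσ γ) (hC γ)
    rwa [inv_mul_cancel₀ (ht γ), one_smul] at this
  refine hS.odd (by omega) hM hMt P (Sum.elim x2 (ent (Ψ⁻¹ * C))) ?_ hPd hPσ ?_ ?_
  · intro L' h1 h2 h3
    have h4 : EM L' C := by
      rw [show C = Ψ * (Ψ⁻¹ * C) from (mul_nonsing_inv_cancel_left _ _ (ndU hΨd)).symm]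
      refine EM.mul ?_ fun i j => h3 (Sum.inr (i, j))
      have h5 : EM L' (tw P) := by
        intro i j; fin_cases i <;> fin_cases j <;> exact h2 _ _
      intro i j
      rw [hΨ]
      exact L'.mul_mem (inv_mem (pow_mem (EM.det h2) _)) (rep_mem _ h5 i j)
    have h6 : EM L' Q1 := fun i j => adL (x := ent C) (fun p => h4 p.1 p.2) (hQ1L i j)
    have h7 : EM L' N := by
      rw [show N = Q1⁻¹ * P by rw [hP, nonsing_inv_mul_cancel_left _ _ (ndU hs)]]
      exact EM.mul (EM.inv h6) h2
    refine (hgen L' h1 (fun p => ?_) fun i => h3 (Sum.inl i)).2 h4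
    have := h7 p.1 p.2
    rw [hN] at this; exact this
  · rintro (i | p)
    · exact hx2 i
    · exact (mFx σ).2 fun γ => congrFun (congrFun (hη γ) p.1) p.2
  · simp only [Fintype.card_sum, Fintype.card_fin, Fintype.card_prod]
    rw [mul_add]; omega

lemma main_concl (ha : 1 < a) (hab : a < b) (hb : 4 < b) (he : Even (a * b)) (M : MM a b K)
    (hM : AI (ent M)) (hMt : adj (Set.range (ent M)) = ⊤) (σ : GG → AE K)
    (hσ : ∀ γ : GG, M.map (σ γ) = aM K γ.2.2 • (rep a (ic K γ.1) * M * (rep b (ic K γ.2.1))ᵀ)) : MC a b σ := by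
  by_cases h2 : a =2
  · subst h2; exact case2 hb M hM hMt σ hσ
  rcases Nat.even_or_odd a with h | h
  · exact caseEven (by omega) h hab hb M hM hMt σ hσ
  · have h3 : Even b := (Nat.even_mul.1 he).resolve_left (Nat.not_even_iff_odd.2 h)
    obtain ⟨k, rfl⟩ := h
    exact caseOdd k (by omega) h3 hab hb M hM hMt σ hσ
end

section
variable {R : Type} [CommRing R] [IsDomain R] [Algebra ℂ R]

def lft (φ : R →ₐ[ℂ] R) (h : Function.Injective φ) : FractionRing R →ₐ[ℂ] FractionRing R :=
  IsFractionRing.liftAlgHom (A := R) (g := (IsScalarTower.toAlgHom ℂ R (FractionRing R)).comp φ)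
    ((IsFractionRing.injective R (FractionRing R)).comp h)

lemma lft_alg (φ : R →ₐ[ℂ] R) (h : Function.Injective φ) (x : R) :
    lft φ h (algebraMap R _ x) = algebraMap R _ (φ x) := IsFractionRing.lift_algebraMap (A := R) (K := FractionRing R)
    (g := ((IsScalarTower.toAlgHom ℂ R (FractionRing R)).comp φ : R →+* FractionRing R)) ((IsFractionRing.injective R (FractionRing R)).comp h) x

lemma inv_eq {ι : Type} (φ : ι → R →ₐ[ℂ] R) (h : ∀ i, Function.Injective (φ i)) :
    invariantField R φ = Fx (fun i => lft (φ i) (h i)) := by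
  have hi := IsFractionRing.injective R (FractionRing R)
  have key : ∀ (f g : R), g ≠0 → ∀ i, (lft (φ i) (h i) (algebraMap R (FractionRing R) f / algebraMap R (FractionRing R) g) =
      algebraMap R (FractionRing R) f / algebraMap R (FractionRing R) g ↔ φ i f * g = φ i g * f) := by
    intro f g hg i
    have h1 : algebraMap R (FractionRing R) g ≠0 := fun h => hg ((map_eq_zero_iff _ hi).1 h)
    have h2 : algebraMap R (FractionRing R) (φ i g) ≠0 := fun h' => hg ((map_eq_zero_iff _ (h i)).1 ((map_eq_zero_iff _ hi).1 h'))
    rw [map_div₀, lft_alg, lft_alg, div_eq_div_iff h2 h1, ← map_mul, ← map_mul, hi.eq_iff, mul_comm f]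
  ext x
  constructor
  · rintro ⟨f, g, hg, rfl, hf⟩
    exact (mFx _).2 fun i => (key f g hg i).2 (hf i)
  · intro hx
    obtain ⟨f, g, hg, rfl⟩ := IsFractionRing.div_surjective (A := R) x
    exact ⟨f, g, nonZeroDivisors.ne_zero hg, rfl, fun i => (key f g (nonZeroDivisors.ne_zero hg) i).1 ((mFx _).1 hx i)⟩
end

section
variable {ι : Type}

def xx (i : ι) : FractionRing (MvPolynomial ι ℂ) := algebraMap (MvPolynomial ι ℂ) _ (X i)

lemma aeval_xx (f : MvPolynomial ι ℂ) : aeval xx f = algebraMap _ (FractionRing (MvPolynomial ι ℂ)) f := by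
  have : aeval xx = IsScalarTower.toAlgHom ℂ (MvPolynomial ι ℂ) (FractionRing (MvPolynomial ι ℂ)) := by
    ext i; rw [aeval_X]; rfl
  rw [this]; rfl

lemma xx_ind : AI (xx (ι := ι)) := by
  rw [algebraicIndependent_iff]
  intro p hp
  rw [aeval_xx] at hp
  exact (map_eq_zero_iff _ (IsFractionRing.injective _ _)).1 hp

lemma xx_top : adj (Set.range (xx (ι := ι))) = ⊤ := by
  have h : ∀ f : MvPolynomial ι ℂ, algebraMap _ (FractionRing (MvPolynomial ι ℂ)) f ∈ adj (Set.range (xx (ι := ι))) := by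
    intro f
    rw [← aeval_xx]
    exact IntermediateField.algebra_adjoin_le_adjoin ℂ _ (by
      rw [Algebra.adjoin_range_eq_range_aeval]; exact ⟨f, rfl⟩)
  refine top_le_iff.1 fun x _ => ?_
  obtain ⟨f, g, hg, rfl⟩ := IsFractionRing.div_surjective (A := MvPolynomial ι ℂ) x
  exact div_mem (h f) (h g)

lemma lin_inj [Fintype ι] [DecidableEq ι] (G H : Matrix ι ι ℂ) (h : G * H =1) (φ : MvPolynomial ι ℂ →ₐ[ℂ] MvPolynomial ι ℂ)
    (hφ : ∀ p, φ (X p) = ∑ q, C (G p q) * X q) : Function.Injective φ := by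
  have h2 : (aeval (fun p => ∑ q, C (H p q) * X q) : MvPolynomial ι ℂ →ₐ[ℂ] MvPolynomial ι ℂ).comp φ = AlgHom.id ℂ _ := by
    ext1 p
    rw [AlgHom.comp_apply, hφ, map_sum, AlgHom.id_apply]
    simp only [map_mul, aeval_C, aeval_X, Finset.mul_sum]
    rw [Finset.sum_comm]
    have : ∀ q, ∑ r, (aM (MvPolynomial ι ℂ)) (G p r) * (C (H r q) * X q) = C ((1 : Matrix ι ι ℂ) p q) * X q := by
      intro q
      rw [← h, Matrix.mul_apply, map_sum, Finset.sum_mul]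
      refine Finset.sum_congr rfl fun r _ => ?_
      rw [map_mul, mul_assoc]; rfl
    simp only [this]
    rw [Finset.sum_eq_single p]
    · rw [one_apply_eq, C_1, one_mul]
    · intro q _ hq; rw [one_apply_ne' hq, C_0, zero_mul]
    · simp
  intro x y hxy
  have h3 := DFunLike.congr_fun h2 x
  have h4 := DFunLike.congr_fun h2 y
  rw [AlgHom.comp_apply, AlgHom.id_apply] at h3 h4
  rw [← h3, ← h4, hxy]
end

lemma rep_inv (d : ℕ) (g : SL2) (t : ℂˣ) : ((t : ℂ) • rep d g.1) * (((t⁻¹ : ℂˣ) : ℂ) • rep d (g⁻¹).1) =1 := by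
  rw [Matrix.smul_mul, Matrix.mul_smul, smul_smul, Units.mul_inv, one_smul, repP]
  have : (g⁻¹).1 * g.1 =1 := by
    have := congrArg Subtype.val (inv_mul_cancel g); exact this
  rw [this, repO]

lemma injB (b : ℕ) (g : SL2) (t : ℂˣ) : Function.Injective (coordHomB b g t) := by
  refine lin_inj _ _ (rep_inv b g t) _ fun p => ?_
  rw [coordHomB, aeval_X, Finset.smul_sum]
  refine Finset.sum_congr rfl fun q _ => ?_
  rw [← repMat_eq, smul_eq_C_mul, ← mul_assoc, ← map_mul]; rfl

lemma injAB (a b : ℕ) (g h : SL2) (t : ℂˣ) : Function.Injective (coordHomAB a b g h t) := by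
  refine lin_inj (kroneckerMap (· * ·) ((t : ℂ) • rep a g.1) (((1 : ℂˣ) : ℂ) • rep b h.1))
    (kroneckerMap (· * ·) (((t⁻¹ : ℂˣ) : ℂ) • rep a (g⁻¹).1) (((1⁻¹ : ℂˣ) : ℂ) • rep b (h⁻¹).1)) ?_ _ fun p => ?_
  · have := mul_kronecker_mul ((t : ℂ) • rep a g.1) (((t⁻¹ : ℂˣ) : ℂ) • rep a (g⁻¹).1) (((1 : ℂˣ) : ℂ) • rep b h.1) (((1⁻¹ : ℂˣ) : ℂ) • rep b (h⁻¹).1)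
    rw [rep_inv, rep_inv, one_kronecker_one] at this
    exact this.symm
  · rw [coordHomAB, aeval_X, Finset.smul_sum]
    refine Finset.sum_congr rfl fun q _ => ?_
    rw [← repMat_eq, ← repMat_eq, smul_eq_C_mul, ← mul_assoc, ← map_mul]
    simp [kroneckerMap_apply, mul_assoc]

section
variable {K K' : Type} [Field K] [Algebra ℂ K] [Field K'] [Algebra ℂ K']

lemma fin_equiv {N : ℕ} (F E : IF K) (T : Fin N → K) (hT : AlgebraicIndependent F T) (hE : E = F ⊔ AR T)
    (F' : Type) [Field F'] [Algebra ℂ F'] (e : F' ≃ₐ[ℂ] F) : Nonempty (E ≃ₐ[ℂ] FractionRing (MvPolynomial (Fin N) F')) := by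
  let g : MvPolynomial (Fin N) F' →ₐ[ℂ] K := ((aeval T : MvPolynomial (Fin N) F →ₐ[F] K).restrictScalars ℂ).comp
    (mapAlgHom (e : F' →ₐ[ℂ] F))
  have hg : Function.Injective g := by
    have h1 := algebraicIndependent_iff_injective_aeval.1 hT
    have h2 := map_injective (σ := Fin N) (e : F' →+* F) e.injective
    intro x y h
    exact h2 (h1 h)
  let i : FractionRing (MvPolynomial (Fin N) F') →ₐ[ℂ] K := IsFractionRing.liftAlgHom hg
  have hi : ∀ x, i (algebraMap _ _ x) = g x := fun x => IsFractionRing.lift_algebraMap (A := MvPolynomial (Fin N) F') hg x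
  have hr : i.fieldRange = E := by
    apply le_antisymm
    · rintro _ ⟨x, rfl⟩
      obtain ⟨f, h, hh, rfl⟩ := IsFractionRing.div_surjective (A := MvPolynomial (Fin N) F') x
      have h2 : ∀ f, g f ∈ E := by
        intro f
        rw [hE]
        exact aeval_mem_sup F T _
      change i _ ∈ E
      rw [map_div₀, hi, hi]
      exact div_mem (h2 _) (h2 _)
    · rw [hE]
      refine saL (fun x hx => ?_) fun j => ?_
      · refine ⟨algebraMap (MvPolynomial (Fin N) F') _ (C (e.symm ⟨x, hx⟩)), ?_⟩
        change i _ = _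
        rw [hi]
        change aeval T (MvPolynomial.map _ (C _)) = _
        rw [map_C, aeval_C]
        change ((e (e.symm _) : F) : K) = _
        rw [e.apply_symm_apply]
      · refine ⟨algebraMap (MvPolynomial (Fin N) F') _ (X j), ?_⟩
        change i _ = _
        rw [hi]
        change aeval T (MvPolynomial.map _ (X _)) = _
        rw [map_X, aeval_X]
  exact ⟨((AlgEquiv.ofInjectiveField i).trans (IntermediateField.equivOfEq hr)).symm⟩


lemma mm0 {b : ℕ} {A : MM b b K} {u : FS b → K} (hu0 : u 0 =1) {τ : AE K} {m : K}
    (h : τ ∘ u = m • (A *ᵥ u)) (i) : τ (u i) = (A *ᵥ u) i / (A *ᵥ u) 0 := by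
  have h1 : 1 = m * (A *ᵥ u) 0 := by
    have := congrFun h 0
    rw [Function.comp, hu0, map_one] at this; exact this
  have h2 : τ (u i) = m * (A *ᵥ u) i := congrFun h i
  have h3 : (A *ᵥ u) 0 ≠0 := by rintro h; rw [h, mul_zero] at h1; exact one_ne_zero h1
  rw [h2, eq_div_iff h3]; linear_combination -(A *ᵥ u) i * h1

end

section
variable {K K' : Type} [Field K] [Algebra ℂ K] [Field K'] [Algebra ℂ K']

lemma tr_e {ι : Type} {u : ι → K} {v : ι → K'} (hu : AI u) (hv : AI v)
    (U : IF K) (V : IF K') (hU : U = AR u) (hV : V = AR v) :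
    ∃ f : U →ₐ[ℂ] K', (∀ i (h : u i ∈ U), f ⟨u i, h⟩ = v i) ∧ ∀ z, z ∈ V ↔ ∃ y, f y = z := by
  subst hU hV
  refine ⟨(AR v).val.comp (hu.aevalEquivField.symm.trans hv.aevalEquivField : AR u →ₐ[ℂ] AR v), fun i h => ?_, fun z => ⟨fun hz => ?_, ?_⟩⟩
  · have h1 : hu.aevalEquivField.symm ⟨u i, h⟩ = algebraMap (MvPolynomial ι ℂ) _ (X i) := by
      rw [AlgEquiv.symm_apply_eq]
      apply Subtype.ext
      have := hu.aevalEquivField_algebraMap_apply_coe (X i)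
      rw [this, aeval_X]
    change ((hv.aevalEquivField (hu.aevalEquivField.symm ⟨u i, h⟩) : _) : K') = _
    rw [h1]
    have := hv.aevalEquivField_algebraMap_apply_coe (X i)
    rw [this, aeval_X]
  · obtain ⟨y, hy⟩ := (hu.aevalEquivField.symm.trans hv.aevalEquivField).surjective ⟨z, hz⟩
    exact ⟨y, congrArg Subtype.val hy⟩
  · rintro ⟨y, rfl⟩
    exact ((hu.aevalEquivField.symm.trans hv.aevalEquivField) y).2

lemma succ_adj {b : ℕ} (u : FS b → K) (hu0 : u 0 =1) : AR u = adj (Set.range (fun i : Fin b => u i.succ)) := by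
  apply le_antisymm
  · refine adL fun i => Fin.cases ?_ (fun i => maO ⟨i, rfl⟩) i
    rw [hu0]; exact one_mem _
  · exact adL fun i => maO ⟨_, rfl⟩

lemma two {b : ℕ} {Γ Δ : Type} (u : FS b → K) (v : FS b → K') (hu0 : u 0 =1) (hv0 : v 0 =1)
    (hu : AI (fun i : Fin b => u i.succ)) (hv : AI (fun i : Fin b => v i.succ))
    (U : IF K) (V : IF K') (hU : U = AR u) (hV : V = AR v)
    (σ : Γ → AE K) (τ : Δ → K' →ₐ[ℂ] K') (g : Γ → SL2) (h : Δ → SL2) (hg : ∀ d, ∃ c, g c = h d) (hh : ∀ c, ∃ d, h d = g c)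
    (m : Γ → K) (n : Δ → K') (hσ : ∀ c, σ c ∘ u = m c • (rep b (ic K (g c)) *ᵥ u)) (hτ : ∀ d, τ d ∘ v = n d • (rep b (ic K' (h d)) *ᵥ v)) :
    Nonempty (↥(U ⊓ Fx σ) ≃ₐ[ℂ] ↥(V ⊓ Fx τ)) := by
  obtain ⟨f, hf0, hfr⟩ := tr_e hu hv U V (hU.trans (succ_adj u hu0)) (hV.trans (succ_adj v hv0))
  have huU : ∀ i, u i ∈ U := fun i => by rw [hU]; exact maO ⟨i, rfl⟩
  have hf : ∀ i, f ⟨u i, huU i⟩ = v i := by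
    intro i
    refine Fin.cases ?_ (fun i => hf0 i (huU i.succ)) i
    have : (⟨u 0, huU 0⟩ : U) =1 := Subtype.ext hu0
    rw [this, map_one, hv0]
  have hA : ∀ (g : SL2) i, (rep b (ic K g) *ᵥ u) i ∈ U := fun g i => rep2_mem _ g huU i
  have hfA : ∀ (g : SL2) i, f ⟨(rep b (ic K g) *ᵥ u) i, hA g i⟩ = (rep b (ic K' g) *ᵥ v) i := by
    intro g i
    have h0 : (rep b (ic K g) *ᵥ u) i = ∑ j, aM K (rep b g.1 i j) * u j := by
      rw [show rep b (ic K g) = (rep b g.1).map (aM K) from repM _ _ _]; rfl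
    have h1 : (⟨(rep b (ic K g) *ᵥ u) i, hA g i⟩ : U) = ∑ j, aM U (rep b g.1 i j) * ⟨u j, huU j⟩ := by
      apply Subtype.ext
      rw [IntermediateField.coe_sum]
      exact h0
    rw [h1, map_sum, show rep b (ic K' g) = (rep b g.1).map (aM K') from repM _ _ _]
    refine Finset.sum_congr rfl fun j _ => ?_
    rw [map_mul, hf, AlgHom.commutes]; rfl
  have hst : ∀ c, ∀ y ∈ U, σ c y ∈ U := by
    intro c y hy
    refine pres (U := ⊥) (x := u) (σ c) ?_ ?_ y ?_
    · rintro _ ⟨z, rfl⟩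
      change σ c (aM K z) ∈ U
      rw [AlgHom.commutes]; exact U.algebraMap_mem z
    · intro i
      rw [mm0 hu0 (hσ c)]
      exact div_mem (hA _ _) (hA _ _)
    · rw [bot_sup_eq, ← hU]; exact hy
  have key : ∀ c d, g c = h d → ∀ y : U, f ⟨σ c y, hst c y y.2⟩ = τ d (f y) := by
    intro c d hcd
    obtain ⟨s, hs⟩ : ∃ s : U →ₐ[ℂ] U, ∀ y, s y = ⟨σ c y, hst c y y.2⟩ :=
      ⟨((σ c).comp U.val).codRestrict U.toSubalgebra (fun y => hst c y y.2), fun y => rfl⟩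
    have h5 : f.comp s = (τ d).comp f := by
      refine IntermediateField.algHom_ext_of_eq_adjoin _ hU ?_
      rintro _ ⟨i, rfl⟩
      rw [AlgHom.comp_apply, AlgHom.comp_apply, hs, hf, mm0 hv0 (hτ d), ← hcd, ← hfA, ← hfA, ← map_div₀]
      exact congrArg f (Subtype.ext (mm0 hu0 (hσ c) i))
    intro y
    rw [← hs]
    exact DFunLike.congr_fun h5 y
  obtain ⟨i, hi⟩ : ∃ i : ↥(U ⊓ Fx σ) →ₐ[ℂ] K', ∀ y, i y = f ⟨y.1, y.2.1⟩ := ⟨f.comp (IntermediateField.inclusion inf_le_left), fun y => rfl⟩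
  have hr : i.fieldRange = V ⊓ Fx τ := by
    ext z
    constructor
    · rintro ⟨y, hy⟩
      have hy : i y = z := hy
      rw [hi] at hy
      refine ⟨(hfr z).2 ⟨_, hy⟩, (mFx τ).2 fun d => ?_⟩
      obtain ⟨c, hc⟩ := hg d
      have h6 := key c d hc ⟨y.1, y.2.1⟩
      rw [hy] at h6
      rw [← h6, ← hy]
      exact congrArg f (Subtype.ext ((mFx σ).1 y.2.2 c))
    · rintro ⟨h1, h2⟩
      obtain ⟨y, hy⟩ := (hfr z).1 h1
      have h4 : y.1 ∈ Fx σ := (mFx σ).2 fun c => by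
        obtain ⟨d, hd⟩ := hh c
        have h3 := key c d hd.symm y
        rw [hy, (mFx τ).1 h2, ← hy] at h3
        exact congrArg Subtype.val (f.toRingHom.injective h3)
      exact ⟨⟨y.1, y.2, h4⟩, (hi _).trans hy⟩
  exact ⟨(AlgEquiv.ofInjectiveField i).trans (IntermediateField.equivOfEq hr)⟩
end

abbrev FF (ι : Type) := FractionRing (MvPolynomial ι ℂ)

section
variable {K K' : Type} [Field K] [Algebra ℂ K] [Field K'] [Algebra ℂ K']

lemma ic1 : ic K 1 =1 := by
  have : (1 : SL2).1 =1 := rfl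
  rw [ic, this, Matrix.map_one _ (map_zero _) (map_one _)]

lemma hyps {b : ℕ} {x : FS b → K'} (hxi : AI x) (hxt : AR x = ⊤) (τ : SL2 × ℂˣ → K' →ₐ[ℂ] K')
    (hτ : ∀ d, τ d ∘ x = aM K' (d.2 : ℂ) • (rep b (ic K' d.1) *ᵥ x)) : ∃ (v : FS b → K') (n : SL2 × ℂˣ → K'),
    v 0 =1 ∧ AI (fun i : Fin b => v i.succ) ∧
    (∀ d, τ d ∘ v = n d • (rep b (ic K' d.1) *ᵥ v)) ∧ Fx τ = AR v ⊓ Fx τ := by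
  have hx0 : ∀ i : FS b, x i ≠0 := fun i => hxi.ne_zero i
  obtain ⟨v, hv⟩ : ∃ v : FS b → K', v = (x 0)⁻¹ • x := ⟨_, rfl⟩
  have hxv : ∀ i, x i = x 0 * v i := by intro i; rw [hv]; exact (mul_inv_cancel_left₀ (hx0 0) _).symm
  have hv0 : v 0 =1 := by rw [hv]; exact inv_mul_cancel₀ (hx0 0)
  have hvi : AI (fun i : Fin b => v i.succ) := by
    have h := count (Sum.elim (fun i : Fin b => v i.succ) (fun _ : Unit => x 0)) x hxi hxt
      (gen_le hxt fun i => by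
        have h0 : x 0 ∈ adj (Set.range (Sum.elim (fun i : Fin b => v i.succ) (fun _ : Unit => x 0))) := maO ⟨Sum.inr (), rfl⟩
        refine Fin.cases h0 (fun i => ?_) i
        have h1 : v i.succ ∈ adj (Set.range (Sum.elim (fun i : Fin b => v i.succ) (fun _ : Unit => x 0))) := maO ⟨Sum.inl i, rfl⟩
        have h := mul_mem h0 h1
        rw [← hxv i.succ] at h
        exact h) (by simp)
    have h2 := h.comp Sum.inl Sum.inl_injective
    exact h2
  have hτv : ∀ d, τ d ∘ v = ((τ d (x 0))⁻¹ * (aM K' (d.2 : ℂ)) * x 0) • (rep b (ic K' d.1) *ᵥ v) := by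
    intro d
    have h1 : τ d ∘ v = (τ d (x 0))⁻¹ • (τ d ∘ x) := by
      funext i
      rw [hv]
      change τ d ((x 0)⁻¹ * x i) = _
      rw [map_mul, map_inv₀]; rfl
    have h2 : rep b (ic K' d.1) *ᵥ x = x 0 • (rep b (ic K' d.1) *ᵥ v) := by
      rw [← mulVec_smul]; exact congrArg (fun w => rep b (ic K' d.1) *ᵥ w) (funext hxv)
    rw [h1, hτ, h2, smul_smul, smul_smul]
  refine ⟨v, _, hv0, hvi, hτv, ?_⟩
  rw [eq_comm, inf_eq_right]
  intro y hy
  refine tlem (AR v) (x 0) (hx0 0) (x := y) ?_ fun t ht => ⟨τ (1, Units.mk0 t ht), (mFx τ).1 hy _, ?_, ?_⟩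
  · have : AR v ⊔ adj {x 0} = ⊤ := by
      refine gen_le hxt fun i => ?_
      have h1 : x 0 ∈ AR v ⊔ adj {x 0} := SetLike.le_def.1 le_sup_right (maO (Set.mem_singleton _))
      have h2 : v i ∈ AR v ⊔ adj {x 0} := SetLike.le_def.1 le_sup_left (maO (Set.mem_range_self i))
      have h := mul_mem h1 h2
      rw [← hxv i] at h
      exact h
    rw [this]; trivial
  · refine fix_adj v _ fun i => ?_
    have h1 := mm0 hv0 (hτv (1, Units.mk0 t ht)) i
    rw [ic1, repO, one_mulVec, hv0, div_one] at h1
    exact h1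
  · have h1 := congrFun (hτ (1, Units.mk0 t ht)) 0
    rw [ic1, repO, one_mulVec] at h1
    exact h1

lemma fin_all {a b : ℕ} (ha : 1 < a) (hab : a < b) (hb : 4 < b) (hev : Even (a * b)) (M : MM a b K)
    (hM : AI (ent M)) (hMt : adj (Set.range (ent M)) = ⊤) (σ : GG → AE K)
    (hσ : ∀ γ : GG, M.map (σ γ) = aM K γ.2.2 • (rep a (ic K γ.1) * M * (rep b (ic K γ.2.1))ᵀ))
    {x : FS b → K'} (hxi : AI x) (hxt : AR x = ⊤) (τ' : SL2 × ℂˣ → K' →ₐ[ℂ] K')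
    (hτ : ∀ d, τ' d ∘ x = aM K' (d.2 : ℂ) • (rep b (ic K' d.1) *ᵥ x)) (F : IF K) (F' : IF K')
    (hF : F = Fx σ) (hF' : F' = Fx τ') :
    Nonempty (F ≃ₐ[ℂ] FractionRing (MvPolynomial (Fin (a * (b +1) -3)) F')) := by
  obtain ⟨u, m, hu0, hu, hum, τ, _, T, hc, hT, hE⟩ := main_concl ha hab hb hev M hM hMt σ hσ
  obtain ⟨v, n, hv0, hv, hvn, hB⟩ := hyps hxi hxt τ' hτ
  obtain ⟨e⟩ := two v u hv0 hu0 hv hu _ _ rfl rfl τ' σ (fun d => d.1) (fun γ => γ.2.1) (fun γ => ⟨(γ.2.1,1), rfl⟩) (fun d => ⟨(1, d.1,1), rfl⟩) n m hvn hum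
  let q : Fin (a * (b +1) -3) ≃ τ := (Fintype.equivFinOfCardEq hc).symm
  refine fin_equiv (AR u ⊓ Fx σ) F (T ∘ q) (hT.comp q q.injective) ?_ F' ((IntermediateField.equivOfEq (hF'.trans hB)).trans e)
  rw [q.surjective.range_comp, hF]
  exact hE
end

lemma xx_tau {b : ℕ} (g : SL2) (t : ℂˣ) :
    lft (coordHomB b g t) (injB b g t) ∘ xx = aM (FF (FS b)) (t : ℂ) • (rep b (ic (FF (FS b)) g) *ᵥ xx) := by
  funext i
  rw [show rep b (ic (FF (FS b)) g) = (rep b g.1).map (aM (FF (FS b))) from repM _ _ _]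
  rw [Function.comp, xx, lft_alg, coordHomB, aeval_X, ← repMat_eq, smul_eq_C_mul, map_mul, map_sum]
  simp only [map_mul]
  rfl

def XX (a b : ℕ) : Matrix (FS a) (FS b) (FF (FS a × FS b)) := Matrix.of fun i j => xx (i, j)

lemma AB_hyp (a b : ℕ) (γ : GG) :
    (XX a b).map (lft (coordHomAB a b γ.1 γ.2.1 γ.2.2) (injAB a b γ.1 γ.2.1 γ.2.2)) =
      aM (FF (FS a × FS b)) (γ.2.2 : ℂ) • (rep a (ic (FF (FS a × FS b)) γ.1) * XX a b * (rep b (ic (FF (FS a × FS b)) γ.2.1))ᵀ) := by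
  ext i j
  rw [show rep a (ic (FF (FS a × FS b)) γ.1) = (rep a γ.1.1).map (aM (FF (FS a × FS b))) from repM _ _ _,
    show rep b (ic (FF (FS a × FS b)) γ.2.1) = (rep b γ.2.1.1).map (aM (FF (FS a × FS b))) from repM _ _ _]
  rw [Matrix.smul_apply, Matrix.mul_apply, map_apply, XX, of_apply, xx, lft_alg, coordHomAB, aeval_X, ← repMat_eq, ← repMat_eq, smul_eq_C_mul, map_mul, map_sum, Fintype.sum_prod_type_right]
  refine congrArg (fun v => _ * v) (Finset.sum_congr rfl fun q _ => ?_)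
  rw [Matrix.mul_apply, Finset.sum_mul]
  refine Finset.sum_congr rfl fun p _ => ?_
  rw [map_mul, C_mul, map_mul]
  exact mul_right_comm _ _ _

end QB

/-- For `1 < a < b`, `b > 4` and `ab` even, `P(V_{a,b})/(SL₂×SL₂)` is birational to
`ℂ^{a(b+1)-3} × (P(V_b)/SL₂)`: the invariant field of `P(V_{a,b})` is a purely transcendental
extension of the invariant field of `P(V_b)` of transcendence degree `a(b+1) - 3`. -/
theorem quotient_birational_to_PVb (a b : ℕ) (ha : 1 < a) (hab : a < b) (hb : 4 < b)
    (hev : Even (a * b)) :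
    Nonempty ((invFieldAB a b) ≃ₐ[ℂ]
      FractionRing (MvPolynomial (Fin (a * (b + 1) - 3)) (invFieldB b))) := by
  exact QB.fin_all ha hab hb hev (QB.XX a b) QB.xx_ind QB.xx_top _ (QB.AB_hyp a b) QB.xx_ind QB.xx_top _ (fun d => QB.xx_tau d.1 d.2) _ _
    (QB.inv_eq _ fun γ : QB.GG => QB.injAB a b γ.1 γ.2.1 γ.2.2) (QB.inv_eq _ fun d : SL2 × ℂˣ => QB.injB b d.1 d.2)
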